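/- arXiv:math/0601623 — 4 statements merged into one kernel-verified Lean document; each statement's English description precedes it below -/
import Mathlib

section
/- Let G be a simple graph in which every vertex has degree at most 4, and let v be a vertex of G. Then there is a partial strong edge-coloring of G using at most 21 colors whose domain is exactly the set of edges of G that are not incident to v. -/
/-- Two edges of `G` conflict in a strong edge-coloring: they share an endpoint,
or some endpoint of one is adjacent in `G` to some endpoint of the other. -/
def StrongConflict {V : Type*} (G : SimpleGraph V) (e f : Sym2 V) : Prop :=
  (∃ v, v ∈ e ∧ v ∈ f) ∨ (∃ u v, u ∈ e ∧ v ∈ f ∧ G.Adj u v)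

/-- A partial strong edge-coloring of `G` with `k` colors, presented as an
`Option`-valued function on the edges (`none` = uncolored): distinct conflicting
edges never receive the same color. -/
def IsPartialStrongEdgeColoring {V : Type*} (G : SimpleGraph V) {k : ℕ}
    (C : G.edgeSet → Option (Fin k)) : Prop :=
  ∀ e f : G.edgeSet, e ≠ f → StrongConflict G (e : Sym2 V) (f : Sym2 V) →
    ∀ a : Fin k, C e = some a → C f ≠ some a

namespace StrongEdge

open Finset
open scoped Classical

section

theorem conflict_symm {V : Type*} {G : SimpleGraph V} {e f : Sym2 V}
    (h : StrongConflict G e f) : StrongConflict G f e := by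
  rcases h with ⟨v, h1, h2⟩ | ⟨u, v, h1, h2, h3⟩
  · exact Or.inl ⟨v, h2, h1⟩
  · exact Or.inr ⟨v, u, h2, h1, h3.symm⟩

variable {V : Type*} [Fintype V]

/-- The neighbors of `x`. -/
noncomputable def nb (G : SimpleGraph V) (x : V) : Finset V := univ.filter (G.Adj x)

/-- The edges of `G`. -/
noncomputable def edges (G : SimpleGraph V) : Finset (Sym2 V) := univ.filter (· ∈ G.edgeSet)

/-- The edges that conflict with `e`. -/
noncomputable def seen (G : SimpleGraph V) (e : Sym2 V) : Finset (Sym2 V) :=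
  (edges G).filter fun f => e ≠ f ∧ StrongConflict G e f

/-- The edges joining `z` to neighbors outside `X`. -/
noncomputable def fan (G : SimpleGraph V) (z : V) (X : Finset V) : Finset (Sym2 V) :=
  (nb G z \ X).image fun q => s(z, q)

/-- `c` is a strong edge-coloring on the edges in `S`. -/
def Proper (G : SimpleGraph V) (S : Finset (Sym2 V)) (c : Sym2 V → Fin 21) : Prop :=
  ∀ e ∈ S, ∀ f ∈ S, e ≠ f → StrongConflict G e f → c e ≠ c f

variable {G : SimpleGraph V}

@[simp] theorem mem_nb {x y : V} : y ∈ nb G x ↔ G.Adj x y := by simp [nb]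

@[simp] theorem mem_edges {e : Sym2 V} : e ∈ edges G ↔ e ∈ G.edgeSet := by simp [edges]

theorem mk_mem_edges {x y : V} : s(x, y) ∈ edges G ↔ G.Adj x y := by simp

theorem mem_seen {e f : Sym2 V} :
    f ∈ seen G e ↔ f ∈ edges G ∧ e ≠ f ∧ StrongConflict G e f := by simp [seen]

theorem exists_of_mem_seen {x y : V} (hxy : G.Adj x y) {f : Sym2 V} (hf : f ∈ seen G s(x, y)) :
    ∃ z q, f = s(z, q) ∧ G.Adj z q ∧ s(x, y) ≠ s(z, q) ∧ (G.Adj x z ∨ G.Adj y z) := by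
  obtain ⟨hf, hne, hc⟩ := mem_seen.1 hf
  induction f using Sym2.ind with
  | _ p q =>
    have hpq := mk_mem_edges.1 hf
    simp only [StrongConflict, Sym2.mem_iff] at hc
    have key : (G.Adj x p ∨ G.Adj y p) ∨ (G.Adj x q ∨ G.Adj y q) := by
      rcases hc with ⟨v, rfl | rfl, rfl | rfl⟩ | ⟨u, v, rfl | rfl, rfl | rfl, h⟩ <;>
        simp_all [G.adj_comm]
    rcases key with h | h
    · exact ⟨p, q, rfl, hpq, hne, h⟩
    · exact ⟨q, p, Sym2.eq_swap, hpq.symm, fun h' => hne (h'.trans Sym2.eq_swap), h⟩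

theorem mem_fan {z q : V} {X : Finset V} (h : G.Adj z q) (hq : q ∉ X) : s(z, q) ∈ fan G z X :=
  mem_image.2 ⟨q, by simp [h, hq], rfl⟩

theorem exists_of_mem_fan {z : V} {X : Finset V} {f : Sym2 V} (h : f ∈ fan G z X) :
    ∃ q, G.Adj z q ∧ q ∉ X ∧ f = s(z, q) := by
  obtain ⟨q, hq, rfl⟩ := mem_image.1 h
  simp only [mem_sdiff, mem_nb] at hq
  exact ⟨q, hq.1, hq.2, rfl⟩

theorem card_fan_add_le (hdeg : ∀ x, #(nb G x) ≤ 4) {z : V} {X : Finset V}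
    (hX : ∀ q ∈ X, G.Adj z q) : #(fan G z X) + #X ≤ 4 := by
  have h1 : #(fan G z X) ≤ #(nb G z \ X) := card_image_le
  have h2 := card_sdiff_add_card_eq_card (s := X) (t := nb G z) (fun q hq => by simp [hX q hq])
  have := hdeg z
  omega

theorem card_fan_one (hdeg : ∀ x, #(nb G x) ≤ 4) {z a : V} (h : G.Adj z a) :
    #(fan G z {a}) ≤ 3 := by
  have := card_fan_add_le hdeg (z := z) (X := {a}) (by simpa using h)
  simp at this; omega

theorem card_fan_two (hdeg : ∀ x, #(nb G x) ≤ 4) {z a b : V} (h : G.Adj z a) (h' : G.Adj z b)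
    (hab : a ≠ b) : #(fan G z {a, b}) ≤ 2 := by
  have := card_fan_add_le hdeg (z := z) (X := {a, b}) (by simp [h, h'])
  rw [card_pair hab] at this; omega

/-- The union of the fans `fan G z {a}` over the neighbors `z` of `a` outside `X`. -/
noncomputable def far (G : SimpleGraph V) (a : V) (X : Finset V) : Finset (Sym2 V) :=
  (nb G a \ X).biUnion fun z => fan G z {a}

theorem card_far_add_le (hdeg : ∀ x, #(nb G x) ≤ 4) {a : V} {X : Finset V}
    (hX : ∀ q ∈ X, G.Adj a q) : #(far G a X) + 3 * #X ≤ 12 := by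
  have h1 : #(far G a X) ≤ #(nb G a \ X) * 3 :=
    card_biUnion_le_card_mul _ _ _ fun z hz => card_fan_one hdeg (by
      simp only [mem_sdiff, mem_nb] at hz; exact hz.1.symm)
  have h2 := card_sdiff_add_card_eq_card (s := X) (t := nb G a) (fun q hq => by simp [hX q hq])
  have := hdeg a
  omega

theorem mem_far {a z q : V} {X : Finset V} (h : G.Adj z q) (haz : G.Adj a z) (hz : z ∉ X)
    (hq : q ≠ a) : s(z, q) ∈ far G a X :=
  mem_biUnion.2 ⟨z, by simp [haz, hz], mem_fan h (by simpa using hq)⟩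

theorem exists_color {s : Finset (Fin 21)} (h : #s ≤ 20) : ∃ a, a ∉ s := by
  by_contra! hs
  have : s = univ := eq_univ_iff_forall.2 hs
  subst this
  simp at h

theorem Proper.update {S : Finset (Sym2 V)} {c : Sym2 V → Fin 21} {e : Sym2 V} {a : Fin 21}
    (hS : S ⊆ edges G) (hc : Proper G (S.erase e) c)
    (ha : ∀ f ∈ seen G e, f ∈ S → c f ≠ a) : Proper G S (Function.update c e a) := by
  intro f hf g hg hne hcf
  by_cases h1 : f = e
  · subst h1
    rw [Function.update_self, Function.update_of_ne hne.symm]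
    exact (ha g (mem_seen.2 ⟨hS hg, hne, hcf⟩) hg).symm
  · rw [Function.update_of_ne h1]
    by_cases h2 : g = e
    · subst h2
      rw [Function.update_self]
      exact ha f (mem_seen.2 ⟨hS hf, hne.symm, conflict_symm hcf⟩) hf
    · rw [Function.update_of_ne h2]
      exact hc f (mem_erase.2 ⟨h1, hf⟩) g (mem_erase.2 ⟨h2, hg⟩) hne hcf

/-- `P` is maximal for the process that adds edges whose coloring can be postponed, relative to
the precolored edges `K`. -/
def Saturated (G : SimpleGraph V) (K P : Finset (Sym2 V)) (c₀ : Sym2 V → Fin 21) : Prop :=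
  ∀ e ∈ edges G, e ∉ P → e ∉ K → 21 ≤ #(seen G e \ (P ∪ K)) + #((seen G e ∩ K).image c₀)

theorem exists_saturated (K U : Finset (Sym2 V)) (c₀ : Sym2 V → Fin 21)
    (hKU : Disjoint K U) (hc₀ : Proper G K c₀) :
    ∃ P, U ⊆ P ∧ Disjoint K P ∧ Saturated G K P c₀ ∧
      (edges G ⊆ P ∪ K → ∃ c, Proper G (edges G \ U) c) := by
  suffices H : ∀ n, ∀ P : Finset (Sym2 V), U ⊆ P → Disjoint K P → #(edges G \ P) = n →
      (∀ c, Proper G (edges G \ P) c → (∀ e ∈ K, c e = c₀ e) →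
        ∃ c, Proper G (edges G \ U) c) →
      ∃ P, U ⊆ P ∧ Disjoint K P ∧ Saturated G K P c₀ ∧
      (edges G ⊆ P ∪ K → ∃ c, Proper G (edges G \ U) c) from
    H _ U subset_rfl hKU rfl fun c hc _ => ⟨c, hc⟩
  intro n
  induction n with
  | zero =>
    intro P hUP hKP h0 hP
    rw [card_eq_zero, sdiff_eq_empty_iff_subset] at h0
    refine ⟨P, hUP, hKP, fun e he heP => absurd (h0 he) heP, fun h => hP c₀ ?_ fun _ _ => rfl⟩
    intro e he
    simp only [mem_sdiff] at he
    exact absurd (h0 he.1) he.2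
  | succ n ih =>
    intro P hUP hKP hn hP
    by_cases hsat : Saturated G K P c₀
    · refine ⟨P, hUP, hKP, hsat, fun h => hP c₀ ?_ fun _ _ => rfl⟩
      have hsub : edges G \ P ⊆ K := by
        intro e he
        simp only [mem_sdiff] at he
        have := h he.1
        simp only [mem_union] at this
        tauto
      exact fun e he f hf => hc₀ e (hsub he) f (hsub hf)
    · simp only [Saturated, not_forall, not_le] at hsat
      obtain ⟨e, he, heP, heK, hlt⟩ := hsat
      refine ih (insert e P) (hUP.trans (subset_insert _ _)) ?_ ?_ ?_
      · rw [disjoint_insert_right]; exact ⟨heK, hKP⟩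
      · have h2 : edges G \ insert e P = (edges G \ P).erase e := by ext; simp; tauto
        rw [h2, card_erase_of_mem (by simpa [heP] using he), hn]; rfl
      · intro c hc hcK
        have hcard : #((seen G e \ (P ∪ K)).image c ∪ (seen G e ∩ K).image c₀) ≤ 20 := by
          have h1 := card_union_le ((seen G e \ (P ∪ K)).image c) ((seen G e ∩ K).image c₀)
          have h2 : #((seen G e \ (P ∪ K)).image c) ≤ _ := card_image_le
          omega
        obtain ⟨a, ha⟩ := exists_color hcard
        refine hP (Function.update c e a) (Proper.update sdiff_subset ?_ ?_) ?_
        · have h2 : edges G \ insert e P = (edges G \ P).erase e := by ext; simp; tauto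
          rwa [← h2]
        · rintro f hf hfP rfl
          apply ha
          simp only [mem_sdiff] at hfP
          by_cases hfK : f ∈ K
          · exact mem_union_right _ (mem_image.2 ⟨f, mem_inter.2 ⟨hf, hfK⟩, (hcK f hfK).symm⟩)
          · refine mem_union_left _ (mem_image_of_mem _ ?_)
            simp [hf, hfP.2, hfK]
        · intro f hf
          rw [Function.update_of_ne (by rintro rfl; exact heK hf)]
          exact hcK f hf

theorem Saturated.mem_of_card_add_le {K P X : Finset (Sym2 V)} {c₀ : Sym2 V → Fin 21} {x y : V}
    (h : Saturated G K P c₀) (hxy : G.Adj x y)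
    (hX : ∀ z q, G.Adj z q → s(x, y) ≠ s(z, q) → (G.Adj x z ∨ G.Adj y z) → s(z, q) ∉ P →
      s(z, q) ∉ K → s(z, q) ∈ X) {C : Finset (Fin 21)}
    (hC : ∀ f ∈ K, StrongConflict G s(x, y) f → c₀ f ∈ C) (hc : #X + #C ≤ 20) :
    s(x, y) ∈ P ∪ K := by
  by_contra hP
  simp only [mem_union, not_or] at hP
  have h1 := h _ (mk_mem_edges.2 hxy) hP.1 hP.2
  have h2 : seen G s(x, y) \ (P ∪ K) ⊆ X := by
    intro f hf
    obtain ⟨hf, hfP⟩ := mem_sdiff.1 hf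
    obtain ⟨z, q, rfl, hzq, hne, hz⟩ := exists_of_mem_seen hxy hf
    simp only [mem_union, not_or] at hfP
    exact hX z q hzq hne hz hfP.1 hfP.2
  have h3 : (seen G s(x, y) ∩ K).image c₀ ⊆ C := by
    intro a ha
    obtain ⟨f, hf, rfl⟩ := mem_image.1 ha
    exact hC f (mem_inter.1 hf).2 (mem_seen.1 (mem_inter.1 hf).1).2.2
  have := card_le_card h2
  have := card_le_card h3
  omega

theorem Saturated.mem_of_card_le {K P X : Finset (Sym2 V)} {c₀ : Sym2 V → Fin 21} {x y : V}
    (h : Saturated G K P c₀) (hKP : Disjoint K P) (hxy : G.Adj x y)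
    (hX : ∀ z q, G.Adj z q → s(x, y) ≠ s(z, q) → (G.Adj x z ∨ G.Adj y z) → s(z, q) ∉ P →
      s(z, q) ∈ X) (hc : #X ≤ 20) : s(x, y) ∈ P ∪ K := by
  by_contra hP
  simp only [mem_union, not_or] at hP
  have h1 := h _ (mk_mem_edges.2 hxy) hP.1 hP.2
  have h2 : seen G s(x, y) \ P ⊆ X := by
    intro f hf
    obtain ⟨hf, hfP⟩ := mem_sdiff.1 hf
    obtain ⟨z, q, rfl, hzq, hne, hz⟩ := exists_of_mem_seen hxy hf
    exact hX z q hzq hne hz hfP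
  have h3 : seen G s(x, y) \ (P ∪ K) = (seen G s(x, y) \ P) \ (seen G s(x, y) ∩ K) := by
    ext f; simp; tauto
  have h4 : seen G s(x, y) ∩ K ⊆ seen G s(x, y) \ P := fun f hf => by
    simp only [mem_inter] at hf
    exact mem_sdiff.2 ⟨hf.1, disjoint_left.1 hKP hf.2⟩
  have h5 := card_sdiff_add_card_eq_card h4
  have h6 : #((seen G s(x, y) ∩ K).image c₀) ≤ _ := card_image_le
  have := card_le_card h2
  rw [h3] at h1
  omega

end

section

variable {V : Type*} [Fintype V] {G : SimpleGraph V}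

/-- The edges near `x` when neighbors in `X` are ignored. -/
noncomputable def wide (G : SimpleGraph V) (x : V) (X : Finset V) : Finset (Sym2 V) :=
  fan G x X ∪ far G x X

theorem card_wide_add_le (hdeg : ∀ x, #(nb G x) ≤ 4) {x : V} {X : Finset V}
    (hX : ∀ q ∈ X, G.Adj x q) : #(wide G x X) + 4 * #X ≤ 16 := by
  have h1 := card_fan_add_le hdeg hX
  have h2 := card_far_add_le hdeg hX
  have h3 := card_union_le (fan G x X) (far G x X)
  rw [← wide] at h3
  omega

theorem card_wide_one (hdeg : ∀ x, #(nb G x) ≤ 4) {z a : V} (h : G.Adj z a) :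
    #(wide G z {a}) ≤ 12 := by
  have := card_wide_add_le hdeg (x := z) (X := {a}) (by simpa using h)
  simp at this; omega

theorem card_wide_two (hdeg : ∀ x, #(nb G x) ≤ 4) {z a b : V} (h : G.Adj z a) (h' : G.Adj z b)
    (hab : a ≠ b) : #(wide G z {a, b}) ≤ 8 := by
  have := card_wide_add_le hdeg (x := z) (X := {a, b}) (by simp [h, h'])
  rw [card_pair hab] at this; omega

theorem card_wide_three (hdeg : ∀ x, #(nb G x) ≤ 4) {z a b c : V} (h : G.Adj z a)
    (h' : G.Adj z b) (h'' : G.Adj z c) (hab : a ≠ b) (hac : a ≠ c) (hbc : b ≠ c) :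
    #(wide G z {a, b, c}) ≤ 4 := by
  have := card_wide_add_le hdeg (x := z) (X := {a, b, c}) (by simp [h, h', h''])
  rw [card_eq_three.2 ⟨a, b, c, hab, hac, hbc, rfl⟩] at this; omega

/-- An edge seen by `xy` lies in one of the two wide sets, or is an edge at an ignored neighbor. -/
theorem mem_wide_or {x y z r : V} {X Y : Finset V} (hzr : G.Adj z r)
    (hne : s(x, y) ≠ s(z, r)) (hz : G.Adj x z ∨ G.Adj y z) :
    (s(z, r) ∈ wide G x X ∨ s(z, r) ∈ wide G y Y) ∨
      (∃ w ∈ X, w ≠ y ∧ ∃ t, G.Adj w t ∧ s(z, r) = s(w, t)) ∨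
      (∃ w ∈ Y, w ≠ x ∧ ∃ t, G.Adj w t ∧ s(z, r) = s(w, t)) := by
  have main : ∀ {x y z r : V} {X Y : Finset V}, G.Adj z r →
    s(x, y) ≠ s(z, r) → G.Adj x z →
    (s(z, r) ∈ wide G x X ∨ s(z, r) ∈ wide G y Y) ∨
      (∃ w ∈ X, w ≠ y ∧ ∃ t, G.Adj w t ∧ s(z, r) = s(w, t)) ∨
      (∃ w ∈ Y, w ≠ x ∧ ∃ t, G.Adj w t ∧ s(z, r) = s(w, t)) := by
    intro x y z r X Y hzr hne hz
    by_cases h1 : z = y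
    · subst h1
      have hr : r ≠ x := by rintro rfl; exact hne Sym2.eq_swap
      by_cases h2 : r ∈ Y
      · exact Or.inr (Or.inr ⟨r, h2, hr, z, hzr.symm, Sym2.eq_swap⟩)
      · exact Or.inl (Or.inr (mem_union_left _ (mem_fan hzr h2)))
    · by_cases h2 : z ∈ X
      · exact Or.inr (Or.inl ⟨z, h2, h1, r, hzr, rfl⟩)
      · by_cases h3 : r = x
        · subst h3
          rw [Sym2.eq_swap]
          exact Or.inl (Or.inl (mem_union_left _ (mem_fan hzr.symm h2)))
        · exact Or.inl (Or.inl (mem_union_right _ (mem_far hzr hz h2 h3)))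
  rcases hz with hz | hz
  · exact main hzr hne hz
  · have := main (X := Y) (Y := X) hzr (by rwa [Sym2.eq_swap (a := y)]) hz
    rcases this with (h | h) | h | h
    · exact Or.inl (Or.inr h)
    · exact Or.inl (Or.inl h)
    · exact Or.inr (Or.inr h)
    · exact Or.inr (Or.inl h)

/-- All edges at `x` lie in `P`. -/
def StarIn (G : SimpleGraph V) (P : Finset (Sym2 V)) (x : V) : Prop :=
  ∀ q, G.Adj x q → s(x, q) ∈ P

section
variable {K P : Finset (Sym2 V)} {c₀ : Sym2 V → Fin 21}

theorem Saturated.starIn_of_adj (h : Saturated G K P c₀) (hKP : Disjoint K P)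
    (hdeg : ∀ x, #(nb G x) ≤ 4) {x y : V} (hx : StarIn G P x) (hxy : G.Adj x y) :
    StarIn G (P ∪ K) y := by
  intro q hq
  by_cases hqx : q = x
  · subst hqx
    rw [Sym2.eq_swap]
    exact mem_union_left _ (hx _ hxy)
  refine h.mem_of_card_le (X := wide G y {x, q} ∪ wide G q {y}) hKP hq ?_ ?_
  · intro z r hzr hne hz hP
    rcases mem_wide_or (X := {x, q}) (Y := {y}) hzr hne hz with h1 | ⟨w, hw, hw', t, ht, he⟩ |
      ⟨w, hw, hw', -⟩
    · simpa using h1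
    · simp only [mem_insert, mem_singleton] at hw
      obtain rfl : w = x := by tauto
      exact absurd (he ▸ hx t ht) hP
    · simp at hw; tauto
  · have h1 := card_wide_two hdeg hxy.symm hq (Ne.symm hqx)
    have h2 := card_wide_one hdeg hq.symm
    have := card_union_le (wide G y {x, q}) (wide G q {y})
    omega

theorem Saturated.starIn_of_adj_two (h : Saturated G K P c₀) (hKP : Disjoint K P)
    (hdeg : ∀ x, #(nb G x) ≤ 4) {x₁ x₂ y : V} (h₁ : StarIn G (P ∪ K) x₁)
    (h₂ : StarIn G (P ∪ K) x₂) (hne : x₁ ≠ x₂) (h₁y : G.Adj x₁ y) (h₂y : G.Adj x₂ y)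
    (hK : ∀ x, #(K.filter (x ∈ ·)) ≤ 2) :
    StarIn G (P ∪ K) y := by
  intro q hq
  by_cases hq1 : q = x₁
  · subst hq1
    rw [Sym2.eq_swap]
    exact h₁ _ h₁y
  by_cases hq2 : q = x₂
  · subst hq2
    rw [Sym2.eq_swap]
    exact h₂ _ h₂y
  refine h.mem_of_card_le (X := (wide G y {x₁, x₂, q} ∪ wide G q {y}) ∪
    (K.filter (x₁ ∈ ·) ∪ K.filter (x₂ ∈ ·))) hKP hq ?_ ?_
  · intro z r hzr hne hz hP
    rcases mem_wide_or (X := {x₁, x₂, q}) (Y := {y}) hzr hne hz with h1 | ⟨w, hw, hw', t, ht, he⟩ |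
      ⟨w, hw, hw', -⟩
    · exact mem_union_left _ (by simpa using h1)
    · simp only [mem_insert, mem_singleton] at hw
      rcases hw with rfl | rfl | rfl
      · have := h₁ t ht
        rw [← he] at this
        simp only [mem_union] at this
        refine mem_union_right _ (mem_union_left _ (mem_filter.2 ⟨by tauto, ?_⟩))
        simp [he]
      · have := h₂ t ht
        rw [← he] at this
        simp only [mem_union] at this
        refine mem_union_right _ (mem_union_right _ (mem_filter.2 ⟨by tauto, ?_⟩))
        simp [he]
      · exact absurd rfl hw'
    · simp at hw; tauto
  · have h1 := card_wide_three hdeg h₁y.symm h₂y.symm hq hne (Ne.symm hq1) (Ne.symm hq2)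
    have h2 := card_wide_one hdeg hq.symm
    have := card_union_le (wide G y {x₁, x₂, q}) (wide G q {y})
    have := card_union_le (wide G y {x₁, x₂, q} ∪ wide G q {y})
      (K.filter (x₁ ∈ ·) ∪ K.filter (x₂ ∈ ·))
    have := card_union_le (K.filter (x₁ ∈ ·)) (K.filter (x₂ ∈ ·))
    have := hK x₁
    have := hK x₂
    omega

/-- With no precolored edges, saturation spreads over a connected graph. -/
theorem Saturated.edges_subset (hG : G.Connected) (h : Saturated G ∅ P c₀)
    (hdeg : ∀ x, #(nb G x) ≤ 4) {x : V} (hx : StarIn G P x) : edges G ⊆ P := by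
  have key : ∀ y, G.Reachable x y → StarIn G P y := by
    rintro y ⟨w⟩
    induction w with
    | nil => exact hx
    | cons hadj _ ih =>
      exact ih (by simpa using h.starIn_of_adj (disjoint_empty_left _) hdeg hx hadj)
  intro e he
  induction e using Sym2.ind with
  | _ p q => exact key p (hG.preconnected x p) q (mk_mem_edges.1 he)

end

/-- Everything outside a set `U` containing a star can be colored. -/
theorem exists_proper_sdiff (hG : G.Connected) (hdeg : ∀ x, #(nb G x) ≤ 4)
    (U : Finset (Sym2 V)) {x : V} (hx : StarIn G U x) :
    ∃ c, Proper G (edges G \ U) c := by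
  obtain ⟨P, hUP, -, hs, hP⟩ := exists_saturated (G := G) ∅ U (fun _ => 0) (disjoint_empty_left _)
    (by simp [Proper])
  exact hP (by simpa using hs.edges_subset hG hdeg fun q hq => hUP (hx q hq))

theorem exists_proper_of_card_lt (hG : G.Connected) (hdeg : ∀ x, #(nb G x) ≤ 4) {x : V}
    (hx : #(nb G x) ≤ 3) : ∃ c, Proper G (edges G) c := by
  obtain ⟨P, -, -, hs, hP⟩ := exists_saturated (G := G) ∅ ∅ (fun _ => 0) (disjoint_empty_left _)
    (by simp [Proper])
  have hx' : StarIn G P x := by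
    intro y hy
    have := hs.mem_of_card_le (X := wide G x {y} ∪ wide G y {x}) (disjoint_empty_left _) hy ?_ ?_
    · simpa using this
    · intro z r hzr hne hz _
      rcases mem_wide_or (X := {y}) (Y := {x}) hzr hne hz with h1 | ⟨w, hw, hw', -⟩ |
        ⟨w, hw, hw', -⟩
      · simpa using h1
      · simp at hw; tauto
      · simp at hw; tauto
    · have h2 := card_wide_one hdeg hy.symm
      have h3 : #(wide G x {y}) ≤ 8 := by
        have e1 : #(nb G x \ {y}) ≤ 2 := by
          rw [card_sdiff_of_subset (by simpa using hy)]
          simp; omega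
        have e2 : #(fan G x {y}) ≤ #(nb G x \ {y}) := card_image_le
        have e3 : #(far G x {y}) ≤ #(nb G x \ {y}) * 3 :=
          card_biUnion_le_card_mul _ _ _ fun z hz => card_fan_one hdeg (by
            simp only [mem_sdiff, mem_nb] at hz; exact hz.1.symm)
        have e4 := card_union_le (fan G x {y}) (far G x {y})
        rw [← wide] at e4
        omega
      have := card_union_le (wide G x {y}) (wide G y {x})
      omega
  simpa using hP (by simpa using hs.edges_subset hG hdeg hx')

theorem exists_proper_of_triangle (hG : G.Connected) (hdeg : ∀ x, #(nb G x) ≤ 4) {x y z : V}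
    (hxy : G.Adj x y) (hxz : G.Adj x z) (hyz : G.Adj y z) : ∃ c, Proper G (edges G) c := by
  obtain ⟨P, -, -, hs, hP⟩ := exists_saturated (G := G) ∅ ∅ (fun _ => 0) (disjoint_empty_left _)
    (by simp [Proper])
  have tri : ∀ {x y z : V}, G.Adj x y → G.Adj x z → G.Adj y z → s(x, y) ∈ P := by
    intro x y z hxy hxz hyz
    have := hs.mem_of_card_le (X := (wide G x {y, z} ∪ wide G y {x, z}) ∪ (fan G z {x, y} ∪
      {s(x, z), s(y, z)}))
      (disjoint_empty_left _) hxy ?_ ?_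
    · simpa using this
    · intro p r hpr hne hp _
      have hzt : ∀ w, w = z → ∀ t, G.Adj w t → s(w, t) ∈ fan G z {x, y} ∪ {s(x, z), s(y, z)} := by
        rintro w rfl t ht
        by_cases h1 : t = x
        · subst h1; exact mem_union_right _ (by simp)
        by_cases h2 : t = y
        · subst h2; exact mem_union_right _ (by simp)
        exact mem_union_left _ (mem_fan ht (by simp [h1, h2]))
      rcases mem_wide_or (X := {y, z}) (Y := {x, z}) hpr hne hp with h1 | ⟨w, hw, hw', t, ht, he⟩ |
        ⟨w, hw, hw', t, ht, he⟩
      · exact mem_union_left _ (by simpa using h1)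
      · simp only [mem_insert, mem_singleton] at hw
        rw [he]
        exact mem_union_right _ (hzt w (by tauto) t ht)
      · simp only [mem_insert, mem_singleton] at hw
        rw [he]
        exact mem_union_right _ (hzt w (by tauto) t ht)
    · have h1 := card_wide_two hdeg hxy hxz hyz.ne
      have h2 := card_wide_two hdeg hxy.symm hyz hxz.ne
      have h3 := card_fan_two hdeg hxz.symm hyz.symm hxy.ne
      have := card_union_le (wide G x {y, z}) (wide G y {x, z})
      have := card_union_le (fan G z {x, y}) {s(x, z), s(y, z)}
      have : #{s(x, z), s(y, z)} ≤ 2 := card_le_two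
      have := card_union_le (wide G x {y, z} ∪ wide G y {x, z})
        (fan G z {x, y} ∪ {s(x, z), s(y, z)})
      omega
  have exy := tri hxy hxz hyz
  have exz := tri hxz hxy hyz.symm
  have eyz := tri hyz hxy.symm hxz.symm
  have hx' : StarIn G P x := by
    intro w hw
    by_cases h1 : w = y
    · subst h1; exact exy
    by_cases h2 : w = z
    · subst h2; exact exz
    have := hs.mem_of_card_le (X := (wide G x {w, y, z} ∪ wide G w {x}) ∪ (fan G z {x, y} ∪
      fan G y {x, z}))
      (disjoint_empty_left _) hw ?_ ?_
    · simpa using this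
    · intro p r hpr hne hp hP
      rcases mem_wide_or (X := {w, y, z}) (Y := {x}) hpr hne hp with h1 | ⟨w, hw, hw', t, ht, he⟩ |
        ⟨w, hw, hw', -⟩
      · exact mem_union_left _ (by simpa using h1)
      · rw [he] at hP ⊢
        simp only [mem_insert, mem_singleton] at hw
        rcases hw with rfl | rfl | rfl
        · tauto
        · refine mem_union_right _ (mem_union_right _ (mem_fan ht ?_))
          simp only [mem_insert, mem_singleton, not_or]
          exact ⟨fun h => hP (by rwa [h, Sym2.eq_swap]), fun h => hP (by rwa [h])⟩
        · refine mem_union_right _ (mem_union_left _ (mem_fan ht ?_))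
          simp only [mem_insert, mem_singleton, not_or]
          exact ⟨fun h => hP (by rwa [h, Sym2.eq_swap]), fun h => hP (by rwa [h, Sym2.eq_swap])⟩
      · simp at hw; tauto
    · have e1 := card_wide_three hdeg hw hxy hxz h1 h2 hyz.ne
      have e2 := card_wide_one hdeg hw.symm
      have e3 := card_fan_two hdeg hxz.symm hyz.symm hxy.ne
      have e4 := card_fan_two hdeg hxy.symm hyz hxz.ne
      have := card_union_le (wide G x {w, y, z}) (wide G w {x})
      have := card_union_le (fan G z {x, y}) (fan G y {x, z})
      have := card_union_le (wide G x {w, y, z} ∪ wide G w {x}) (fan G z {x, y} ∪ fan G y {x, z})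
      omega
  simpa using hP (by simpa using hs.edges_subset hG hdeg hx')

end

section

section
variable {α β : Type*} [DecidableEq β] {M : α → α → Prop} {I : Finset α} {L : α → Finset β}

/-- The elements of `I` can be assigned values from the lists `L` so that equal values only occur
at pairs related by `M`. -/
def Choosable (M : α → α → Prop) (I : Finset α) (L : α → Finset β) : Prop :=
  ∃ g : α → β, (∀ x ∈ I, g x ∈ L x) ∧ ∀ x ∈ I, ∀ y ∈ I, x ≠ y → g x = g y → M x y

theorem choosable_of_hall [Nonempty β] (h : ∀ S ⊆ I, #S ≤ #(S.biUnion L)) : Choosable M I L := by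
  obtain ⟨f, hf, hfL⟩ := (all_card_le_biUnion_card_iff_exists_injective
    (fun x : I => L x)).1 fun S => by
      have := h (S.map (Function.Embedding.subtype _)) (fun x hx => by
        obtain ⟨y, -, rfl⟩ := mem_map.1 hx
        exact y.2)
      rw [card_map] at this
      refine this.trans (card_le_card fun a ha => ?_)
      simpa using ha
  refine ⟨fun x => if hx : x ∈ I then f ⟨x, hx⟩ else Classical.arbitrary β, fun x hx => ?_,
    fun x hx y hy hne he => ?_⟩
  · simpa [hx] using hfL ⟨x, hx⟩
  · simp only [hx, hy, dif_pos] at he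
    exact absurd (congrArg Subtype.val (hf he)) hne

theorem card_le_card_biUnion {S : Finset α} {x : α} (hx : x ∈ S) {n : ℕ} (h : n ≤ #(L x)) :
    n ≤ #(S.biUnion L) := h.trans (card_le_card (subset_biUnion_of_mem L hx))

theorem card_union_le_card_biUnion {S : Finset α} {x y : α} (hx : x ∈ S) (hy : y ∈ S) {n : ℕ}
    (h : n ≤ #(L x ∪ L y)) : n ≤ #(S.biUnion L) :=
  h.trans (card_le_card (union_subset (subset_biUnion_of_mem L hx) (subset_biUnion_of_mem L hy)))

variable [DecidableEq α]

theorem Choosable.of_pair {p q : α} (hpq : M p q) (hqp : M q p) {a : β} (ha : a ∈ L p)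
    (ha' : a ∈ L q) (h : Choosable M (I \ {p, q}) fun x => (L x).erase a) : Choosable M I L := by
  obtain ⟨g, hg, hg'⟩ := h
  have hm : ∀ x ∈ I, ¬ (x = p ∨ x = q) → x ∈ I \ {p, q} := fun x hx hx' => by simp [hx, hx']
  refine ⟨fun x => if x = p ∨ x = q then a else g x, fun x hx => ?_, fun x hx y hy hne he => ?_⟩
  · by_cases h1 : x = p ∨ x = q
    · simp only [h1, if_true]
      rcases h1 with rfl | rfl <;> assumption
    · simp only [h1, if_false]
      exact (mem_erase.1 (hg x (hm x hx h1))).2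
  · by_cases h1 : x = p ∨ x = q <;> by_cases h2 : y = p ∨ y = q <;>
      simp only [h1, h2, if_true, if_false] at he
    · rcases h1 with rfl | rfl <;> rcases h2 with rfl | rfl <;> tauto
    · exact absurd he.symm (mem_erase.1 (hg y (hm y hy h2))).1
    · exact absurd he (mem_erase.1 (hg x (hm x hx h1))).1
    · exact hg' x (hm x hx h1) y (hm y hy h2) hne he

/-- Strong elements have lists of almost full size; the weak ones satisfy Hall's condition. -/
theorem choosable_of_strong [Nonempty β] {T W : Finset α} {b : ℕ} (hcard : #(T ∪ W) ≤ b)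
    (hT : ∀ e ∈ T, b ≤ #(L e) + 1) {e₀ e₁ : α} (he₀ : e₀ ∈ T) (he₁ : e₁ ∈ T)
    (he : b ≤ #(L e₀ ∪ L e₁)) (hW : ∀ S ⊆ W, #S ≤ #(S.biUnion L)) :
    Choosable M (T ∪ W) L := by
  refine choosable_of_hall fun S hS => ?_
  by_cases hST : ∃ e ∈ T, e ∈ S
  · obtain ⟨e, heT, heS⟩ := hST
    by_cases hTS : T ⊆ S
    · have := card_union_le_card_biUnion (hTS he₀) (hTS he₁) he
      have := card_le_card hS
      omega
    · obtain ⟨x, hx, hxS⟩ := not_subset.1 hTS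
      have h1 := card_lt_card ((ssubset_iff_of_subset hS).2 ⟨x, mem_union_left _ hx, hxS⟩)
      have h2 := card_le_card_biUnion heS le_rfl (L := L)
      have := hT e heT
      omega
  · push Not at hST
    refine hW S fun x hx => ?_
    have := hS hx
    simp only [mem_union] at this
    have := fun h => hST x h hx
    tauto

/-- The weak elements `p` and `q` may share a value and have large lists. -/
structure Shareable (M : α → α → Prop) (W : Finset α) (L : α → Finset β) (m : ℕ) (p q : α) :
    Prop where
  mem_left : p ∈ W
  mem_right : q ∈ W
  ne : p ≠ q
  rel : M p q
  rel' : M q p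
  le : m ≤ #(L p) + #(L q)

/-- A choice exists when `n` disjoint pairs of weak elements are allowed to share values. -/
theorem choosable_of_pairs [Nonempty β] {T W : Finset α} {b n w : ℕ} (hTW : Disjoint T W)
    (hcard : #T + #W ≤ b + 2 * n)
    (hT : ∀ e ∈ T, b + n ≤ #(L e) + 1) {e₀ e₁ : α} (he₀ : e₀ ∈ T) (he₁ : e₁ ∈ T)
    (he : b + n ≤ #(L e₀ ∪ L e₁)) (hW : ∀ e ∈ W, w + n ≤ #(L e)) (hWc : #W ≤ w + 2 * n)
    {Q : Finset (α × α)} (hQ : #Q = n)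
    (hQW : ∀ p ∈ Q, Shareable M W L (b + 2 * n) p.1 p.2)
    (hQd : ∀ p ∈ Q, ∀ q ∈ Q, p ≠ q → p.1 ≠ q.1 ∧ p.1 ≠ q.2 ∧ p.2 ≠ q.1 ∧ p.2 ≠ q.2) :
    Choosable M (T ∪ W) L := by
  induction n generalizing W Q L with
  | zero =>
    refine choosable_of_strong ?_ (by simpa using hT) he₀ he₁ he ?_
    · exact (card_union_le _ _).trans (by simpa using hcard)
    · intro S hS
      obtain rfl | ⟨x, hx⟩ := S.eq_empty_or_nonempty
      · simp
      · have := card_le_card_biUnion hx (hW x (hS hx))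
        have := card_le_card hS
        omega
  | succ n ih =>
    by_cases hshare : ∃ p ∈ Q, (L p.1 ∩ L p.2).Nonempty
    · obtain ⟨⟨p, q⟩, hpQ, a, ha⟩ := hshare
      obtain ⟨hp, hq, hpq, hM, hM', hs⟩ := hQW _ hpQ
      dsimp only at hp hq hpq hM hM' hs ha
      obtain ⟨ha, ha'⟩ := mem_inter.1 ha
      refine Choosable.of_pair hM hM' ha ha' ?_
      have hWpq : (T ∪ W) \ {p, q} = T ∪ W \ {p, q} := by
        rw [union_sdiff_distrib, sdiff_eq_self_of_disjoint]
        simp only [disjoint_insert_right, disjoint_singleton_right]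
        exact ⟨disjoint_right.1 hTW hp, disjoint_right.1 hTW hq⟩
      have hc : #(W \ {p, q}) + 2 = #W := by
        rw [← card_sdiff_add_card_eq_card (s := {p, q}) (t := W)
          (by simp [insert_subset_iff, hp, hq]), card_pair hpq]
      have her : ∀ x, #(L x) ≤ #((L x).erase a) + 1 := fun x => by
        have := pred_card_le_card_erase (s := L x) (a := a); omega
      rw [hWpq]
      refine ih (Q := Q.erase (p, q)) (hTW.mono_right sdiff_subset) (by omega) ?_ ?_ ?_ ?_ ?_ ?_ ?_
      · intro e he; have := hT e he; have := her e; omega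
      · have h1 : (L e₀).erase a ∪ (L e₁).erase a = (L e₀ ∪ L e₁).erase a := by
          ext; simp; tauto
        have := pred_card_le_card_erase (s := L e₀ ∪ L e₁) (a := a)
        rw [h1]; omega
      · intro e he
        have := hW e (mem_sdiff.1 he).1; have := her e; omega
      · omega
      · rw [card_erase_of_mem hpQ, hQ]; rfl
      · intro r hr
        obtain ⟨hne, hr⟩ := mem_erase.1 hr
        obtain ⟨h1, h2, h3, h4, h5, h6⟩ := hQW r hr
        obtain ⟨d1, d2, d3, d4⟩ := hQd r hr _ hpQ hne
        refine ⟨?_, ?_, h3, h4, h5, ?_⟩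
        · simp only [mem_sdiff, mem_insert, mem_singleton]; tauto
        · simp only [mem_sdiff, mem_insert, mem_singleton]; tauto
        · have := her r.1; have := her r.2; omega
      · exact fun r hr s hs => hQd r (mem_erase.1 hr).2 s (mem_erase.1 hs).2
    · push Not at hshare
      refine choosable_of_hall fun S hS => ?_
      have hSc := card_le_card hS
      have hTWc := card_union_le T W
      by_cases hpair : ∃ p ∈ Q, p.1 ∈ S ∧ p.2 ∈ S
      · obtain ⟨p, hp, h1, h2⟩ := hpair
        have h3 := card_union_le_card_biUnion h1 h2 le_rfl (L := L)
        rw [card_union_of_disjoint (disjoint_iff_inter_eq_empty.2 (hshare p hp))] at h3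
        have := (hQW p hp).le
        omega
      · push Not at hpair
        have hmiss : n + 1 ≤ #(W \ S) := by
          rw [← hQ]
          refine card_le_card_of_injOn (fun p => if p.1 ∈ S then p.2 else p.1) ?_ ?_
          · intro p hp
            have := (hQW p hp).mem_left
            have := (hQW p hp).mem_right
            have := hpair p hp
            by_cases h : p.1 ∈ S <;> simp [h] <;> tauto
          · intro p hp q hq h
            by_contra hne
            have := hQd p hp q hq hne
            dsimp only at h
            split_ifs at h <;> tauto
        by_cases hST : ∃ e ∈ T, e ∈ S
        · obtain ⟨e, heT, heS⟩ := hST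
          have h4 : #S + #(W \ S) + #(T \ S) ≤ #T + #W := by
            have e1 : #S ≤ #(T ∩ S) + #(W ∩ S) := by
              refine (card_le_card fun x hx => ?_).trans (card_union_le _ _)
              have := hS hx
              simp only [mem_union, mem_inter] at this ⊢
              tauto
            have e2 := card_inter_add_card_sdiff T S
            have e3 := card_inter_add_card_sdiff W S
            omega
          by_cases hTS : T ⊆ S
          · have := card_union_le_card_biUnion (hTS he₀) (hTS he₁) he
            omega
          · obtain ⟨x, hx, hxS⟩ := not_subset.1 hTS
            have : 0 < #(T \ S) := card_pos.2 ⟨x, mem_sdiff.2 ⟨hx, hxS⟩⟩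
            have := card_le_card_biUnion heS (hT e heT |> fun h => Nat.sub_le_iff_le_add.2 h)
            omega
        · push Not at hST
          have hSW : S ⊆ W := fun x hx => by
            have := hS hx
            simp only [mem_union] at this
            have := fun h => hST x h hx
            tauto
          obtain rfl | ⟨x, hx⟩ := S.eq_empty_or_nonempty
          · simp
          · have := card_le_card_biUnion hx (hW x (hSW hx))
            have := card_sdiff_add_card_eq_card hSW
            omega

theorem choosable_of_one_pair [Nonempty β] {T W : Finset α} (b w : ℕ) (hTW : Disjoint T W)
    (hcard : #T + #W ≤ b + 2) (hT : ∀ e ∈ T, b ≤ #(L e)) {e₀ e₁ : α} (he₀ : e₀ ∈ T)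
    (he₁ : e₁ ∈ T) (he : b + 1 ≤ #(L e₀ ∪ L e₁)) (hW : ∀ e ∈ W, w + 1 ≤ #(L e))
    (hWc : #W ≤ w + 2) {p q : α} (hpq : Shareable M W L (b + 2) p q) :
    Choosable M (T ∪ W) L := by
  refine choosable_of_pairs (b := b) (n := 1) (w := w) (Q := {(p, q)}) hTW hcard
    (fun e he => Nat.succ_le_succ (hT e he)) he₀ he₁ he hW hWc (card_singleton _) ?_ ?_
  · simpa using hpq
  · simp only [mem_singleton]
    rintro r rfl s rfl h
    exact absurd rfl h

theorem choosable_of_two_pairs [Nonempty β] {T W : Finset α} (b w : ℕ) (hTW : Disjoint T W)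
    (hcard : #T + #W ≤ b + 4) (hT : ∀ e ∈ T, b + 1 ≤ #(L e)) {e₀ e₁ : α} (he₀ : e₀ ∈ T)
    (he₁ : e₁ ∈ T) (he : b + 2 ≤ #(L e₀ ∪ L e₁)) (hW : ∀ e ∈ W, w + 2 ≤ #(L e))
    (hWc : #W ≤ w + 4) {p q p' q' : α} (hpq : Shareable M W L (b + 4) p q)
    (hpq' : Shareable M W L (b + 4) p' q') (hd : p ≠ p' ∧ p ≠ q' ∧ q ≠ p' ∧ q ≠ q') :
    Choosable M (T ∪ W) L := by
  refine choosable_of_pairs (b := b) (n := 2) (w := w) (Q := {(p, q), (p', q')}) hTW hcard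
    (fun e he => Nat.succ_le_succ (hT e he)) he₀ he₁ he hW hWc (card_pair ?_) ?_ ?_
  · simp only [ne_eq, Prod.mk.injEq]; tauto
  · simp only [mem_insert, mem_singleton]
    rintro r (rfl | rfl) <;> assumption
  · simp only [mem_insert, mem_singleton]
    rintro r (rfl | rfl) s (rfl | rfl) h
    exacts [absurd rfl h, hd, ⟨hd.1.symm, hd.2.2.1.symm, hd.2.1.symm, hd.2.2.2.symm⟩,
      absurd rfl h]

theorem choosable_of_three_pairs [Nonempty β] {T W : Finset α} (b w : ℕ) (hTW : Disjoint T W)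
    (hcard : #T + #W ≤ b + 6) (hT : ∀ e ∈ T, b + 2 ≤ #(L e)) {e₀ e₁ : α} (he₀ : e₀ ∈ T)
    (he₁ : e₁ ∈ T) (he : b + 3 ≤ #(L e₀ ∪ L e₁)) (hW : ∀ e ∈ W, w + 3 ≤ #(L e))
    (hWc : #W ≤ w + 6) {p q p' q' p'' q'' : α} (hpq : Shareable M W L (b + 6) p q)
    (hpq' : Shareable M W L (b + 6) p' q') (hpq'' : Shareable M W L (b + 6) p'' q'')
    (hd : p ≠ p' ∧ p ≠ q' ∧ q ≠ p' ∧ q ≠ q') (hd' : p ≠ p'' ∧ p ≠ q'' ∧ q ≠ p'' ∧ q ≠ q'')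
    (hd'' : p' ≠ p'' ∧ p' ≠ q'' ∧ q' ≠ p'' ∧ q' ≠ q'') : Choosable M (T ∪ W) L := by
  refine choosable_of_pairs (b := b) (n := 3) (w := w) (Q := {(p, q), (p', q'), (p'', q'')})
    hTW hcard (fun e he => Nat.succ_le_succ (hT e he)) he₀ he₁ he hW hWc
    (card_eq_three.2 ⟨_, _, _, ?_, ?_, ?_, rfl⟩) ?_ ?_
  · simp only [ne_eq, Prod.mk.injEq]; tauto
  · simp only [ne_eq, Prod.mk.injEq]; tauto
  · simp only [ne_eq, Prod.mk.injEq]; tauto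
  · simp only [mem_insert, mem_singleton]
    rintro r (rfl | rfl | rfl) <;> assumption
  · simp only [mem_insert, mem_singleton]
    rintro r (rfl | rfl | rfl) s (rfl | rfl | rfl) h
    exacts [absurd rfl h, hd, hd', ⟨hd.1.symm, hd.2.2.1.symm, hd.2.1.symm, hd.2.2.2.symm⟩,
      absurd rfl h, hd'', ⟨hd'.1.symm, hd'.2.2.1.symm, hd'.2.1.symm, hd'.2.2.2.symm⟩,
      ⟨hd''.1.symm, hd''.2.2.1.symm, hd''.2.1.symm, hd''.2.2.2.symm⟩, absurd rfl h]

end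

end

section

section
variable {V : Type*} {G : SimpleGraph V}

/-- The neighbors of `x` are the four distinct vertices `p`, `q`, `r`, `s`. -/
structure Nbs (G : SimpleGraph V) (x p q r s : V) : Prop where
  adj_iff : ∀ z, G.Adj x z ↔ z = p ∨ z = q ∨ z = r ∨ z = s
  ne₁₂ : p ≠ q
  ne₁₃ : p ≠ r
  ne₁₄ : p ≠ s
  ne₂₃ : q ≠ r
  ne₂₄ : q ≠ s
  ne₃₄ : r ≠ s

variable {x p q r s : V}

theorem Nbs.adj₁ (h : Nbs G x p q r s) : G.Adj x p := (h.adj_iff _).2 (by simp)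

theorem Nbs.adj₂ (h : Nbs G x p q r s) : G.Adj x q := (h.adj_iff _).2 (by simp)

theorem Nbs.adj₃ (h : Nbs G x p q r s) : G.Adj x r := (h.adj_iff _).2 (by simp)

theorem Nbs.adj₄ (h : Nbs G x p q r s) : G.Adj x s := (h.adj_iff _).2 (by simp)

theorem Nbs.swap₁₂ (h : Nbs G x p q r s) : Nbs G x q p r s :=
  ⟨fun z => by rw [h.adj_iff]; tauto, h.ne₁₂.symm, h.ne₂₃, h.ne₂₄, h.ne₁₃, h.ne₁₄, h.ne₃₄⟩

theorem Nbs.swap₂₃ (h : Nbs G x p q r s) : Nbs G x p r q s :=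
  ⟨fun z => by rw [h.adj_iff]; tauto, h.ne₁₃, h.ne₁₂, h.ne₁₄, h.ne₂₃.symm, h.ne₃₄, h.ne₂₄⟩

theorem Nbs.swap₃₄ (h : Nbs G x p q r s) : Nbs G x p q s r :=
  ⟨fun z => by rw [h.adj_iff]; tauto, h.ne₁₂, h.ne₁₄, h.ne₁₃, h.ne₂₄, h.ne₂₃, h.ne₃₄.symm⟩

theorem StarIn.mono {P Q : Finset (Sym2 V)} {x : V} (h : StarIn G P x) (hPQ : P ⊆ Q) :
    StarIn G Q x := fun q hq => hPQ (h q hq)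

theorem Nbs.starIn {U : Finset (Sym2 V)} (h : Nbs G x p q r s)
    (hp : s(x, p) ∈ U) (hq : s(x, q) ∈ U) (hr : s(x, r) ∈ U) (hs : s(x, s) ∈ U) :
    StarIn G U x := by
  intro z hz
  rcases (h.adj_iff z).1 hz with rfl | rfl | rfl | rfl <;> assumption

end

variable {V : Type*} [Fintype V] {G : SimpleGraph V}

theorem exists_nbs_of_three {x p q r : V} (h4 : #(nb G x) = 4) (hp : G.Adj x p) (hq : G.Adj x q)
    (hr : G.Adj x r) (hpq : p ≠ q) (hpr : p ≠ r) (hqr : q ≠ r) : ∃ s, Nbs G x p q r s := by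
  have hsub : ({p, q, r} : Finset V) ⊆ nb G x := by simp [insert_subset_iff, hp, hq, hr]
  have h1 : #(nb G x \ {p, q, r}) = 1 := by
    rw [card_sdiff_of_subset hsub, h4, card_eq_three.2 ⟨p, q, r, hpq, hpr, hqr, rfl⟩]
  obtain ⟨s, hs⟩ := card_eq_one.1 h1
  have hs' : ∀ z, (G.Adj x z ∧ ¬ (z = p ∨ z = q ∨ z = r)) ↔ z = s := fun z => by
    have := Finset.ext_iff.1 hs z
    simpa using this
  have h2 := (hs' s).2 rfl
  refine ⟨s, fun z => ⟨fun hz => ?_, ?_⟩, hpq, hpr, by tauto, hqr, by tauto, by tauto⟩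
  · have := hs' z
    tauto
  · rintro (rfl | rfl | rfl | rfl) <;> tauto

theorem exists_nbs_of_two {x p q : V} (h4 : #(nb G x) = 4) (hp : G.Adj x p) (hq : G.Adj x q)
    (hpq : p ≠ q) : ∃ r s, Nbs G x p q r s := by
  have : ∃ r ∈ nb G x, r ∉ ({p, q} : Finset V) := by
    refine exists_mem_notMem_of_card_lt_card ?_
    rw [card_pair hpq]; omega
  obtain ⟨r, hr, hr'⟩ := this
  simp only [mem_insert, mem_singleton, not_or] at hr'
  exact ⟨r, exists_nbs_of_three h4 hp hq (by simpa using hr) hpq (Ne.symm hr'.1) (Ne.symm hr'.2)⟩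

theorem exists_nbs_of_one {x p : V} (h4 : #(nb G x) = 4) (hp : G.Adj x p) :
    ∃ q r s, Nbs G x p q r s := by
  have : ∃ r ∈ nb G x, r ∉ ({p} : Finset V) := by
    refine exists_mem_notMem_of_card_lt_card ?_
    rw [card_singleton]; omega
  obtain ⟨q, hq, hq'⟩ := this
  simp only [mem_singleton] at hq'
  exact ⟨q, exists_nbs_of_two h4 hp (by simpa using hq) (Ne.symm hq')⟩

theorem Nbs.card_far_three (hdeg : ∀ x, #(nb G x) ≤ 4) {x p q r s : V} (h : Nbs G x p q r s) :
    #(far G x {p, q, r}) ≤ 3 := by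
  have := card_far_add_le hdeg (a := x) (X := {p, q, r}) (by simp [h.adj_iff])
  rw [card_eq_three.2 ⟨p, q, r, h.ne₁₂, h.ne₁₃, h.ne₂₃, rfl⟩] at this; omega

theorem Nbs.card_far_two (hdeg : ∀ x, #(nb G x) ≤ 4) {x p q r s : V} (h : Nbs G x p q r s) :
    #(far G x {p, q}) ≤ 6 := by
  have := card_far_add_le hdeg (a := x) (X := {p, q}) (by simp [h.adj_iff])
  rw [card_pair h.ne₁₂] at this; omega

theorem Nbs.far_eq_empty {x p q r s : V} (h : Nbs G x p q r s) : far G x {p, q, r, s} = ∅ := by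
  have : nb G x \ {p, q, r, s} = ∅ := by
    ext z
    simp only [mem_sdiff, mem_nb, h.adj_iff, mem_insert, mem_singleton, notMem_empty]
    tauto
  simp [far, this]

/-- The colors still available at `e` when the edges outside `U` are colored by `c`. -/
noncomputable def avail (G : SimpleGraph V) (U : Finset (Sym2 V)) (c : Sym2 V → Fin 21)
    (e : Sym2 V) : Finset (Fin 21) := univ \ (seen G e \ U).image c

theorem mem_avail {U : Finset (Sym2 V)} {c : Sym2 V → Fin 21} {e : Sym2 V} {a : Fin 21} :
    a ∈ avail G U c e ↔ ∀ f ∈ seen G e, f ∉ U → c f ≠ a := by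
  simp [avail]

theorem exists_proper_of_choosable {U : Finset (Sym2 V)} {c : Sym2 V → Fin 21}
    (hc : Proper G (edges G \ U) c)
    (h : Choosable (fun e f => ¬ StrongConflict G e f) U (avail G U c)) :
    ∃ c, Proper G (edges G) c := by
  obtain ⟨g, hg, hg'⟩ := h
  refine ⟨fun e => if e ∈ U then g e else c e, fun e he f hf hne hcf => ?_⟩
  by_cases heU : e ∈ U <;> by_cases hfU : f ∈ U <;> simp only [heU, hfU, if_true, if_false]
  · exact fun h => hg' e heU f hfU hne h hcf
  · exact (mem_avail.1 (hg e heU) f (mem_seen.2 ⟨hf, hne, hcf⟩) hfU).symm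
  · exact mem_avail.1 (hg f hfU) e (mem_seen.2 ⟨he, hne.symm, conflict_symm hcf⟩) heU
  · exact hc e (mem_sdiff.2 ⟨he, heU⟩) f (mem_sdiff.2 ⟨hf, hfU⟩) hne hcf

theorem le_card_univ_sdiff {A : Finset (Fin 21)} {n : ℕ} (h : n + #A ≤ 21) :
    n ≤ #(univ \ A) := by
  rw [card_sdiff_of_subset (subset_univ _), card_univ, Fintype.card_fin]; omega

theorem le_card_avail {U E : Finset (Sym2 V)} {c : Sym2 V → Fin 21} {e : Sym2 V} {n : ℕ}
    (hE : seen G e \ U ⊆ E) (hn : n + #E ≤ 21) : n ≤ #(avail G U c e) := by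
  refine le_card_univ_sdiff ?_
  have h1 : #((seen G e \ U).image c) ≤ _ := card_image_le
  have := card_le_card hE
  omega

theorem seen_sdiff_subset {U A B E : Finset (Sym2 V)} {x y : V} {X Y : Finset V}
    (hxy : G.Adj x y) (hA : wide G x X \ U ⊆ A) (hB : wide G y Y \ U ⊆ B)
    (hX : ∀ w ∈ X, w ≠ y → StarIn G (U ∪ E) w) (hY : ∀ w ∈ Y, w ≠ x → StarIn G (U ∪ E) w) :
    seen G s(x, y) \ U ⊆ A ∪ B ∪ E := by
  intro f hf
  obtain ⟨hf, hfU⟩ := mem_sdiff.1 hf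
  obtain ⟨z, q, rfl, hzq, hne, hz⟩ := exists_of_mem_seen hxy hf
  rcases mem_wide_or (X := X) (Y := Y) hzq hne hz with (h | h) | ⟨w, hw, hw', t, ht, he⟩ |
    ⟨w, hw, hw', t, ht, he⟩
  · exact mem_union_left _ (mem_union_left _ (hA (mem_sdiff.2 ⟨h, hfU⟩)))
  · exact mem_union_left _ (mem_union_right _ (hB (mem_sdiff.2 ⟨h, hfU⟩)))
  · rw [he] at hfU ⊢
    exact mem_union_right _ ((mem_union.1 (hX w hw hw' t ht)).resolve_left hfU)
  · rw [he] at hfU ⊢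
    exact mem_union_right _ ((mem_union.1 (hY w hw hw' t ht)).resolve_left hfU)

theorem StarIn.wide_sdiff_subset {U : Finset (Sym2 V)} {x : V} {X : Finset V}
    (h : StarIn G U x) : wide G x X \ U ⊆ far G x X := by
  intro f hf
  obtain ⟨hf, hfU⟩ := mem_sdiff.1 hf
  rcases mem_union.1 hf with hf | hf
  · obtain ⟨q, hq, -, rfl⟩ := exists_of_mem_fan hf
    exact absurd (h q hq) hfU
  · exact hf

/-- Availability at an edge `xa` where `x` and its neighbors `p`, `q` have their stars in `U`. -/
theorem six_le_card_avail (hdeg : ∀ x, #(nb G x) ≤ 4) {U : Finset (Sym2 V)}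
    {c : Sym2 V → Fin 21} {x p q a b : V} (hx : Nbs G x p q a b) (hxU : StarIn G U x)
    (hp : StarIn G U p) (hq : StarIn G U q) : 6 ≤ #(avail G U c s(x, a)) := by
  refine le_card_avail (seen_sdiff_subset (E := ∅) (X := {p, q, a}) (Y := {x}) hx.adj₃
    hxU.wide_sdiff_subset sdiff_subset ?_ ?_) ?_
  · simp only [mem_insert, mem_singleton, union_empty]
    rintro w (rfl | rfl | rfl) h
    exacts [hp, hq, absurd rfl h]
  · simp only [mem_singleton]
    rintro w rfl h
    exact absurd rfl h
  · have h1 := hx.card_far_three hdeg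
    have h2 := card_wide_one hdeg hx.adj₃.symm
    have := card_union_le (far G x {p, q, a}) (wide G a {x})
    rw [union_empty]; omega

theorem seen_sdiff_subset_far {U : Finset (Sym2 V)} {x y p q : V} (hxy : G.Adj x y)
    (hxU : StarIn G U x) (hyU : StarIn G U y) (hp : StarIn G U p) (hq : StarIn G U q) :
    seen G s(x, y) \ U ⊆ far G x {y, p} ∪ far G y {x, q} := by
  rw [← union_empty (_ ∪ _)]
  refine seen_sdiff_subset hxy hxU.wide_sdiff_subset hyU.wide_sdiff_subset ?_ ?_ <;>
  · simp only [mem_insert, mem_singleton, union_empty]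
    rintro w (rfl | rfl) h
    all_goals first | exact absurd rfl h | exact hp | exact hq

end

section

section
variable {V : Type*} {G : SimpleGraph V}

theorem mk_ne_mk {u v p r : V} (h : u ≠ v) (h' : p ≠ v) : s(u, p) ≠ s(v, r) := by
  intro he
  rcases Sym2.eq_iff.1 he with h1 | h1 <;> tauto

theorem not_conflict {u v p r : V} (h₁ : u ≠ v) (h₂ : u ≠ r) (h₃ : p ≠ v) (h₄ : p ≠ r)
    (h₅ : ¬ G.Adj u v) (h₆ : ¬ G.Adj u r) (h₇ : ¬ G.Adj p v) (h₈ : ¬ G.Adj p r) :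
    ¬ StrongConflict G s(u, p) s(v, r) := by
  simp only [StrongConflict, Sym2.mem_iff, not_or, not_exists]
  refine ⟨?_, ?_⟩
  · rintro x ⟨rfl | rfl, rfl | rfl⟩ <;> tauto
  · rintro x y ⟨rfl | rfl, rfl | rfl, h⟩ <;> tauto

/-- An induced 4-cycle whose opposite vertices have no further common neighbors, with the
neighbors of its vertices. -/
structure Square (G : SimpleGraph V) (c₀ c₁ c₂ c₃ a₀ b₀ a₁ b₁ a₂ b₂ a₃ b₃ : V) : Prop where
  nbs₀ : Nbs G c₀ c₁ c₃ a₀ b₀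
  nbs₁ : Nbs G c₁ c₂ c₀ a₁ b₁
  nbs₂ : Nbs G c₂ c₃ c₁ a₂ b₂
  nbs₃ : Nbs G c₃ c₀ c₂ a₃ b₃
  ne₀₂ : c₀ ≠ c₂
  ne₁₃ : c₁ ≠ c₃
  nadj₀₂ : ¬ G.Adj c₀ c₂
  nadj₁₃ : ¬ G.Adj c₁ c₃
  common₀₂ : ∀ z, G.Adj c₀ z → G.Adj c₂ z → z = c₁ ∨ z = c₃
  common₁₃ : ∀ z, G.Adj c₁ z → G.Adj c₃ z → z = c₀ ∨ z = c₂

variable {c₀ c₁ c₂ c₃ a₀ b₀ a₁ b₁ a₂ b₂ a₃ b₃ : V}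

namespace Square

theorem rotate (h : Square G c₀ c₁ c₂ c₃ a₀ b₀ a₁ b₁ a₂ b₂ a₃ b₃) :
    Square G c₁ c₂ c₃ c₀ a₁ b₁ a₂ b₂ a₃ b₃ a₀ b₀ where
  nbs₀ := h.nbs₁
  nbs₁ := h.nbs₂
  nbs₂ := h.nbs₃
  nbs₃ := h.nbs₀
  ne₀₂ := h.ne₁₃
  ne₁₃ := h.ne₀₂.symm
  nadj₀₂ := h.nadj₁₃
  nadj₁₃ := fun h' => h.nadj₀₂ h'.symm
  common₀₂ := fun z hz hz' => (h.common₁₃ z hz hz').symm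
  common₁₃ := fun z hz hz' => h.common₀₂ z hz' hz

theorem swap (h : Square G c₀ c₁ c₂ c₃ a₀ b₀ a₁ b₁ a₂ b₂ a₃ b₃) :
    Square G c₀ c₁ c₂ c₃ b₀ a₀ a₁ b₁ a₂ b₂ a₃ b₃ :=
  { h with nbs₀ := h.nbs₀.swap₃₄ }

/-- Edges at opposite vertices of the cycle conflict only if their outer ends are adjacent. -/
theorem not_conflict (h : Square G c₀ c₁ c₂ c₃ a₀ b₀ a₁ b₁ a₂ b₂ a₃ b₃) {p r : V}
    (hp : p = a₀ ∨ p = b₀) (hr : r = a₂ ∨ r = b₂) (hpr : ¬ G.Adj p r) :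
    ¬ StrongConflict G s(c₀, p) s(c₂, r) := by
  have h1 : G.Adj c₀ p := (h.nbs₀.adj_iff _).2 (by tauto)
  have h2 : G.Adj c₂ r := (h.nbs₂.adj_iff _).2 (by tauto)
  have h3 : p ≠ c₁ ∧ p ≠ c₃ := by
    have := h.nbs₀
    rcases hp with rfl | rfl
    · exact ⟨this.ne₁₃.symm, this.ne₂₃.symm⟩
    · exact ⟨this.ne₁₄.symm, this.ne₂₄.symm⟩
  have h4 : r ≠ c₁ ∧ r ≠ c₃ := by
    have := h.nbs₂
    rcases hr with rfl | rfl
    · exact ⟨this.ne₂₃.symm, this.ne₁₃.symm⟩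
    · exact ⟨this.ne₂₄.symm, this.ne₁₄.symm⟩
  refine StrongEdge.not_conflict h.ne₀₂ ?_ ?_ ?_ h.nadj₀₂ ?_ ?_ hpr
  · rintro rfl; exact h.nadj₀₂ h2.symm
  · rintro rfl; exact h.nadj₀₂ h1
  · rintro rfl; have := h.common₀₂ _ h1 h2; tauto
  · intro h'; have := h.common₀₂ _ h' h2; tauto
  · intro h'; have := h.common₀₂ _ h1 h'.symm; tauto

end Square
end

variable {V : Type*} {G : SimpleGraph V} {c₀ c₁ c₂ c₃ a₀ b₀ a₁ b₁ a₂ b₂ a₃ b₃ : V}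

/-- The edges of a 4-cycle. -/
noncomputable def rim (c₀ c₁ c₂ c₃ : V) : Finset (Sym2 V) :=
  {s(c₀, c₁), s(c₁, c₂), s(c₂, c₃), s(c₃, c₀)}

/-- The other edges at the vertices of a 4-cycle. -/
noncomputable def spokes (c₀ c₁ c₂ c₃ a₀ b₀ a₁ b₁ a₂ b₂ a₃ b₃ : V) : Finset (Sym2 V) :=
  {s(c₀, a₀), s(c₀, b₀), s(c₁, a₁), s(c₁, b₁), s(c₂, a₂), s(c₂, b₂), s(c₃, a₃), s(c₃, b₃)}

theorem rim_rotate : rim c₁ c₂ c₃ c₀ = rim c₀ c₁ c₂ c₃ := by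
  ext; simp only [rim, mem_insert, mem_singleton]; tauto

theorem spokes_rotate : spokes c₁ c₂ c₃ c₀ a₁ b₁ a₂ b₂ a₃ b₃ a₀ b₀ =
    spokes c₀ c₁ c₂ c₃ a₀ b₀ a₁ b₁ a₂ b₂ a₃ b₃ := by
  ext; simp only [spokes, mem_insert, mem_singleton]; tauto

theorem card_rim_le : #(rim c₀ c₁ c₂ c₃) ≤ 4 := card_le_four

theorem card_spokes_le : #(spokes c₀ c₁ c₂ c₃ a₀ b₀ a₁ b₁ a₂ b₂ a₃ b₃) ≤ 8 := by
  unfold spokes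
  iterate 7 refine (card_insert_le _ _).trans (Nat.succ_le_succ ?_)
  simp

namespace Square

theorem starIn (h : Square G c₀ c₁ c₂ c₃ a₀ b₀ a₁ b₁ a₂ b₂ a₃ b₃) :
    (StarIn G (rim c₀ c₁ c₂ c₃ ∪ spokes c₀ c₁ c₂ c₃ a₀ b₀ a₁ b₁ a₂ b₂ a₃ b₃) c₀ ∧
    StarIn G (rim c₀ c₁ c₂ c₃ ∪ spokes c₀ c₁ c₂ c₃ a₀ b₀ a₁ b₁ a₂ b₂ a₃ b₃) c₁) ∧
    StarIn G (rim c₀ c₁ c₂ c₃ ∪ spokes c₀ c₁ c₂ c₃ a₀ b₀ a₁ b₁ a₂ b₂ a₃ b₃) c₂ ∧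
    StarIn G (rim c₀ c₁ c₂ c₃ ∪ spokes c₀ c₁ c₂ c₃ a₀ b₀ a₁ b₁ a₂ b₂ a₃ b₃) c₃ := by
  refine ⟨⟨h.nbs₀.starIn ?_ ?_ ?_ ?_, h.nbs₁.starIn ?_ ?_ ?_ ?_⟩,
    h.nbs₂.starIn ?_ ?_ ?_ ?_, h.nbs₃.starIn ?_ ?_ ?_ ?_⟩ <;> simp [rim, spokes]

theorem disjoint (h : Square G c₀ c₁ c₂ c₃ a₀ b₀ a₁ b₁ a₂ b₂ a₃ b₃) :
    Disjoint (rim c₀ c₁ c₂ c₃) (spokes c₀ c₁ c₂ c₃ a₀ b₀ a₁ b₁ a₂ b₂ a₃ b₃) := by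
  have key : ∀ {c₀ c₁ c₂ c₃ a₀ b₀ a₁ b₁ a₂ b₂ a₃ b₃ : V},
      Square G c₀ c₁ c₂ c₃ a₀ b₀ a₁ b₁ a₂ b₂ a₃ b₃ →
      s(c₀, a₀) ∉ rim c₀ c₁ c₂ c₃ ∧ s(c₀, b₀) ∉ rim c₀ c₁ c₂ c₃ := by
    intro c₀ c₁ c₂ c₃ a₀ b₀ a₁ b₁ a₂ b₂ a₃ b₃ h
    have h0 := h.nbs₀
    have e1 := h0.adj₁.ne
    have e2 := h0.adj₂.ne
    have e3 := h0.adj₃.ne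
    have e4 := h0.adj₄.ne
    simp only [rim, mem_insert, mem_singleton, Sym2.eq_iff, not_or]
    have := h.ne₀₂
    obtain ⟨-, _, _, _, _, _, _⟩ := h0
    refine ⟨⟨?_, ?_, ?_, ?_⟩, ⟨?_, ?_, ?_, ?_⟩⟩ <;> tauto
  rw [disjoint_right]
  have k0 := key h
  have k1 := key h.rotate
  have k2 := key h.rotate.rotate
  have k3 := key h.rotate.rotate.rotate
  rw [rim_rotate] at k1 k2 k3
  rw [rim_rotate] at k2 k3
  rw [rim_rotate] at k3
  simp only [spokes, mem_insert, mem_singleton]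
  rintro e (rfl | rfl | rfl | rfl | rfl | rfl | rfl | rfl) <;> tauto

end Square

theorem Square.outer (h : Square G c₀ c₁ c₂ c₃ a₀ b₀ a₁ b₁ a₂ b₂ a₃ b₃) {p : V}
    (hp : p = a₀ ∨ p = b₀) : p ≠ c₀ ∧ p ≠ c₁ ∧ p ≠ c₂ ∧ p ≠ c₃ := by
  have h0 := h.nbs₀
  have h1 : G.Adj c₀ p := (h0.adj_iff _).2 (by tauto)
  have h2 : p ≠ c₂ := by rintro rfl; exact h.nadj₀₂ h1
  have h3 := h1.ne
  obtain ⟨-, _, _, _, _, _, _⟩ := h0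
  refine ⟨h3.symm, ?_, h2, ?_⟩ <;> rcases hp with rfl | rfl <;> tauto

theorem Square.spoke_pair (h : Square G c₀ c₁ c₂ c₃ a₀ b₀ a₁ b₁ a₂ b₂ a₃ b₃) {p r : V}
    (hp : p = a₀ ∨ p = b₀) (hr : r = a₂ ∨ r = b₂) (hpr : ¬ G.Adj p r) :
    s(c₀, p) ∈ spokes c₀ c₁ c₂ c₃ a₀ b₀ a₁ b₁ a₂ b₂ a₃ b₃ ∧
    s(c₂, r) ∈ spokes c₀ c₁ c₂ c₃ a₀ b₀ a₁ b₁ a₂ b₂ a₃ b₃ ∧ s(c₀, p) ≠ s(c₂, r) ∧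
    ¬ StrongConflict G s(c₀, p) s(c₂, r) ∧ ¬ StrongConflict G s(c₂, r) s(c₀, p) := by
  have hn := h.not_conflict hp hr hpr
  refine ⟨?_, ?_, mk_ne_mk h.ne₀₂ (h.outer hp).2.2.1, hn, fun h' => hn (conflict_symm h')⟩ <;>
  · simp only [spokes, mem_insert, mem_singleton]
    rcases hp with rfl | rfl <;> rcases hr with rfl | rfl <;> tauto

theorem Square.spoke_ne (h : Square G c₀ c₁ c₂ c₃ a₀ b₀ a₁ b₁ a₂ b₂ a₃ b₃) {p q r t : V}
    (hp : p = a₀ ∨ p = b₀) (hr : r = a₂ ∨ r = b₂) : s(c₀, p) ≠ s(c₁, q) ∧ s(c₀, p) ≠ s(c₃, t) ∧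
      s(c₂, r) ≠ s(c₁, q) ∧ s(c₂, r) ≠ s(c₃, t) := by
  have h1 := h.outer hp
  have h2 := h.rotate.rotate.outer hr
  exact ⟨mk_ne_mk h.nbs₀.adj₁.ne h1.2.1, mk_ne_mk h.nbs₃.adj₁.ne' h1.2.2.2,
    mk_ne_mk h.nbs₁.adj₁.ne' h2.2.2.2, mk_ne_mk h.nbs₂.adj₁.ne h2.2.1⟩

theorem Square.spoke_pair' (h : Square G c₀ c₁ c₂ c₃ a₀ b₀ a₁ b₁ a₂ b₂ a₃ b₃) {q t : V}
    (hq : q = a₁ ∨ q = b₁) (ht : t = a₃ ∨ t = b₃) (hqt : ¬ G.Adj q t) :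
    s(c₁, q) ∈ spokes c₀ c₁ c₂ c₃ a₀ b₀ a₁ b₁ a₂ b₂ a₃ b₃ ∧
    s(c₃, t) ∈ spokes c₀ c₁ c₂ c₃ a₀ b₀ a₁ b₁ a₂ b₂ a₃ b₃ ∧ s(c₁, q) ≠ s(c₃, t) ∧
    ¬ StrongConflict G s(c₁, q) s(c₃, t) ∧ ¬ StrongConflict G s(c₃, t) s(c₁, q) := by
  rw [← spokes_rotate]
  exact h.rotate.spoke_pair hq ht hqt

theorem mem_of_mem_rim_union_spokes {e : Sym2 V} (he : e ∈ rim c₀ c₁ c₂ c₃ ∪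
    spokes c₀ c₁ c₂ c₃ a₀ b₀ a₁ b₁ a₂ b₂ a₃ b₃) : c₀ ∈ e ∨ c₁ ∈ e ∨ c₂ ∈ e ∨ c₃ ∈ e := by
  simp only [rim, spokes, mem_union, mem_insert, mem_singleton] at he
  rcases he with (rfl | rfl | rfl | rfl) | rfl | rfl | rfl | rfl | rfl | rfl | rfl | rfl <;> simp

variable [Fintype V]

theorem Square.rim_avail (h : Square G c₀ c₁ c₂ c₃ a₀ b₀ a₁ b₁ a₂ b₂ a₃ b₃)
    (hdeg : ∀ x, #(nb G x) ≤ 4) (c : Sym2 V → Fin 21) :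
    ∀ e ∈ rim c₀ c₁ c₂ c₃, 9 ≤ #(avail G (rim c₀ c₁ c₂ c₃ ∪
      spokes c₀ c₁ c₂ c₃ a₀ b₀ a₁ b₁ a₂ b₂ a₃ b₃) c e) := by
  obtain ⟨⟨s0, s1⟩, s2, s3⟩ := h.starIn
  have key : ∀ {x y p q a b a' b' : V} {U : Finset (Sym2 V)}, Nbs G x y p a b →
      Nbs G y q x a' b' → StarIn G U x → StarIn G U y → StarIn G U p → StarIn G U q →
      9 ≤ #(avail G U c s(x, y)) := by
    intro x y p q a b a' b' U hx hy hxU hyU hp hq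
    refine le_card_avail (seen_sdiff_subset_far hx.adj₁ hxU hyU hp hq) ?_
    have h1 := hx.card_far_two hdeg
    have h2 := hy.swap₁₂.card_far_two hdeg
    have := card_union_le (far G x {y, p}) (far G y {x, q})
    omega
  simp only [rim, mem_insert, mem_singleton]
  rintro e (rfl | rfl | rfl | rfl)
  · exact key h.nbs₀ h.nbs₁ s0 s1 s3 s2
  · exact key h.nbs₁ h.nbs₂ s1 s2 s0 s3
  · exact key h.nbs₂ h.nbs₃ s2 s3 s1 s0
  · exact key h.nbs₃ h.nbs₀ s3 s0 s2 s1

theorem Square.spokes_avail (h : Square G c₀ c₁ c₂ c₃ a₀ b₀ a₁ b₁ a₂ b₂ a₃ b₃)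
    (hdeg : ∀ x, #(nb G x) ≤ 4) (c : Sym2 V → Fin 21) :
    ∀ e ∈ spokes c₀ c₁ c₂ c₃ a₀ b₀ a₁ b₁ a₂ b₂ a₃ b₃, 6 ≤ #(avail G (rim c₀ c₁ c₂ c₃ ∪
      spokes c₀ c₁ c₂ c₃ a₀ b₀ a₁ b₁ a₂ b₂ a₃ b₃) c e) := by
  obtain ⟨⟨s0, s1⟩, s2, s3⟩ := h.starIn
  generalize hU : rim c₀ c₁ c₂ c₃ ∪ spokes c₀ c₁ c₂ c₃ a₀ b₀ a₁ b₁ a₂ b₂ a₃ b₃ = U at *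
  simp only [spokes, mem_insert, mem_singleton]
  rintro e (rfl | rfl | rfl | rfl | rfl | rfl | rfl | rfl)
  · exact six_le_card_avail hdeg h.nbs₀ s0 s1 s3
  · exact six_le_card_avail hdeg h.nbs₀.swap₃₄ s0 s1 s3
  · exact six_le_card_avail hdeg h.nbs₁ s1 s2 s0
  · exact six_le_card_avail hdeg h.nbs₁.swap₃₄ s1 s2 s0
  · exact six_le_card_avail hdeg h.nbs₂ s2 s3 s1
  · exact six_le_card_avail hdeg h.nbs₂.swap₃₄ s2 s3 s1
  · exact six_le_card_avail hdeg h.nbs₃ s3 s0 s2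
  · exact six_le_card_avail hdeg h.nbs₃.swap₃₄ s3 s0 s2

/-- Three disjoint pairs of spokes can share colors. -/
theorem Square.exists_proper_of_three (hG : G.Connected)
    (h : Square G c₀ c₁ c₂ c₃ a₀ b₀ a₁ b₁ a₂ b₂ a₃ b₃) (hdeg : ∀ x, #(nb G x) ≤ 4)
    (h₁ : ¬ G.Adj a₀ a₂) (h₂ : ¬ G.Adj b₀ b₂) {q t : V} (hq : q = a₁ ∨ q = b₁)
    (ht : t = a₃ ∨ t = b₃) (hqt : ¬ G.Adj q t) : ∃ c, Proper G (edges G) c := by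
  obtain ⟨c, hc⟩ := exists_proper_sdiff hG hdeg _ h.starIn.1.1
  refine exists_proper_of_choosable hc ?_
  have hR := h.rim_avail hdeg c
  have hS := h.spokes_avail hdeg c
  have n1 := h.spoke_pair (Or.inl rfl) (Or.inl rfl) h₁
  have n2 := h.spoke_pair (Or.inr rfl) (Or.inr rfl) h₂
  have n3 := h.spoke_pair' hq ht hqt
  have d1 := h.spoke_ne (q := q) (t := t) (Or.inl rfl) (Or.inl rfl)
  have d2 := h.spoke_ne (q := q) (t := t) (Or.inr rfl) (Or.inr rfl)
  have d3 : s(c₀, a₀) ≠ s(c₀, b₀) ∧ s(c₀, a₀) ≠ s(c₂, b₂) ∧ s(c₂, a₂) ≠ s(c₀, b₀) ∧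
      s(c₂, a₂) ≠ s(c₂, b₂) :=
    ⟨fun he => h.nbs₀.ne₃₄ (Sym2.congr_right.1 he), mk_ne_mk h.ne₀₂ (h.outer (Or.inl rfl)).2.2.1,
      mk_ne_mk h.ne₀₂.symm (h.rotate.rotate.outer (Or.inl rfl)).2.2.1,
      fun he => h.nbs₂.ne₃₄ (Sym2.congr_right.1 he)⟩
  have m0 : s(c₀, c₁) ∈ rim c₀ c₁ c₂ c₃ := by simp [rim]
  have hr := card_rim_le (c₀ := c₀) (c₁ := c₁) (c₂ := c₂) (c₃ := c₃)
  have hs := card_spokes_le (c₀ := c₀) (c₁ := c₁) (c₂ := c₂) (c₃ := c₃) (a₀ := a₀) (b₀ := b₀)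
    (a₁ := a₁) (b₁ := b₁) (a₂ := a₂) (b₂ := b₂) (a₃ := a₃) (b₃ := b₃)
  exact choosable_of_three_pairs (L := avail G (rim c₀ c₁ c₂ c₃ ∪
      spokes c₀ c₁ c₂ c₃ a₀ b₀ a₁ b₁ a₂ b₂ a₃ b₃) c) 6 3 h.disjoint (by omega)
    (fun e he => by have := hR e he; omega) m0 m0 (by simpa using hR _ m0)
    hS (by omega)
    ⟨n1.1, n1.2.1, n1.2.2.1, n1.2.2.2.1, n1.2.2.2.2, Nat.add_le_add (hS _ n1.1) (hS _ n1.2.1)⟩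
    ⟨n2.1, n2.2.1, n2.2.2.1, n2.2.2.2.1, n2.2.2.2.2, Nat.add_le_add (hS _ n2.1) (hS _ n2.2.1)⟩
    ⟨n3.1, n3.2.1, n3.2.2.1, n3.2.2.2.1, n3.2.2.2.2, Nat.add_le_add (hS _ n3.1) (hS _ n3.2.1)⟩
    d3 d1 d2

/-- An outer vertex adjacent to both outer vertices at the opposite vertex of the cycle. -/
theorem Square.exists_proper_of_cherry (hG : G.Connected)
    (h : Square G c₀ c₁ c₂ c₃ a₀ b₀ a₁ b₁ a₂ b₂ a₃ b₃) (hreg : ∀ x, #(nb G x) = 4)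
    (h₁ : G.Adj a₀ a₂) (h₂ : G.Adj a₀ b₂) {p r : V} (hp : p = a₀ ∨ p = b₀)
    (hr : r = a₂ ∨ r = b₂) (hpr : ¬ G.Adj p r) {q t : V} (hq : q = a₁ ∨ q = b₁)
    (ht : t = a₃ ∨ t = b₃) (hqt : ¬ G.Adj q t) (ha₀c₁ : ¬ G.Adj a₀ c₁) (ha₀c₃ : ¬ G.Adj a₀ c₃) :
    ∃ c, Proper G (edges G) c := by
  have hdeg : ∀ x, #(nb G x) ≤ 4 := fun x => (hreg x).le
  obtain ⟨c, hc⟩ := exists_proper_sdiff hG hdeg _ h.starIn.1.1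
  refine exists_proper_of_choosable hc ?_
  have hR := h.rim_avail hdeg c
  have hS := h.spokes_avail hdeg c
  have n1 := h.spoke_pair hp hr hpr
  have n3 := h.spoke_pair' hq ht hqt
  have d1 := h.spoke_ne (q := q) (t := t) hp hr
  have m0 : s(c₀, c₁) ∈ rim c₀ c₁ c₂ c₃ := by simp [rim]
  have m1 : s(c₁, c₂) ∈ rim c₀ c₁ c₂ c₃ := by simp [rim]
  have hrc := card_rim_le (c₀ := c₀) (c₁ := c₁) (c₂ := c₂) (c₃ := c₃)
  have hsc := card_spokes_le (c₀ := c₀) (c₁ := c₁) (c₂ := c₂) (c₃ := c₃) (a₀ := a₀) (b₀ := b₀)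
    (a₁ := a₁) (b₁ := b₁) (a₂ := a₂) (b₂ := b₂) (a₃ := a₃) (b₃ := b₃)
  suffices hu : ∃ e ∈ rim c₀ c₁ c₂ c₃, 10 ≤ #(avail G (rim c₀ c₁ c₂ c₃ ∪
      spokes c₀ c₁ c₂ c₃ a₀ b₀ a₁ b₁ a₂ b₂ a₃ b₃) c s(c₀, c₁) ∪ avail G (rim c₀ c₁ c₂ c₃ ∪
      spokes c₀ c₁ c₂ c₃ a₀ b₀ a₁ b₁ a₂ b₂ a₃ b₃) c e) by
    obtain ⟨e, he, hu⟩ := hu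
    exact choosable_of_two_pairs (L := avail G (rim c₀ c₁ c₂ c₃ ∪
        spokes c₀ c₁ c₂ c₃ a₀ b₀ a₁ b₁ a₂ b₂ a₃ b₃) c) 8 4 h.disjoint (by omega)
      hR m0 he hu hS (by omega)
      ⟨n1.1, n1.2.1, n1.2.2.1, n1.2.2.2.1, n1.2.2.2.2,
        (Nat.add_le_add (hS _ n1.1) (hS _ n1.2.1) : 6 + 6 ≤ _)⟩
      ⟨n3.1, n3.2.1, n3.2.2.1, n3.2.2.2.1, n3.2.2.2.2,
        (Nat.add_le_add (hS _ n3.1) (hS _ n3.2.1) : 6 + 6 ≤ _)⟩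
      d1
  obtain ⟨⟨s0, s1⟩, s2, s3⟩ := h.starIn
  set U := rim c₀ c₁ c₂ c₃ ∪ spokes c₀ c₁ c₂ c₃ a₀ b₀ a₁ b₁ a₂ b₂ a₃ b₃ with hU
  obtain ⟨x, hx⟩ := exists_nbs_of_three (hreg a₀) h.nbs₀.adj₃.symm h₁ h₂
    (h.rotate.rotate.outer (Or.inl rfl)).2.2.1.symm (h.rotate.rotate.outer (Or.inr rfl)).2.2.1.symm
    h.nbs₂.ne₃₄
  have hout := h.outer (Or.inl rfl : a₀ = a₀ ∨ a₀ = b₀)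
  have hxc₂ : x ≠ c₂ := by
    rintro rfl
    exact (h.common₀₂ _ h.nbs₀.adj₃ hx.adj₄.symm).elim hout.2.1 hout.2.2.2
  have hxc₀ := hx.ne₁₄.symm
  have hxc₁ : x ≠ c₁ := by rintro rfl; exact ha₀c₁ hx.adj₄
  have hxc₃ : x ≠ c₃ := by rintro rfl; exact ha₀c₃ hx.adj₄
  have hnU : s(a₀, x) ∉ U := by
    intro h'
    have := mem_of_mem_rim_union_spokes h'
    simp only [Sym2.mem_iff] at this
    rcases this with (h | h) | (h | h) | (h | h) | (h | h)
    exacts [hout.1 h.symm, hxc₀ h.symm, hout.2.1 h.symm, hxc₁ h.symm, hout.2.2.1 h.symm,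
      hxc₂ h.symm, hout.2.2.2 h.symm, hxc₃ h.symm]
  have hax := mk_mem_edges.2 hx.adj₄
  have hS0 := seen_sdiff_subset_far h.nbs₀.adj₁ s0 s1 s3 s2
  have hS1 := seen_sdiff_subset_far h.nbs₁.adj₁ s1 s2 s0 s3
  have hf0 := h.nbs₀.card_far_two hdeg
  have hf1 := h.nbs₁.swap₁₂.card_far_two hdeg
  have hin : s(a₀, x) ∈ far G c₀ {c₁, c₃} :=
    mem_far hx.adj₄ h.nbs₀.adj₃ (by simp [hout]) hxc₀
  by_cases hk : c s(a₀, x) ∈ (far G c₁ {c₀, c₂}).image c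
  · refine ⟨_, m0, ?_⟩
    rw [union_self]
    refine le_card_univ_sdiff ?_
    have e1 : #((seen G s(c₀, c₁) \ U).image c) ≤
      #((far G c₀ {c₁, c₃}).image c ∪ (far G c₁ {c₀, c₂}).image c) := by
      rw [← image_union]; exact card_le_card (image_subset_image hS0)
    have e2 := card_union_add_card_inter ((far G c₀ {c₁, c₃}).image c) ((far G c₁ {c₀, c₂}).image c)
    have e3 : 0 < #((far G c₀ {c₁, c₃}).image c ∩ (far G c₁ {c₀, c₂}).image c) :=
      card_pos.2 ⟨_, mem_inter.2 ⟨mem_image_of_mem c hin, hk⟩⟩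
    have e4 : #((far G c₀ {c₁, c₃}).image c) ≤ _ := card_image_le
    have e5 : #((far G c₁ {c₀, c₂}).image c) ≤ _ := card_image_le
    omega
  · refine ⟨_, m1, ?_⟩
    have e1 : c s(a₀, x) ∉ avail G U c s(c₀, c₁) := by
      rw [mem_avail]
      push Not
      refine ⟨s(a₀, x), mem_seen.2 ⟨hax, ?_, ?_⟩, hnU, rfl⟩
      · exact mk_ne_mk hout.1.symm hout.2.1.symm
      · exact Or.inr ⟨c₀, a₀, by simp, by simp, h.nbs₀.adj₃⟩
    have e2 : c s(a₀, x) ∈ avail G U c s(c₁, c₂) := by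
      rw [mem_avail]
      intro f hf hfU hfk
      have hf' := hS1 (mem_sdiff.2 ⟨hf, hfU⟩)
      rcases mem_union.1 hf' with hf' | hf'
      · rw [pair_comm c₂ c₀] at hf'
        exact hk (hfk ▸ mem_image_of_mem c hf')
      · obtain ⟨z, hz, hf'⟩ := mem_biUnion.1 hf'
        obtain ⟨y, hy, -, rfl⟩ := exists_of_mem_fan hf'
        simp only [mem_sdiff, mem_nb, h.nbs₂.adj_iff, mem_insert, mem_singleton] at hz
        have hz' : z = a₂ ∨ z = b₂ := by clear * - hz; tauto
        have haz : G.Adj a₀ z := by rcases hz' with rfl | rfl <;> assumption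
        refine hc s(a₀, x) (mem_sdiff.2 ⟨hax, hnU⟩) s(z, y) (mem_sdiff.2 ⟨(mem_seen.1 hf).1, hfU⟩)
          ?_ (Or.inr ⟨a₀, z, by simp, by simp, haz⟩) hfk.symm
        refine mk_ne_mk haz.ne ?_
        rcases hz' with rfl | rfl
        exacts [hx.ne₂₄.symm, hx.ne₃₄.symm]
    have e3 := card_le_card (insert_subset (mem_union_right (avail G U c s(c₀, c₁)) e2)
      subset_union_left)
    rw [card_insert_of_notMem e1] at e3
    have := hR _ m0
    omega

end

section

section
variable {V : Type*} {G : SimpleGraph V} {c₀ c₁ c₂ c₃ a₀ b₀ a₁ b₁ a₂ b₂ a₃ b₃ : V}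

/-- No two vertices have three common neighbors. -/
def CommonLeTwo (G : SimpleGraph V) : Prop :=
  ∀ x y p q r, x ≠ y → p ≠ q → p ≠ r → q ≠ r → G.Adj x p → G.Adj x q → G.Adj x r →
    G.Adj y p → G.Adj y q → G.Adj y r → False

theorem Square.exists_not_adj (hK : CommonLeTwo G)
    (h : Square G c₀ c₁ c₂ c₃ a₀ b₀ a₁ b₁ a₂ b₂ a₃ b₃) :
    ∃ p r, (p = a₀ ∨ p = b₀) ∧ (r = a₂ ∨ r = b₂) ∧ ¬ G.Adj p r := by
  by_contra! hall
  exact hK a₂ b₂ c₂ a₀ b₀ h.nbs₂.ne₃₄ (h.outer (Or.inl rfl)).2.2.1.symm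
    (h.outer (Or.inr rfl)).2.2.1.symm h.nbs₀.ne₃₄ h.nbs₂.adj₃.symm
    (hall a₀ a₂ (by simp) (by simp)).symm (hall b₀ a₂ (by simp) (by simp)).symm h.nbs₂.adj₄.symm
    (hall a₀ b₂ (by simp) (by simp)).symm (hall b₀ b₂ (by simp) (by simp)).symm

end

variable {V : Type*} [Fintype V] {G : SimpleGraph V}

theorem exists_proper_of_four_cycle (hG : G.Connected) (hreg : ∀ x, #(nb G x) = 4)
    (htri : ∀ x y z, G.Adj x y → G.Adj x z → ¬ G.Adj y z) (hK : CommonLeTwo G) {c₀ c₁ c₂ c₃ : V}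
    (h₀₁ : G.Adj c₀ c₁) (h₁₂ : G.Adj c₁ c₂) (h₂₃ : G.Adj c₂ c₃) (h₃₀ : G.Adj c₃ c₀)
    (h₀₂ : c₀ ≠ c₂) (h₁₃ : c₁ ≠ c₃) : ∃ c, Proper G (edges G) c := by
  have hdeg : ∀ x, #(nb G x) ≤ 4 := fun x => (hreg x).le
  obtain ⟨a₀, b₀, n₀⟩ := exists_nbs_of_two (hreg c₀) h₀₁ h₃₀.symm h₁₃
  obtain ⟨a₁, b₁, n₁⟩ := exists_nbs_of_two (hreg c₁) h₁₂ h₀₁.symm h₀₂.symm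
  obtain ⟨a₂, b₂, n₂⟩ := exists_nbs_of_two (hreg c₂) h₂₃ h₁₂.symm h₁₃.symm
  obtain ⟨a₃, b₃, n₃⟩ := exists_nbs_of_two (hreg c₃) h₃₀ h₂₃.symm h₀₂
  have h : Square G c₀ c₁ c₂ c₃ a₀ b₀ a₁ b₁ a₂ b₂ a₃ b₃ := by
    refine ⟨n₀, n₁, n₂, n₃, h₀₂, h₁₃, htri c₁ c₀ c₂ h₀₁.symm h₁₂, htri c₀ c₁ c₃ h₀₁ h₃₀.symm,
      fun z hz hz' => ?_, fun z hz hz' => ?_⟩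
    · by_contra hne
      push Not at hne
      exact hK c₀ c₂ c₁ c₃ z h₀₂ h₁₃ hne.1.symm hne.2.symm h₀₁ h₃₀.symm hz h₁₂.symm h₂₃ hz'
    · by_contra hne
      push Not at hne
      exact hK c₁ c₃ c₀ c₂ z h₁₃ h₀₂ hne.1.symm hne.2.symm h₀₁.symm h₁₂ hz h₃₀ h₂₃.symm hz'
  obtain ⟨p, r, hp, hr, hpr⟩ := h.exists_not_adj hK
  obtain ⟨q, t, hq, ht, hqt⟩ := h.rotate.exists_not_adj hK
  have hrp : ¬ G.Adj r p := fun h' => hpr h'.symm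
  have htq : ¬ G.Adj t q := fun h' => hqt h'.symm
  by_cases e1 : G.Adj a₀ a₂
  · by_cases e2 : G.Adj a₀ b₂
    · exact h.exists_proper_of_cherry hG hreg e1 e2 hp hr hpr hq ht hqt
        (fun h' => htri _ _ _ n₀.adj₁ n₀.adj₃ h'.symm) fun h' => htri _ _ _ n₀.adj₂ n₀.adj₃ h'.symm
    · by_cases e3 : G.Adj b₀ a₂
      · exact h.rotate.rotate.exists_proper_of_cherry hG hreg e1.symm e3.symm hr hp hrp ht hq htq
          (fun h' => htri _ _ _ n₂.adj₁ n₂.adj₃ h'.symm)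
          fun h' => htri _ _ _ n₂.adj₂ n₂.adj₃ h'.symm
      · exact h.swap.exists_proper_of_three hG hdeg e3 e2 hq ht hqt
  · by_cases e2 : G.Adj b₀ b₂
    · by_cases e3 : G.Adj a₀ b₂
      · exact h.rotate.rotate.swap.exists_proper_of_cherry hG hreg e3.symm e2.symm hr.symm hp hrp
          ht hq htq (fun h' => htri _ _ _ n₂.adj₁ n₂.adj₄ h'.symm)
          fun h' => htri _ _ _ n₂.adj₂ n₂.adj₄ h'.symm
      · by_cases e4 : G.Adj b₀ a₂
        · exact h.swap.exists_proper_of_cherry hG hreg e4 e2 hp.symm hr hpr hq ht hqt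
            (fun h' => htri _ _ _ n₀.adj₁ n₀.adj₄ h'.symm)
            fun h' => htri _ _ _ n₀.adj₂ n₀.adj₄ h'.symm
        · exact h.swap.exists_proper_of_three hG hdeg e4 e3 hq ht hqt
    · exact h.exists_proper_of_three hG hdeg e1 e2 hq ht hqt

end

section

section
variable {V : Type*} {G : SimpleGraph V} {U : Finset (Sym2 V)} {x y v₁ v₂ v₃ s t o o' p p' : V}

/-- The vertices `x`, `y` have the common neighbors `v₁`, `v₂`, `v₃`, and the set `U` contains all
edges at `x`, `y`, `v₁`, `v₂`. -/
structure Theta (G : SimpleGraph V) (U : Finset (Sym2 V)) (x y v₁ v₂ v₃ s t o o' p p' : V) :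
    Prop where
  ne : x ≠ y
  nbs_x : Nbs G x v₁ v₂ v₃ s
  nbs_y : Nbs G y v₁ v₂ v₃ t
  nbs₁ : Nbs G v₁ x y o o'
  nbs₂ : Nbs G v₂ x y p p'
  star_x : StarIn G U x
  star_y : StarIn G U y
  star₁ : StarIn G U v₁
  star₂ : StarIn G U v₂

theorem Theta.flip (h : Theta G U x y v₁ v₂ v₃ s t o o' p p') :
    Theta G U y x v₁ v₂ v₃ t s o o' p p' :=
  ⟨h.ne.symm, h.nbs_y, h.nbs_x, h.nbs₁.swap₁₂, h.nbs₂.swap₁₂, h.star_y, h.star_x, h.star₁,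
    h.star₂⟩

theorem Theta.swap (h : Theta G U x y v₁ v₂ v₃ s t o o' p p') :
    Theta G U x y v₂ v₁ v₃ s t p p' o o' :=
  ⟨h.ne, h.nbs_x.swap₁₂, h.nbs_y.swap₁₂, h.nbs₂, h.nbs₁, h.star_x, h.star_y, h.star₂, h.star₁⟩

theorem Theta.swap_left (h : Theta G U x y v₁ v₂ v₃ s t o o' p p') :
    Theta G U x y v₁ v₂ v₃ s t o' o p p' :=
  { h with nbs₁ := h.nbs₁.swap₃₄ }

end

variable {V : Type*} [Fintype V] {G : SimpleGraph V} {U : Finset (Sym2 V)}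
  {x y v₁ v₂ v₃ s t o o' p p' : V} {c : Sym2 V → Fin 21}

theorem starIn_fan_two (hz : s(v₃, x) ∈ U) (hz' : s(v₃, y) ∈ U) :
    StarIn G (U ∪ fan G v₃ {x, y}) v₃ := by
  intro q hq
  by_cases h1 : q = x
  · subst h1; exact mem_union_left _ hz
  by_cases h2 : q = y
  · subst h2; exact mem_union_left _ hz'
  exact mem_union_right _ (mem_fan hq (by simp [h1, h2]))

namespace Theta

theorem star₃ (h : Theta G U x y v₁ v₂ v₃ s t o o' p p') :
    StarIn G (U ∪ fan G v₃ {x, y}) v₃ := by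
  refine starIn_fan_two ?_ ?_ <;> rw [Sym2.eq_swap]
  exacts [h.star_x _ h.nbs_x.adj₃, h.star_y _ h.nbs_y.adj₃]

theorem seen_subset (h : Theta G U x y v₁ v₂ v₃ s t o o' p p') :
    seen G s(x, v₁) \ U ⊆ far G x {v₁, v₂, v₃} ∪ (far G v₁ {x, y} ∪ fan G v₃ {x, y}) := by
  rw [← union_assoc]
  refine seen_sdiff_subset h.nbs_x.adj₁ h.star_x.wide_sdiff_subset h.star₁.wide_sdiff_subset ?_ ?_
  · simp only [mem_insert, mem_singleton]
    rintro w (rfl | rfl | rfl) hw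
    exacts [absurd rfl hw, h.star₂.mono subset_union_left, h.star₃]
  · simp only [mem_insert, mem_singleton]
    rintro w (rfl | rfl) hw
    exacts [absurd rfl hw, h.star_y.mono subset_union_left]

theorem card_fan₃ (h : Theta G U x y v₁ v₂ v₃ s t o o' p p') (hdeg : ∀ x, #(nb G x) ≤ 4) :
    #(fan G v₃ {x, y}) ≤ 2 := card_fan_two hdeg h.nbs_x.adj₃.symm h.nbs_y.adj₃.symm h.ne

/-- The edges seen by both `x v₁` and `y v₁`. -/
theorem exists_common (h : Theta G U x y v₁ v₂ v₃ s t o o' p p') (hdeg : ∀ x, #(nb G x) ≤ 4) :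
    ∃ D, #D ≤ 8 ∧ seen G s(x, v₁) \ U ⊆ far G x {v₁, v₂, v₃} ∪ D ∧
      seen G s(y, v₁) \ U ⊆ far G y {v₁, v₂, v₃} ∪ D := by
  refine ⟨_, ?_, h.seen_subset, ?_⟩
  · have h1 := h.nbs₁.card_far_two hdeg
    have h2 := h.card_fan₃ hdeg
    have := card_union_le (far G v₁ {x, y}) (fan G v₃ {x, y})
    omega
  · rw [pair_comm x y]
    exact h.flip.seen_subset

theorem seen_subset_of_eq (h : Theta G U x y v₁ v₂ v₃ s t o o' o p') :
    seen G s(x, v₁) \ U ⊆ far G x {v₁, v₂, v₃} ∪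
      (far G v₁ {x, y, o} ∪ (fan G v₃ {x, y} ∪ fan G o {v₁, v₂})) := by
  rw [← union_assoc]
  refine seen_sdiff_subset h.nbs_x.adj₁ h.star_x.wide_sdiff_subset h.star₁.wide_sdiff_subset ?_ ?_
  · simp only [mem_insert, mem_singleton]
    rintro w (rfl | rfl | rfl) hw
    exacts [absurd rfl hw, h.star₂.mono subset_union_left, h.star₃.mono (by
      rw [← union_assoc]; exact subset_union_left)]
  · simp only [mem_insert, mem_singleton]
    rintro w (rfl | rfl | rfl) hw
    · exact absurd rfl hw
    · exact h.star_y.mono subset_union_left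
    · refine (starIn_fan_two (G := G) (U := U) (x := v₁) (y := v₂) ?_ ?_).mono
        (union_subset_union_right subset_union_right) <;> rw [Sym2.eq_swap]
      exacts [h.star₁ _ h.nbs₁.adj₃, h.star₂ _ h.nbs₂.adj₃]

theorem exists_common_of_eq (h : Theta G U x y v₁ v₂ v₃ s t o o' o p')
    (hdeg : ∀ x, #(nb G x) ≤ 4) :
    ∃ D, #D ≤ 7 ∧ seen G s(x, v₁) \ U ⊆ far G x {v₁, v₂, v₃} ∪ D ∧
      seen G s(y, v₁) \ U ⊆ far G y {v₁, v₂, v₃} ∪ D := by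
  refine ⟨_, ?_, h.seen_subset_of_eq, ?_⟩
  · have h1 := h.nbs₁.card_far_three hdeg
    have h2 := h.card_fan₃ hdeg
    have h3 := card_fan_two hdeg h.nbs₁.adj₃.symm h.nbs₂.adj₃.symm h.nbs_x.ne₁₂
    have := card_union_le (far G v₁ {x, y, o}) (fan G v₃ {x, y} ∪ fan G o {v₁, v₂})
    have := card_union_le (fan G v₃ {x, y}) (fan G o {v₁, v₂})
    omega
  · rw [pair_comm x y, insert_comm x y]
    exact h.flip.seen_subset_of_eq

theorem le_card_avail_left (h : Theta G U x y v₁ v₂ v₃ s t o o' p p')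
    (hdeg : ∀ x, #(nb G x) ≤ 4) {D : Finset (Sym2 V)} {e : Sym2 V} {n : ℕ} (hD : n + #D ≤ 18)
    (he : seen G e \ U ⊆ far G x {v₁, v₂, v₃} ∪ D) : n ≤ #(avail G U c e) := by
  refine le_card_avail he ?_
  have h1 := h.nbs_x.card_far_three hdeg
  have := card_union_le (far G x {v₁, v₂, v₃}) D
  omega

theorem mem_far (h : Theta G U x y v₁ v₂ v₃ s t o o' p p') {f : Sym2 V}
    (hf : f ∈ far G x {v₁, v₂, v₃}) : ∃ q, G.Adj s q ∧ q ≠ x ∧ f = s(s, q) := by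
  obtain ⟨z, hz, hf⟩ := mem_biUnion.1 hf
  obtain ⟨q, hq, hqx, rfl⟩ := exists_of_mem_fan hf
  simp only [mem_sdiff, mem_nb, h.nbs_x.adj_iff, mem_insert, mem_singleton] at hz
  have : z = s := by tauto
  exact ⟨q, this ▸ hq, by simpa using hqx, by rw [this]⟩

/-- If `s`, `t` are equal or adjacent, few colors occur both at `s` and at `t`. -/
theorem exists_common_colors (h : Theta G U x y v₁ v₂ v₃ s t o o' p p')
    (hdeg : ∀ x, #(nb G x) ≤ 4) (hc : Proper G (edges G \ U) c) (hst : s = t ∨ G.Adj s t) :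
    ∃ Z : Finset (Fin 21), #Z ≤ 2 ∧ ∀ f ∈ far G x {v₁, v₂, v₃} \ U,
      ∀ g ∈ far G y {v₁, v₂, v₃} \ U, c f = c g → c f ∈ Z := by
  rcases hst with rfl | hst
  · refine ⟨(fan G s {x, y}).image c, card_image_le.trans
      (card_fan_two hdeg h.nbs_x.adj₄.symm h.nbs_y.adj₄.symm h.ne), fun f hf g _ _ => ?_⟩
    obtain ⟨hf, hfU⟩ := mem_sdiff.1 hf
    obtain ⟨q, hq, hqx, rfl⟩ := h.mem_far hf
    refine mem_image_of_mem c (mem_fan hq ?_)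
    simp only [mem_insert, mem_singleton, not_or]
    refine ⟨hqx, ?_⟩
    rintro rfl
    rw [Sym2.eq_swap] at hfU
    exact hfU (h.star_y _ hq.symm)
  · refine ⟨{c s(s, t)}, by simp, fun f hf g hg hfg => ?_⟩
    obtain ⟨hf, hfU⟩ := mem_sdiff.1 hf
    obtain ⟨hg, hgU⟩ := mem_sdiff.1 hg
    obtain ⟨q, hq, -, rfl⟩ := h.mem_far hf
    obtain ⟨r, hr, -, rfl⟩ := h.flip.mem_far hg
    have he : s(s, q) = s(t, r) := by
      by_contra hne
      exact hc _ (mem_sdiff.2 ⟨mk_mem_edges.2 hq, hfU⟩) _ (mem_sdiff.2 ⟨mk_mem_edges.2 hr, hgU⟩)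
        hne (Or.inr ⟨s, t, by simp, by simp, hst⟩) hfg
    rcases Sym2.eq_iff.1 he with ⟨rfl, -⟩ | ⟨-, rfl⟩
    · exact absurd hst (G.loopless.irrefl _)
    · simp

theorem le_card_avail_union (h : Theta G U x y v₁ v₂ v₃ s t o o' p p')
    (hdeg : ∀ x, #(nb G x) ≤ 4) (hc : Proper G (edges G \ U) c) (hst : s = t ∨ G.Adj s t)
    {D : Finset (Sym2 V)} {e f : Sym2 V} {n : ℕ} (hD : n + #D ≤ 19)
    (he : seen G e \ U ⊆ far G x {v₁, v₂, v₃} ∪ D) (hf : seen G f \ U ⊆ far G y {v₁, v₂, v₃} ∪ D) :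
    n ≤ #(avail G U c e ∪ avail G U c f) := by
  obtain ⟨Z, hZ, hZc⟩ := h.exists_common_colors hdeg hc hst
  have h1 : univ \ (Z ∪ D.image c) ⊆ avail G U c e ∪ avail G U c f := by
    intro a ha
    by_contra hna
    simp only [mem_union, not_or, mem_avail] at hna
    push Not at hna
    obtain ⟨⟨e', he', heU, rfl⟩, f', hf', hfU, hef⟩ := hna
    simp only [mem_sdiff, mem_univ, true_and, mem_union, not_or, mem_image, not_exists,
      not_and] at ha
    have h2 := (mem_union.1 (he (mem_sdiff.2 ⟨he', heU⟩))).resolve_right fun h => ha.2 _ h rfl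
    have h3 := (mem_union.1 (hf (mem_sdiff.2 ⟨hf', hfU⟩))).resolve_right fun h => ha.2 _ h hef
    exact ha.1 (hZc _ (mem_sdiff.2 ⟨h2, heU⟩) _ (mem_sdiff.2 ⟨h3, hfU⟩) hef.symm)
  refine le_trans (le_card_univ_sdiff ?_) (card_le_card h1)
  have := card_union_le Z (D.image c)
  have : #(D.image c) ≤ _ := card_image_le
  omega

theorem ten_le_card_avail₃ (h : Theta G U x y v₁ v₂ v₃ s t o o' p p')
    (hdeg : ∀ x, #(nb G x) ≤ 4) : 10 ≤ #(avail G U c s(x, v₃)) := by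
  refine le_card_avail (seen_sdiff_subset (E := ∅) (X := {v₁, v₂, v₃}) (Y := {x, y}) h.nbs_x.adj₃
    h.star_x.wide_sdiff_subset sdiff_subset ?_ ?_) ?_
  · simp only [mem_insert, mem_singleton, union_empty]
    rintro w (rfl | rfl | rfl) hw
    exacts [h.star₁, h.star₂, absurd rfl hw]
  · simp only [mem_insert, mem_singleton, union_empty]
    rintro w (rfl | rfl) hw
    exacts [absurd rfl hw, h.star_y]
  · have h1 := h.nbs_x.card_far_three hdeg
    have h2 := card_wide_two hdeg h.nbs_x.adj₃.symm h.nbs_y.adj₃.symm h.ne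
    have := card_union_le (far G x {v₁, v₂, v₃}) (wide G v₃ {x, y})
    rw [union_empty]; omega

theorem le_card_avail_outer (h : Theta G U x y v₁ v₂ v₃ s t o o' p p')
    (hdeg : ∀ x, #(nb G x) ≤ 4) {Y : Finset V} {F : Finset (Sym2 V)} {n : ℕ}
    (hY : ∀ w ∈ Y, w ≠ x → StarIn G (U ∪ F) w) (hn : n + #(wide G s Y) + #F ≤ 19) :
    n ≤ #(avail G U c s(x, s)) := by
  refine le_card_avail (seen_sdiff_subset (E := fan G v₃ {x, y} ∪ F) (X := {v₁, v₂, v₃, s}) (Y := Y)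
    h.nbs_x.adj₄ h.star_x.wide_sdiff_subset sdiff_subset ?_ ?_) ?_
  · simp only [mem_insert, mem_singleton]
    rintro w (rfl | rfl | rfl | rfl) hw
    exacts [h.star₁.mono subset_union_left, h.star₂.mono subset_union_left, h.star₃.mono
      (union_subset_union_right subset_union_left), absurd rfl hw]
  · exact fun w hw hwx => (hY w hw hwx).mono (union_subset_union_right subset_union_right)
  · rw [h.nbs_x.far_eq_empty, empty_union]
    have h2 := h.card_fan₃ hdeg
    have := card_union_le (fan G v₃ {x, y}) F
    have := card_union_le (wide G s Y) (fan G v₃ {x, y} ∪ F)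
    omega

theorem seven_le_card_avail_outer (h : Theta G U x y v₁ v₂ v₃ s t o o' p p')
    (hdeg : ∀ x, #(nb G x) ≤ 4) : 7 ≤ #(avail G U c s(x, s)) := by
  refine h.le_card_avail_outer hdeg (Y := {x}) (F := ∅) ?_ ?_
  · simp only [mem_singleton]
    rintro w rfl hw
    exact absurd rfl hw
  · have := card_wide_one hdeg h.nbs_x.adj₄.symm
    simp; omega

theorem ten_le_card_avail_common (h : Theta G U x y v₁ v₂ v₃ s t o o' o p')
    (hdeg : ∀ x, #(nb G x) ≤ 4) : 10 ≤ #(avail G U c s(v₁, o)) := by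
  refine le_card_avail (seen_sdiff_subset (E := ∅) (X := {x, y, o}) (Y := {v₁, v₂}) h.nbs₁.adj₃
    h.star₁.wide_sdiff_subset sdiff_subset ?_ ?_) ?_
  · simp only [mem_insert, mem_singleton, union_empty]
    rintro w (rfl | rfl | rfl) hw
    exacts [h.star_x, h.star_y, absurd rfl hw]
  · simp only [mem_insert, mem_singleton, union_empty]
    rintro w (rfl | rfl) hw
    exacts [absurd rfl hw, h.star₂]
  · have h1 := h.nbs₁.card_far_three hdeg
    have h2 := card_wide_two hdeg h.nbs₁.adj₃.symm h.nbs₂.adj₃.symm h.nbs_x.ne₁₂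
    have := card_union_le (far G v₁ {x, y, o}) (wide G o {v₁, v₂})
    rw [union_empty]; omega

theorem seven_le_card_avail_of_common (h : Theta G U x y v₁ v₂ v₃ s t o o' o p')
    (hdeg : ∀ x, #(nb G x) ≤ 4) : 7 ≤ #(avail G U c s(v₁, o')) := by
  refine le_card_avail (seen_sdiff_subset (E := fan G o {v₁, v₂}) (X := {x, y, o, o'}) (Y := {v₁})
    h.nbs₁.adj₄ h.star₁.wide_sdiff_subset sdiff_subset ?_ ?_) ?_
  · simp only [mem_insert, mem_singleton]
    rintro w (rfl | rfl | rfl | rfl) hw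
    · exact h.star_x.mono subset_union_left
    · exact h.star_y.mono subset_union_left
    · refine starIn_fan_two ?_ ?_ <;> rw [Sym2.eq_swap]
      exacts [h.star₁ _ h.nbs₁.adj₃, h.star₂ _ h.nbs₂.adj₃]
    · exact absurd rfl hw
  · simp only [mem_singleton]
    rintro w rfl hw
    exact absurd rfl hw
  · rw [h.nbs₁.far_eq_empty, empty_union]
    have h1 := card_wide_one hdeg h.nbs₁.adj₄.symm
    have h2 := card_fan_two hdeg h.nbs₁.adj₃.symm h.nbs₂.adj₃.symm h.nbs_x.ne₁₂
    have := card_union_le (wide G o' {v₁}) (fan G o {v₁, v₂})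
    omega

theorem six_le_card_avail_outer (h : Theta G U x y v₁ v₂ v₃ s t o o' p p')
    (hdeg : ∀ x, #(nb G x) ≤ 4) : 6 ≤ #(avail G U c s(v₁, o)) :=
  six_le_card_avail hdeg h.nbs₁ h.star₁ h.star_x h.star_y

theorem eight_le_card_avail_outer (h : Theta G U x y v₁ v₂ v₃ s t o o' p p')
    (hdeg : ∀ x, #(nb G x) ≤ 4) (hxy : ¬ G.Adj x y) (hst : s = t ∨ G.Adj s t) :
    8 ≤ #(avail G U c s(x, s)) := by
  rcases hst with rfl | hst
  · refine h.le_card_avail_outer hdeg (Y := {x, y}) (F := ∅) ?_ ?_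
    · simp only [mem_insert, mem_singleton, union_empty]
      rintro w (rfl | rfl) hw
      exacts [absurd rfl hw, h.star_y]
    · have := card_wide_two hdeg h.nbs_x.adj₄.symm h.nbs_y.adj₄.symm h.ne
      simp; omega
  · have hxt : x ≠ t := by
      rintro rfl
      exact hxy h.nbs_y.adj₄.symm
    refine h.le_card_avail_outer hdeg (Y := {x, t}) (F := fan G t {y}) ?_ ?_
    · simp only [mem_insert, mem_singleton]
      rintro w (rfl | rfl) hw
      · exact absurd rfl hw
      · intro q hq
        by_cases hqy : q = y
        · subst hqy
          rw [Sym2.eq_swap]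
          exact mem_union_left _ (h.star_y _ hq.symm)
        · exact mem_union_right _ (mem_fan hq (by simpa using hqy))
    · have h1 := card_wide_two hdeg h.nbs_x.adj₄.symm hst hxt
      have h2 := card_fan_one hdeg h.nbs_y.adj₄.symm
      omega

end Theta

end

section

section
variable {V : Type*} {G : SimpleGraph V} {U : Finset (Sym2 V)} {x y v₁ v₂ v₃ s t o o' p p' : V}

/-- The edges of the 4-cycle `x v₁ y v₂`. -/
noncomputable def thetaRim (x y v₁ v₂ : V) : Finset (Sym2 V) :=
  {s(x, v₁), s(y, v₁), s(x, v₂), s(y, v₂)}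

/-- The edges of the path `x v₃ y`. -/
noncomputable def thetaPath (x y v₃ : V) : Finset (Sym2 V) := {s(x, v₃), s(y, v₃)}

/-- The other edges at `x`, `y`, `v₁`, `v₂`. -/
noncomputable def thetaOuter (x y v₁ v₂ s t o o' p p' : V) : Finset (Sym2 V) :=
  {s(x, s), s(y, t), s(v₁, o), s(v₁, o'), s(v₂, p), s(v₂, p')}

theorem card_thetaRim_le : #(thetaRim x y v₁ v₂) ≤ 4 := card_le_four

theorem card_thetaPath_le : #(thetaPath x y v₃) ≤ 2 := card_le_two

theorem card_thetaOuter_le : #(thetaOuter x y v₁ v₂ s t o o' p p') ≤ 6 := card_le_six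

theorem mem_thetaRim : s(x, v₁) ∈ thetaRim x y v₁ v₂ ∧ s(y, v₁) ∈ thetaRim x y v₁ v₂ := by
  simp [thetaRim]

theorem mem_thetaOuter : s(x, s) ∈ thetaOuter x y v₁ v₂ s t o o' p p' ∧
    s(y, t) ∈ thetaOuter x y v₁ v₂ s t o o' p p' ∧ s(v₁, o) ∈ thetaOuter x y v₁ v₂ s t o o' p p' ∧
    s(v₂, p) ∈ thetaOuter x y v₁ v₂ s t o o' p p' := by
  simp [thetaOuter]

theorem theta_of_nbs (ne : x ≠ y) (hx : Nbs G x v₁ v₂ v₃ s) (hy : Nbs G y v₁ v₂ v₃ t)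
    (h₁ : Nbs G v₁ x y o o') (h₂ : Nbs G v₂ x y p p') (hU : thetaRim x y v₁ v₂ ⊆ U)
    (hU' : thetaPath x y v₃ ⊆ U) (hU'' : thetaOuter x y v₁ v₂ s t o o' p p' ⊆ U) :
    Theta G U x y v₁ v₂ v₃ s t o o' p p' := by
  simp only [thetaRim, thetaPath, thetaOuter, insert_subset_iff, singleton_subset_iff]
    at hU hU' hU''
  obtain ⟨a1, a2, a3, a4⟩ := hU
  obtain ⟨b1, b2⟩ := hU'
  obtain ⟨d1, d2, d3, d4, d5, d6⟩ := hU''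
  refine ⟨ne, hx, hy, h₁, h₂, hx.starIn a1 a3 b1 d1, hy.starIn a2 a4 b2 d2,
    h₁.starIn ?_ ?_ d3 d4, h₂.starIn ?_ ?_ d5 d6⟩ <;> rwa [Sym2.eq_swap]

namespace Theta

theorem apex_notMem (h : Theta G U x y v₁ v₂ v₃ s t o o' p p')
    (htri : ∀ x y z, G.Adj x y → G.Adj x z → ¬G.Adj y z) : s ∉ ({x, y, v₁, v₂, v₃} : Finset V) := by
  simp only [mem_insert, mem_singleton, not_or]
  refine ⟨h.nbs_x.adj₄.ne', ?_, h.nbs_x.ne₁₄.symm, h.nbs_x.ne₂₄.symm, h.nbs_x.ne₃₄.symm⟩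
  rintro rfl
  exact htri v₁ x s h.nbs_x.adj₁.symm h.nbs_y.adj₁.symm h.nbs_x.adj₄

theorem side_notMem (h : Theta G U x y v₁ v₂ v₃ s t o o' p p')
    (htri : ∀ x y z, G.Adj x y → G.Adj x z → ¬G.Adj y z) : o ∉ ({x, y, v₁, v₂, v₃} : Finset V) := by
  simp only [mem_insert, mem_singleton, not_or]
  refine ⟨h.nbs₁.ne₁₃.symm, h.nbs₁.ne₂₃.symm, h.nbs₁.adj₃.ne', ?_, ?_⟩ <;> rintro rfl
  · exact htri x v₁ o h.nbs_x.adj₁ h.nbs_x.adj₂ h.nbs₁.adj₃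
  · exact htri x v₁ o h.nbs_x.adj₁ h.nbs_x.adj₃ h.nbs₁.adj₃

theorem exists_notMem_of_mem_outer (h : Theta G U x y v₁ v₂ v₃ s t o o' p p')
    (htri : ∀ x y z, G.Adj x y → G.Adj x z → ¬G.Adj y z) {e : Sym2 V}
    (he : e ∈ thetaOuter x y v₁ v₂ s t o o' p p') :
    ∃ z ∈ e, z ∉ ({x, y, v₁, v₂, v₃} : Finset V) := by
  have h1 := h.apex_notMem htri
  have h2 := h.flip.apex_notMem htri
  have h3 := h.side_notMem htri
  have h4 := h.swap_left.side_notMem htri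
  have h5 := h.swap.side_notMem htri
  have h6 := h.swap.swap_left.side_notMem htri
  rw [insert_comm] at h2
  rw [insert_comm v₂ v₁] at h5 h6
  simp only [thetaOuter, mem_insert, mem_singleton] at he
  rcases he with rfl | rfl | rfl | rfl | rfl | rfl
  exacts [⟨_, Sym2.mem_mk_right _ _, h1⟩, ⟨_, Sym2.mem_mk_right _ _, h2⟩,
    ⟨_, Sym2.mem_mk_right _ _, h3⟩, ⟨_, Sym2.mem_mk_right _ _, h4⟩, ⟨_, Sym2.mem_mk_right _ _, h5⟩,
    ⟨_, Sym2.mem_mk_right _ _, h6⟩]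

theorem disjoint_outer (h : Theta G U x y v₁ v₂ v₃ s t o o' p p')
    (htri : ∀ x y z, G.Adj x y → G.Adj x z → ¬G.Adj y z) :
    Disjoint (thetaRim x y v₁ v₂ ∪ thetaPath x y v₃) (thetaOuter x y v₁ v₂ s t o o' p p') := by
  rw [disjoint_left]
  intro e he he'
  obtain ⟨z, hz, hz'⟩ := h.exists_notMem_of_mem_outer htri he'
  simp only [mem_insert, mem_singleton, not_or] at hz'
  simp only [thetaRim, thetaPath, mem_union, mem_insert, mem_singleton] at he
  rcases he with (rfl | rfl | rfl | rfl) | rfl | rfl <;> simp only [Sym2.mem_iff] at hz <;> tauto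

theorem disjoint_path (h : Theta G U x y v₁ v₂ v₃ s t o o' p p') :
    Disjoint (thetaRim x y v₁ v₂) (thetaPath x y v₃) := by
  rw [disjoint_left]
  intro e he he'
  have h3 : v₃ ∈ e := by
    simp only [thetaPath, mem_insert, mem_singleton] at he'
    rcases he' with rfl | rfl <;> exact Sym2.mem_mk_right _ _
  have n1 := h.nbs_x.adj₃.ne'
  have n2 := h.nbs_y.adj₃.ne'
  have n3 := h.nbs_x.ne₁₃.symm
  have n4 := h.nbs_x.ne₂₃.symm
  simp only [thetaRim, mem_insert, mem_singleton] at he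
  rcases he with (rfl | rfl | rfl | rfl) <;> simp only [Sym2.mem_iff] at h3 <;> tauto

theorem not_conflict_apex (h : Theta G U x y v₁ v₂ v₃ s t o o' p p')
    (htri : ∀ x y z, G.Adj x y → G.Adj x z → ¬G.Adj y z) (hst : ¬ (s = t ∨ G.Adj s t)) :
    ¬ StrongConflict G s(x, s) s(y, t) := by
  push Not at hst
  have h1 := h.apex_notMem htri
  have h2 := h.flip.apex_notMem htri
  simp only [mem_insert, mem_singleton, not_or] at h1 h2
  refine not_conflict h.ne (Ne.symm h2.2.1) h1.2.1 hst.1 (htri _ _ _ h.nbs_x.adj₁.symm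
    h.nbs_y.adj₁.symm) (fun hxt => ?_) (fun hsy => ?_) hst.2
  · have := (h.nbs_x.adj_iff t).1 hxt
    tauto
  · have := (h.nbs_y.adj_iff s).1 hsy.symm
    tauto

theorem not_conflict_side (h : Theta G U x y v₁ v₂ v₃ s t o o' p p')
    (htri : ∀ x y z, G.Adj x y → G.Adj x z → ¬G.Adj y z)
    (hcom : ∀ z, G.Adj v₁ z → G.Adj v₂ z → z = x ∨ z = y) (hop : ¬ G.Adj o p) :
    ¬ StrongConflict G s(v₁, o) s(v₂, p) := by
  have h1 := h.side_notMem htri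
  have h2 := h.swap.side_notMem htri
  simp only [mem_insert, mem_singleton, not_or] at h1 h2
  refine not_conflict h.nbs_x.ne₁₂ (Ne.symm h2.2.2.2.1) h1.2.2.2.1 ?_
    (htri _ _ _ h.nbs_x.adj₁ h.nbs_x.adj₂) (fun h' => ?_) (fun h' => ?_) hop
  · rintro rfl
    have := hcom o h.nbs₁.adj₃ h.nbs₂.adj₃
    tauto
  · have := hcom p h' h.nbs₂.adj₃
    tauto
  · have := hcom o h.nbs₁.adj₃ h'.symm
    tauto

theorem apex_ne_side (h : Theta G U x y v₁ v₂ v₃ s t o o' p p')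
    (htri : ∀ x y z, G.Adj x y → G.Adj x z → ¬G.Adj y z) : s(x, s) ≠ s(v₁, o) := by
  have h1 := h.apex_notMem htri
  simp only [mem_insert, mem_singleton, not_or] at h1
  exact mk_ne_mk h.nbs_x.adj₁.ne h1.2.2.1

end Theta

end

variable {V : Type*} [Fintype V] {G : SimpleGraph V} {U : Finset (Sym2 V)}
  {x y v₁ v₂ v₃ s t o o' p p' : V} {c : Sym2 V → Fin 21}

namespace Theta

theorem ten_le_card_avail_rim (h : Theta G U x y v₁ v₂ v₃ s t o o' p p')
    (hdeg : ∀ x, #(nb G x) ≤ 4) : ∀ e ∈ thetaRim x y v₁ v₂, 10 ≤ #(avail G U c e) := by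
  obtain ⟨D, hD, hx, hy⟩ := h.exists_common hdeg
  obtain ⟨D', hD', hx', hy'⟩ := h.swap.exists_common hdeg
  rw [insert_comm v₂ v₁] at hx' hy'
  simp only [thetaRim, mem_insert, mem_singleton]
  rintro e (rfl | rfl | rfl | rfl)
  exacts [h.le_card_avail_left hdeg (by omega) hx, h.flip.le_card_avail_left hdeg (by omega) hy,
    h.le_card_avail_left hdeg (by omega) hx', h.flip.le_card_avail_left hdeg (by omega) hy']

theorem eleven_le_card_avail_rim (h : Theta G U x y v₁ v₂ v₃ s t o o' o p')
    (hdeg : ∀ x, #(nb G x) ≤ 4) : ∀ e ∈ thetaRim x y v₁ v₂, 11 ≤ #(avail G U c e) := by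
  obtain ⟨D, hD, hx, hy⟩ := h.exists_common_of_eq hdeg
  obtain ⟨D', hD', hx', hy'⟩ := h.swap.exists_common_of_eq hdeg
  rw [insert_comm v₂ v₁] at hx' hy'
  simp only [thetaRim, mem_insert, mem_singleton]
  rintro e (rfl | rfl | rfl | rfl)
  exacts [h.le_card_avail_left hdeg (by omega) hx, h.flip.le_card_avail_left hdeg (by omega) hy,
    h.le_card_avail_left hdeg (by omega) hx', h.flip.le_card_avail_left hdeg (by omega) hy']

theorem ten_le_card_avail_path (h : Theta G U x y v₁ v₂ v₃ s t o o' p p')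
    (hdeg : ∀ x, #(nb G x) ≤ 4) : ∀ e ∈ thetaPath x y v₃, 10 ≤ #(avail G U c e) := by
  simp only [thetaPath, mem_insert, mem_singleton]
  rintro e (rfl | rfl)
  exacts [h.ten_le_card_avail₃ hdeg, h.flip.ten_le_card_avail₃ hdeg]

theorem six_le_card_avail_of_mem_outer (h : Theta G U x y v₁ v₂ v₃ s t o o' p p')
    (hdeg : ∀ x, #(nb G x) ≤ 4) :
    ∀ e ∈ thetaOuter x y v₁ v₂ s t o o' p p', 6 ≤ #(avail G U c e) := by
  simp only [thetaOuter, mem_insert, mem_singleton]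
  rintro e (rfl | rfl | rfl | rfl | rfl | rfl)
  exacts [(h.seven_le_card_avail_outer hdeg).trans' (by omega),
    (h.flip.seven_le_card_avail_outer hdeg).trans' (by omega), h.six_le_card_avail_outer hdeg,
    h.swap_left.six_le_card_avail_outer hdeg, h.swap.six_le_card_avail_outer hdeg,
    h.swap.swap_left.six_le_card_avail_outer hdeg]

theorem seven_le_card_avail_of_mem_outer (h : Theta G U x y v₁ v₂ v₃ s t o o' o p')
    (hdeg : ∀ x, #(nb G x) ≤ 4) :
    ∀ e ∈ thetaOuter x y v₁ v₂ s t o o' o p', 7 ≤ #(avail G U c e) := by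
  simp only [thetaOuter, mem_insert, mem_singleton]
  rintro e (rfl | rfl | rfl | rfl | rfl | rfl)
  exacts [h.seven_le_card_avail_outer hdeg, h.flip.seven_le_card_avail_outer hdeg,
    (h.ten_le_card_avail_common hdeg).trans' (by omega), h.seven_le_card_avail_of_common hdeg,
    (h.swap.ten_le_card_avail_common hdeg).trans' (by omega),
    h.swap.seven_le_card_avail_of_common hdeg]

end Theta

/-- Two neighbors of `v₁`, `v₂` outside the theta graph are not adjacent. -/
theorem exists_proper_of_theta (hG : G.Connected) (hdeg : ∀ x, #(nb G x) ≤ 4)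
    (htri : ∀ x y z, G.Adj x y → G.Adj x z → ¬G.Adj y z) (ne : x ≠ y) (hx : Nbs G x v₁ v₂ v₃ s)
    (hy : Nbs G y v₁ v₂ v₃ t) (h₁ : Nbs G v₁ x y o o') (h₂ : Nbs G v₂ x y p p')
    (hcom : ∀ z, G.Adj v₁ z → G.Adj v₂ z → z = x ∨ z = y) (hop : ¬ G.Adj o p) :
    ∃ c, Proper G (edges G) c := by
  have h := theta_of_nbs (U := (thetaRim x y v₁ v₂ ∪ thetaPath x y v₃) ∪
    thetaOuter x y v₁ v₂ s t o o' p p') ne hx hy h₁ h₂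
    (subset_union_left.trans subset_union_left) (subset_union_right.trans subset_union_left)
    subset_union_right
  obtain ⟨c, hc⟩ := exists_proper_sdiff hG hdeg _ h.star_x
  refine exists_proper_of_choosable hc ?_
  have m := mem_thetaRim (x := x) (y := y) (v₁ := v₁) (v₂ := v₂)
  have m' := mem_thetaOuter (x := x) (y := y) (v₁ := v₁) (v₂ := v₂) (s := s) (t := t) (o := o)
    (o' := o') (p := p) (p' := p')
  have hT : ∀ e ∈ thetaRim x y v₁ v₂ ∪ thetaPath x y v₃, 10 ≤ #(avail G
      ((thetaRim x y v₁ v₂ ∪ thetaPath x y v₃) ∪ thetaOuter x y v₁ v₂ s t o o' p p') c e) := by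
    intro e he
    rcases mem_union.1 he with he | he
    exacts [h.ten_le_card_avail_rim hdeg e he, h.ten_le_card_avail_path hdeg e he]
  have hW := h.six_le_card_avail_of_mem_outer (c := c) hdeg
  have c1 := card_union_le (thetaRim x y v₁ v₂) (thetaPath x y v₃)
  have c2 := card_thetaRim_le (x := x) (y := y) (v₁ := v₁) (v₂ := v₂)
  have c3 := card_thetaPath_le (x := x) (y := y) (v₃ := v₃)
  have c4 := card_thetaOuter_le (x := x) (y := y) (v₁ := v₁) (v₂ := v₂) (s := s) (t := t) (o := o)
    (o' := o') (p := p) (p' := p')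
  have n2 := h.not_conflict_side htri hcom hop
  have e2 : s(v₁, o) ≠ s(v₂, p) :=
    fun he => n2 (Or.inl ⟨v₁, by simp, by rw [← he]; simp⟩)
  obtain ⟨D, hD, hDx, hDy⟩ := h.exists_common hdeg
  by_cases hst : s = t ∨ G.Adj s t
  · exact choosable_of_one_pair (L := avail G ((thetaRim x y v₁ v₂ ∪ thetaPath x y v₃) ∪
      thetaOuter x y v₁ v₂ s t o o' p p') c) 10 5 (h.disjoint_outer htri) (by omega) hT
      (mem_union_left _ m.1) (mem_union_left _ m.2)
      (h.le_card_avail_union hdeg hc hst (by omega) hDx hDy) hW (by omega)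
      ⟨m'.2.2.1, m'.2.2.2, e2, n2, fun h' => n2 (conflict_symm h'),
        (Nat.add_le_add (hW _ m'.2.2.1) (hW _ m'.2.2.2) : 6 + 6 ≤ _)⟩
  · have n1 := h.not_conflict_apex htri hst
    have e1 : s(x, s) ≠ s(y, t) :=
      fun he => n1 (Or.inl ⟨x, by simp, by rw [← he]; simp⟩)
    exact choosable_of_two_pairs (L := avail G ((thetaRim x y v₁ v₂ ∪ thetaPath x y v₃) ∪
      thetaOuter x y v₁ v₂ s t o o' p p') c) 8 4 (h.disjoint_outer htri) (by omega)
      (fun e he => (hT e he).trans' (by omega)) (mem_union_left _ m.1) (mem_union_left _ m.1)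
      (by simpa using hT _ (mem_union_left _ m.1)) hW (by omega)
      ⟨m'.1, m'.2.1, e1, n1, fun h' => n1 (conflict_symm h'),
        (Nat.add_le_add (hW _ m'.1) (hW _ m'.2.1) : 6 + 6 ≤ _)⟩
      ⟨m'.2.2.1, m'.2.2.2, e2, n2, fun h' => n2 (conflict_symm h'),
        (Nat.add_le_add (hW _ m'.2.2.1) (hW _ m'.2.2.2) : 6 + 6 ≤ _)⟩
      ⟨h.apex_ne_side htri, h.swap.apex_ne_side htri, h.flip.apex_ne_side htri,
        h.flip.swap.apex_ne_side htri⟩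

/-- The vertices `v₁`, `v₂` have a common neighbor outside the theta graph. -/
theorem exists_proper_of_theta_of_common (hG : G.Connected) (hdeg : ∀ x, #(nb G x) ≤ 4)
    (htri : ∀ x y z, G.Adj x y → G.Adj x z → ¬G.Adj y z) (ne : x ≠ y) (hx : Nbs G x v₁ v₂ v₃ s)
    (hy : Nbs G y v₁ v₂ v₃ t) (h₁ : Nbs G v₁ x y o o') (h₂ : Nbs G v₂ x y o p') :
    ∃ c, Proper G (edges G) c := by
  have h := theta_of_nbs (U := thetaRim x y v₁ v₂ ∪ (thetaPath x y v₃ ∪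
    thetaOuter x y v₁ v₂ s t o o' o p')) ne hx hy h₁ h₂ subset_union_left
    (subset_union_left.trans subset_union_right) (subset_union_right.trans subset_union_right)
  obtain ⟨c, hc⟩ := exists_proper_sdiff hG hdeg _ h.star_x
  refine exists_proper_of_choosable hc ?_
  have m := mem_thetaRim (x := x) (y := y) (v₁ := v₁) (v₂ := v₂)
  have m' := mem_thetaOuter (x := x) (y := y) (v₁ := v₁) (v₂ := v₂) (s := s) (t := t) (o := o)
    (o' := o') (p := o) (p' := p')
  have hT := h.eleven_le_card_avail_rim (c := c) hdeg
  have hW : ∀ e ∈ thetaPath x y v₃ ∪ thetaOuter x y v₁ v₂ s t o o' o p', 7 ≤ #(avail G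
      (thetaRim x y v₁ v₂ ∪ (thetaPath x y v₃ ∪ thetaOuter x y v₁ v₂ s t o o' o p')) c e) := by
    intro e he
    rcases mem_union.1 he with he | he
    exacts [(h.ten_le_card_avail_path hdeg e he).trans' (by omega),
      h.seven_le_card_avail_of_mem_outer hdeg e he]
  have c1 := card_union_le (thetaPath x y v₃) (thetaOuter x y v₁ v₂ s t o o' o p')
  have c2 := card_thetaRim_le (x := x) (y := y) (v₁ := v₁) (v₂ := v₂)
  have c3 := card_thetaPath_le (x := x) (y := y) (v₃ := v₃)
  have c4 := card_thetaOuter_le (x := x) (y := y) (v₁ := v₁) (v₂ := v₂) (s := s) (t := t) (o := o)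
    (o' := o') (p := o) (p' := p')
  have c5 := card_union_le (thetaRim x y v₁ v₂) (thetaPath x y v₃ ∪
    thetaOuter x y v₁ v₂ s t o o' o p')
  have hdisj : Disjoint (thetaRim x y v₁ v₂)
      (thetaPath x y v₃ ∪ thetaOuter x y v₁ v₂ s t o o' o p') :=
    disjoint_union_right.2 ⟨h.disjoint_path,
      disjoint_of_subset_left subset_union_left (h.disjoint_outer htri)⟩
  by_cases hst : s = t ∨ G.Adj s t
  · obtain ⟨D, hD, hDx, hDy⟩ := h.exists_common_of_eq hdeg
    refine choosable_of_strong (b := 12) (by omega) (fun e he => Nat.succ_le_succ (hT e he)) m.1 m.2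
      (h.le_card_avail_union hdeg hc hst (by omega) hDx hDy) fun S hS => ?_
    rcases S.eq_empty_or_nonempty with rfl | ⟨e, he⟩
    · simp
    by_cases hS7 : #S ≤ 7
    · exact hS7.trans (card_le_card_biUnion he (hW e (hS he)))
    · obtain rfl := eq_of_subset_of_card_le hS (by omega)
      exact (card_le_card_biUnion (mem_union_right _ m'.1) (h.eight_le_card_avail_outer hdeg
        (htri _ _ _ hx.adj₁.symm hy.adj₁.symm) hst)).trans' (by omega)
  · have n1 := h.not_conflict_apex htri hst
    have e1 : s(x, s) ≠ s(y, t) :=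
      fun he => n1 (Or.inl ⟨x, by simp, by rw [← he]; simp⟩)
    have m1 := mem_union_right (thetaPath x y v₃) m'.1
    have m2 := mem_union_right (thetaPath x y v₃) m'.2.1
    exact choosable_of_one_pair (L := avail G (thetaRim x y v₁ v₂ ∪ (thetaPath x y v₃ ∪
      thetaOuter x y v₁ v₂ s t o o' o p')) c) 10 6 hdisj (by omega)
      (fun e he => (hT e he).trans' (by omega)) m.1 m.1 (by simpa using hT _ m.1) hW (by omega)
      ⟨m1, m2, e1, n1, fun h' => n1 (conflict_symm h'),
        (Nat.add_le_add (hW _ m1) (hW _ m2) : 7 + 7 ≤ _).trans' (by omega)⟩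

theorem exists_proper_of_common_three (hG : G.Connected) (hreg : ∀ x, #(nb G x) = 4)
    (htri : ∀ x y z, G.Adj x y → G.Adj x z → ¬G.Adj y z) (hK : ¬ CommonLeTwo G) :
    ∃ c, Proper G (edges G) c := by
  have hdeg : ∀ x, #(nb G x) ≤ 4 := fun x => (hreg x).le
  simp only [CommonLeTwo, not_forall] at hK
  obtain ⟨x, y, v₁, v₂, v₃, ne, n12, n13, n23, x1, x2, x3, y1, y2, y3, -⟩ := hK
  obtain ⟨s, hx⟩ := exists_nbs_of_three (hreg x) x1 x2 x3 n12 n13 n23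
  obtain ⟨t, hy⟩ := exists_nbs_of_three (hreg y) y1 y2 y3 n12 n13 n23
  have key : ∀ {a b d : V}, Nbs G x a b d s → Nbs G y a b d t →
      (∃ z, G.Adj a z ∧ G.Adj b z ∧ z ≠ x ∧ z ≠ y) → ∃ c, Proper G (edges G) c := by
    rintro a b d hx hy ⟨z, hz, hz', hzx, hzy⟩
    obtain ⟨o', h₁⟩ := exists_nbs_of_three (hreg a) hx.adj₁.symm hy.adj₁.symm hz ne hzx.symm
      hzy.symm
    obtain ⟨p', h₂⟩ := exists_nbs_of_three (hreg b) hx.adj₂.symm hy.adj₂.symm hz' ne hzx.symm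
      hzy.symm
    exact exists_proper_of_theta_of_common hG hdeg htri ne hx hy h₁ h₂
  have key' : ∀ {a b d o o' p p' : V}, Nbs G x a b d s → Nbs G y a b d t → Nbs G a x y o o' →
      Nbs G b x y p p' → ¬ G.Adj o p → ∃ c, Proper G (edges G) c := by
    intro a b d o o' p p' hx hy h₁ h₂ hop
    by_cases hcom : ∀ z, G.Adj a z → G.Adj b z → z = x ∨ z = y
    · exact exists_proper_of_theta hG hdeg htri ne hx hy h₁ h₂ hcom hop
    · push Not at hcom
      exact key hx hy hcom
  obtain ⟨o, o', h₁⟩ := exists_nbs_of_two (hreg v₁) x1.symm y1.symm ne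
  obtain ⟨p, p', h₂⟩ := exists_nbs_of_two (hreg v₂) x2.symm y2.symm ne
  obtain ⟨q, q', h₃⟩ := exists_nbs_of_two (hreg v₃) x3.symm y3.symm ne
  by_cases hop : G.Adj o p
  · by_cases hoq : G.Adj o q
    · exact key' hx.swap₁₂.swap₂₃ hy.swap₁₂.swap₂₃ h₂ h₃ (htri _ _ _ hop hoq)
    · exact key' hx.swap₂₃ hy.swap₂₃ h₁ h₃ hoq
  · exact key' hx hy h₁ h₂ hop

end

section

section
variable {V : Type*} {G : SimpleGraph V} {w : V} {u : Fin 3 → V} {a : Fin 3 → Bool → V}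

/-- Neighbors `u i` of `w`, each with two further neighbors `a i s`. -/
structure Spider (G : SimpleGraph V) (w : V) (u : Fin 3 → V) (a : Fin 3 → Bool → V) : Prop where
  adj_u : ∀ i, G.Adj w (u i)
  inj : Function.Injective u
  adj_a : ∀ i s, G.Adj (u i) (a i s)
  a_ne : ∀ i s, a i s ≠ w
  a_inj : ∀ i, Function.Injective (a i)

/-- The graph has no 3-cycles and no 4-cycles. -/
structure NoShortCycle (G : SimpleGraph V) : Prop where
  triangle : ∀ x y z, G.Adj x y → G.Adj x z → ¬G.Adj y z
  square : ∀ x y p q, G.Adj x p → G.Adj x q → G.Adj y p → G.Adj y q → p ≠ q → x = y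

namespace Spider

theorem reindex (h : Spider G w u a) {σ : Fin 3 → Fin 3} (hσ : Function.Injective σ)
    (φ : Fin 3 → Bool) : Spider G w (u ∘ σ) fun i s => a (σ i) (s ^^ φ i) where
  adj_u i := h.adj_u _
  inj := h.inj.comp hσ
  adj_a i s := h.adj_a _ _
  a_ne i s := h.a_ne _ _
  a_inj i := (h.a_inj _).comp fun s t hst => by simpa using hst

theorem u_ne_a (h : Spider G w u a) (hG : NoShortCycle G) (i j s) : u i ≠ a j s := by
  intro he
  exact hG.triangle w (u j) (u i) (h.adj_u j) (h.adj_u i) (he ▸ h.adj_a j s)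

theorem u_not_adj_u (h : Spider G w u a) (hG : NoShortCycle G) (i j) : ¬ G.Adj (u i) (u j) :=
  hG.triangle w _ _ (h.adj_u i) (h.adj_u j)

theorem u_not_adj_a (h : Spider G w u a) (hG : NoShortCycle G) {i j} (hij : i ≠ j) (s) :
    ¬ G.Adj (u i) (a j s) := fun h' =>
  h.a_ne j s (hG.square (a j s) w (u i) (u j) h'.symm (h.adj_a j s).symm (h.adj_u i) (h.adj_u j)
    (h.inj.ne hij))

theorem a_eq (h : Spider G w u a) (hG : NoShortCycle G) {i j s t} (he : a i s = a j t) :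
    i = j ∧ s = t := by
  have hij : i = j := by
    by_contra hij
    exact h.u_not_adj_a hG hij t (he ▸ h.adj_a i s)
  subst hij
  exact ⟨rfl, h.a_inj i he⟩

theorem not_conflict (h : Spider G w u a) (hG : NoShortCycle G) {i j s t} (hij : i ≠ j)
    (hst : ¬ G.Adj (a i s) (a j t)) : ¬ StrongConflict G s(u i, a i s) s(u j, a j t) :=
  StrongEdge.not_conflict (h.inj.ne hij) (h.u_ne_a hG i j t) (h.u_ne_a hG j i s).symm
    (fun he => hij (h.a_eq hG he).1) (h.u_not_adj_u hG i j) (h.u_not_adj_a hG hij t)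
    (fun h' => h.u_not_adj_a hG hij.symm s h'.symm) hst

end Spider

/-- The edge `u i, a i s` of a spider. -/
def leg (u : Fin 3 → V) (a : Fin 3 → Bool → V) (p : Fin 3 × Bool) : Sym2 V := s(u p.1, a p.1 p.2)

/-- The edges of a spider that are not at its center. -/
noncomputable def legs (u : Fin 3 → V) (a : Fin 3 → Bool → V) : Finset (Sym2 V) :=
  univ.image (leg u a)

namespace Spider

theorem leg_injective (h : Spider G w u a) (hG : NoShortCycle G) :
    Function.Injective (leg u a) := by
  rintro ⟨i, s⟩ ⟨j, t⟩ he
  rcases Sym2.eq_iff.1 he with ⟨-, he⟩ | ⟨he, -⟩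
  · exact Prod.ext_iff.2 (h.a_eq hG he)
  · exact absurd he (h.u_ne_a hG i j t)

theorem card_legs (h : Spider G w u a) (hG : NoShortCycle G) : #(legs u a) = 6 := by
  rw [legs, card_image_of_injective _ (h.leg_injective hG)]
  rfl

theorem notMem_of_mem_legs (h : Spider G w u a) {e : Sym2 V} (he : e ∈ legs u a) : w ∉ e := by
  obtain ⟨⟨i, s⟩, -, rfl⟩ := mem_image.1 he
  simp only [leg, Sym2.mem_iff, not_or]
  exact ⟨(h.adj_u i).ne, (h.a_ne i s).symm⟩

theorem card_legs_filter_le_one (h : Spider G w u a) (hG : NoShortCycle G) {x : V}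
    (hx : ∀ i, x ≠ u i) : #((legs u a).filter (x ∈ ·)) ≤ 1 := by
  rw [card_le_one]
  have key : ∀ e ∈ (legs u a).filter (x ∈ ·), ∃ i s, e = leg u a (i, s) ∧ x = a i s := by
    intro e he
    obtain ⟨he, hxe⟩ := mem_filter.1 he
    obtain ⟨⟨i, s⟩, -, rfl⟩ := mem_image.1 he
    exact ⟨i, s, rfl, (Sym2.mem_iff.1 hxe).resolve_left (hx i)⟩
  intro e he f hf
  obtain ⟨i, s, rfl, h1⟩ := key e he
  obtain ⟨j, t, rfl, h2⟩ := key f hf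
  rw [Prod.ext_iff.2 (h.a_eq hG (h1.symm.trans h2) : (i, s).1 = (j, t).1 ∧ _)]

theorem card_legs_filter_le_two (h : Spider G w u a) (hG : NoShortCycle G) (x : V) :
    #((legs u a).filter (x ∈ ·)) ≤ 2 := by
  by_cases hx : ∀ i, x ≠ u i
  · exact (h.card_legs_filter_le_one hG hx).trans (by omega)
  push Not at hx
  obtain ⟨i, rfl⟩ := hx
  refine (card_le_card (t := {leg u a (i, true), leg u a (i, false)}) fun e he => ?_).trans
    card_le_two
  obtain ⟨he, hxe⟩ := mem_filter.1 he
  obtain ⟨⟨j, s⟩, -, rfl⟩ := mem_image.1 he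
  obtain rfl : i = j := h.inj ((Sym2.mem_iff.1 hxe).resolve_right (h.u_ne_a hG i j s))
  cases s <;> simp

end Spider

end

variable {V : Type*} [Fintype V] {G : SimpleGraph V} {w : V} {u : Fin 3 → V} {a : Fin 3 → Bool → V}
  {K P : Finset (Sym2 V)} {c₀ : Sym2 V → Fin 21}

/-- Precolored edges that force the star of `v` into every saturated set. -/
structure Config (G : SimpleGraph V) (v : V) (K : Finset (Sym2 V)) (c₀ : Sym2 V → Fin 21) :
    Prop where
  proper : Proper G K c₀
  two : ∀ x, #(K.filter (x ∈ ·)) ≤ 2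
  notMem : ∀ e ∈ K, v ∉ e
  star : ∀ P, Saturated G K P c₀ → StarIn G (P ∪ K) v

theorem Saturated.mem_of_wide (h : Saturated G K P c₀) (hdeg : ∀ x, #(nb G x) ≤ 4) {x y : V}
    (hxy : G.Adj x y) {M : Finset (Sym2 V)} (hM : M ⊆ wide G x {y} ∪ wide G y {x})
    (hMP : M ⊆ P ∪ K) {C : Finset (Fin 21)} (hC : ∀ f ∈ K, c₀ f ∈ C) (hc : #C + 4 ≤ #M) :
    s(x, y) ∈ P ∪ K := by
  refine h.mem_of_card_add_le (X := (wide G x {y} ∪ wide G y {x}) \ M) (C := C) hxy ?_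
    (fun f hf _ => hC f hf) ?_
  · intro z r hzr hne hz hP hK
    refine mem_sdiff.2 ⟨?_, fun h' => ?_⟩
    · rcases mem_wide_or (X := {y}) (Y := {x}) hzr hne hz with h1 | ⟨w, hw, hw', -⟩ |
        ⟨w, hw, hw', -⟩
      · exact mem_union.2 h1
      · exact absurd (mem_singleton.1 hw) hw'
      · exact absurd (mem_singleton.1 hw) hw'
    · exact (mem_union.1 (hMP h')).elim hP hK
  · have h1 := card_sdiff_add_card_eq_card hM
    have h2 := card_wide_one hdeg hxy
    have h3 := card_wide_one hdeg hxy.symm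
    have := card_union_le (wide G x {y}) (wide G y {x})
    omega

namespace Spider

theorem legs_subset (h : Spider G w u a) (z : V) :
    legs u a ⊆ wide G w {z} ∪ wide G z {w} := by
  intro e he
  obtain ⟨⟨i, s⟩, -, rfl⟩ := mem_image.1 he
  by_cases hz : u i = z
  · subst hz
    exact mem_union_right _ (mem_union_left _ (mem_fan (h.adj_a i s) (by simpa using h.a_ne i s)))
  · exact mem_union_left _ (mem_union_right _ (mem_far (h.adj_a i s) (h.adj_u i) (by simpa using hz)
      (h.a_ne i s)))

theorem config_of_not_adj_same (h : Spider G w u a) (hG : NoShortCycle G)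
    (hdeg : ∀ x, #(nb G x) ≤ 4) (hs : ∀ i j s, i ≠ j → ¬ G.Adj (a i s) (a j s)) :
    ∃ c₀, Config G w (legs u a) c₀ := by
  have hc := (h.leg_injective hG).extend_apply (fun p => if p.2 then (0 : Fin 21) else 1)
    (fun _ => 0)
  refine ⟨Function.extend (leg u a) (fun p => if p.2 then (0 : Fin 21) else 1) fun _ => 0, ?_,
    h.card_legs_filter_le_two hG, fun e he => h.notMem_of_mem_legs he,
    fun P hP z hz => hP.mem_of_wide hdeg hz (h.legs_subset z) subset_union_right (C := {0, 1}) ?_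
      (by rw [h.card_legs hG]; rfl)⟩
  · intro e he f hf hne hcf
    obtain ⟨⟨i, s⟩, -, rfl⟩ := mem_image.1 he
    obtain ⟨⟨j, t⟩, -, rfl⟩ := mem_image.1 hf
    rw [hc, hc]
    intro hst
    have hst' : s = t := by cases s <;> cases t <;> simp_all
    subst hst'
    have hij : i ≠ j := by rintro rfl; exact hne rfl
    exact h.not_conflict hG hij (hs i j s hij) hcf
  · intro f hf
    obtain ⟨⟨j, t⟩, -, rfl⟩ := mem_image.1 hf
    rw [hc]
    cases t <;> simp

/-- The colors of the legs of a spider whose vertices `a 0 true` and `a 1 true` are adjacent. -/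
def legColor : Fin 3 × Bool → Fin 21
  | (0, true) => 0
  | (1, true) => 1
  | (2, true) => 0
  | (0, false) => 1
  | (1, false) => 0
  | (2, false) => 2

theorem config_of_not_adj_diff (h : Spider G w u a) (hG : NoShortCycle G)
    (hdeg : ∀ x, #(nb G x) ≤ 4) (hs : ∀ i j s, i ≠ j → ¬ G.Adj (a i s) (a j !s))
    (h₀₁ : G.Adj (a 0 true) (a 1 true)) (h₀₂ : ¬ G.Adj (a 0 true) (a 2 true)) :
    ∃ c₀, Config G w (insert s(a 0 true, a 1 true) (legs u a)) c₀ := by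
  have hnot : ∀ p, leg u a p ≠ s(a 0 true, a 1 true) := by
    rintro ⟨i, s⟩ he
    have : u i ∈ s(a 0 true, a 1 true) := he ▸ Sym2.mem_mk_left _ _
    rcases Sym2.mem_iff.1 this with h' | h' <;> exact h.u_ne_a hG _ _ _ h'
  have hnot' : s(a 0 true, a 1 true) ∉ legs u a := by
    intro he
    obtain ⟨p, -, hp⟩ := mem_image.1 he
    exact hnot p hp
  have hc := (h.leg_injective hG).extend_apply legColor (fun _ => 2)
  have hc' : Function.extend (leg u a) legColor (fun _ => 2) s(a 0 true, a 1 true) = 2 :=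
    Function.extend_apply' _ _ _ fun ⟨p, hp⟩ => hnot p hp
  have hnc : ∀ p, legColor p = 2 → ¬ StrongConflict G (leg u a p) s(a 0 true, a 1 true) := by
    intro p hp
    obtain rfl : p = (2, false) := by revert p; decide
    refine StrongEdge.not_conflict (h.u_ne_a hG _ _ _) (h.u_ne_a hG _ _ _)
      (fun he => ?_) (fun he => ?_) (h.u_not_adj_a hG (by decide) _)
      (h.u_not_adj_a hG (by decide) _) (hs 2 0 false (by decide)) (hs 2 1 false (by decide))
    · exact absurd (h.a_eq hG he).1 (by decide)
    · exact absurd (h.a_eq hG he).1 (by decide)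
  have hC : ∀ f ∈ insert s(a 0 true, a 1 true) (legs u a),
      Function.extend (leg u a) legColor (fun _ => 2) f ∈ ({0, 1, 2} : Finset (Fin 21)) := by
    intro f hf
    rcases mem_insert.1 hf with rfl | hf
    · rw [hc']; decide
    · obtain ⟨p, -, rfl⟩ := mem_image.1 hf
      rw [hc]
      exact (by decide : ∀ p, legColor p ∈ ({0, 1, 2} : Finset (Fin 21))) p
  refine ⟨Function.extend (leg u a) legColor fun _ => 2, ?_, fun x => ?_, fun e he => ?_,
    fun P hP => ?_⟩
  · intro e he f hf hne hcf
    rcases mem_insert.1 he with rfl | he <;> rcases mem_insert.1 hf with rfl | hf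
    · exact absurd rfl hne
    · obtain ⟨p, -, rfl⟩ := mem_image.1 hf
      rw [hc, hc']
      exact fun h' => hnc p h'.symm (conflict_symm hcf)
    · obtain ⟨p, -, rfl⟩ := mem_image.1 he
      rw [hc, hc']
      exact fun h' => hnc p h' hcf
    · obtain ⟨⟨i, s⟩, -, rfl⟩ := mem_image.1 he
      obtain ⟨⟨j, t⟩, -, rfl⟩ := mem_image.1 hf
      rw [hc, hc]
      intro hst
      have key : ∀ i j s t, legColor (i, s) = legColor (j, t) → (i = j ∧ s = t) ∨
          (i ≠ j ∧ (t = !s)) ∨ (s = true ∧ t = true ∧ (i = 0 ∧ j = 2 ∨ i = 2 ∧ j = 0)) := by decide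
      rcases key i j s t hst with ⟨rfl, rfl⟩ | ⟨hij, rfl⟩ | ⟨rfl, rfl, ⟨rfl, rfl⟩ | ⟨rfl, rfl⟩⟩
      · exact hne rfl
      · exact h.not_conflict hG hij (hs i j s hij) hcf
      · exact h.not_conflict hG (by decide) h₀₂ hcf
      · exact h.not_conflict hG (by decide) (fun h' => h₀₂ h'.symm) hcf
  · rw [filter_insert]
    split_ifs with hx
    · refine (card_insert_le _ _).trans (Nat.succ_le_succ (h.card_legs_filter_le_one hG ?_))
      rintro i rfl
      rcases Sym2.mem_iff.1 hx with h' | h' <;> exact h.u_ne_a hG _ _ _ h'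
    · exact h.card_legs_filter_le_two hG x
  · rcases mem_insert.1 he with rfl | he
    · simp only [Sym2.mem_iff, not_or]
      exact ⟨(h.a_ne _ _).symm, (h.a_ne _ _).symm⟩
    · exact h.notMem_of_mem_legs he
  · have h0 : s(w, u 0) ∈ P ∪ insert s(a 0 true, a 1 true) (legs u a) := by
      refine hP.mem_of_wide hdeg (h.adj_u 0) (insert_subset ?_ (h.legs_subset _))
        subset_union_right hC ?_
      · exact mem_union_right _ (mem_union_right _ (mem_far h₀₁ (h.adj_a 0 true)
          (by simpa using h.a_ne 0 true) (h.u_ne_a hG 0 1 true).symm))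
      · rw [card_insert_of_notMem hnot', h.card_legs hG]
        decide
    intro z hz
    by_cases hz0 : u 0 = z
    · rwa [← hz0]
    refine hP.mem_of_wide hdeg hz (M := insert s(w, u 0) (legs u a))
      (insert_subset ?_ (h.legs_subset _)) (insert_subset h0
        ((subset_insert _ _).trans subset_union_right)) hC ?_
    · exact mem_union_left _ (mem_union_left _ (mem_fan (h.adj_u 0) (by simpa using hz0)))
    · rw [card_insert_of_notMem fun h' => h.notMem_of_mem_legs h' (Sym2.mem_mk_left _ _),
        h.card_legs hG]
      decide

end Spider

end

section

theorem exists_flip {S D : Fin 3 → Fin 3 → Prop} (hS : ∀ i j, S i j → S j i)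
    (hD : ∀ i j, D i j → D j i) (hSD : ∀ i j, i ≠ j → S i j → ¬ D i j) :
    ∃ φ : Fin 3 → Bool,
      (∀ i j, i ≠ j → if φ i = φ j then ¬ S i j else ¬ D i j) ∨
      (∀ i j, i ≠ j → if φ i = φ j then ¬ D i j else ¬ S i j) := by
  have red : ∀ {Q R : Fin 3 → Fin 3 → Prop} {φ : Fin 3 → Bool}, (∀ i j, Q i j → Q j i) →
      (∀ i j, R i j → R j i) → (if φ 0 = φ 1 then ¬ Q 0 1 else ¬ R 0 1) →
      (if φ 0 = φ 2 then ¬ Q 0 2 else ¬ R 0 2) → (if φ 1 = φ 2 then ¬ Q 1 2 else ¬ R 1 2) →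
      ∀ i j, i ≠ j → if φ i = φ j then ¬ Q i j else ¬ R i j := by
    intro Q R φ hQ hR h01 h02 h12
    have symm : ∀ i j, (if φ i = φ j then ¬ Q i j else ¬ R i j) →
        if φ j = φ i then ¬ Q j i else ¬ R j i := by
      intro i j h
      by_cases hφ : φ i = φ j
      · rw [if_pos hφ] at h; rw [if_pos hφ.symm]; exact fun h' => h (hQ _ _ h')
      · rw [if_neg hφ] at h; rw [if_neg fun h' => hφ h'.symm]; exact fun h' => h (hR _ _ h')
    intro i j hij
    fin_cases i <;> fin_cases j
    exacts [absurd rfl hij, h01, h02, symm _ _ h01, absurd rfl hij, h12, symm _ _ h02,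
      symm _ _ h12, absurd rfl hij]
  have e01 := hSD 0 1 (by decide)
  have e02 := hSD 0 2 (by decide)
  have e12 := hSD 1 2 (by decide)
  suffices H : ∃ b c d : Bool,
      ((if b = c then ¬ S 0 1 else ¬ D 0 1) ∧ (if b = d then ¬ S 0 2 else ¬ D 0 2) ∧
        (if c = d then ¬ S 1 2 else ¬ D 1 2)) ∨
      ((if b = c then ¬ D 0 1 else ¬ S 0 1) ∧ (if b = d then ¬ D 0 2 else ¬ S 0 2) ∧
        (if c = d then ¬ D 1 2 else ¬ S 1 2)) by
    obtain ⟨b, c, d, ⟨h1, h2, h3⟩ | ⟨h1, h2, h3⟩⟩ := H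
    · exact ⟨![b, c, d], Or.inl (red hS hD h1 h2 h3)⟩
    · exact ⟨![b, c, d], Or.inr (red hD hS h1 h2 h3)⟩
  clear red
  by_cases s01 : S 0 1 <;> by_cases s02 : S 0 2 <;> by_cases s12 : S 1 2 <;>
    by_cases d01 : D 0 1 <;> by_cases d02 : D 0 2 <;> by_cases d12 : D 1 2 <;>
    simp_all

section
variable {V : Type*} {G : SimpleGraph V} {w : V} {u : Fin 3 → V} {a : Fin 3 → Bool → V}

namespace Spider

theorem a_adj_unique (h : Spider G w u a) (hG : NoShortCycle G) {i j s t t'}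
    (ht : G.Adj (a i s) (a j t)) (ht' : G.Adj (a i s) (a j t')) : t = t' := by
  by_contra hne
  exact h.u_ne_a hG j i s (hG.square (u j) (a i s) (a j t) (a j t') (h.adj_a j t) (h.adj_a j t') ht
    ht' ((h.a_inj j).ne hne))

theorem exists_flip (h : Spider G w u a) (hG : NoShortCycle G) : ∃ φ : Fin 3 → Bool,
    (∀ i j s, i ≠ j → ¬ G.Adj (a i (s ^^ φ i)) (a j (s ^^ φ j))) ∨
    (∀ i j s, i ≠ j → ¬ G.Adj (a i (s ^^ φ i)) (a j ((!s) ^^ φ j))) := by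
  obtain ⟨φ, hφ⟩ := StrongEdge.exists_flip (S := fun i j => ∃ s, G.Adj (a i s) (a j s))
    (D := fun i j => ∃ s, G.Adj (a i s) (a j !s)) (fun i j ⟨s, hs⟩ => ⟨s, hs.symm⟩)
    (fun i j ⟨s, hs⟩ => ⟨!s, by simpa using hs.symm⟩) (by
      rintro i j hij ⟨s, hs⟩ ⟨t, ht⟩
      by_cases hst : s = t
      · subst hst
        have := h.a_adj_unique hG hs ht
        simp at this
      · obtain rfl : t = !s := by cases s <;> cases t <;> simp_all
        rw [Bool.not_not] at ht
        have := h.a_adj_unique hG hs.symm ht.symm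
        simp at this)
  refine ⟨φ, hφ.imp (fun hφ i j s hij hadj => ?_) (fun hφ i j s hij hadj => ?_)⟩ <;>
  · have h1 := hφ i j hij
    by_cases he : φ i = φ j
    · rw [if_pos he] at h1
      rw [← he] at hadj
      exact h1 ⟨s ^^ φ i, by simpa using hadj⟩
    · rw [if_neg he] at h1
      have hj : φ j = !φ i := by cases hi : φ i <;> cases hj : φ j <;> simp_all
      rw [hj] at hadj
      exact h1 ⟨s ^^ φ i, by simpa using hadj⟩

end Spider

/-- The vertices reached from `v` by the rules that propagate saturation. -/
inductive Reached (G : SimpleGraph V) (K : Finset (Sym2 V)) (v : V) : V → Prop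
  | base : Reached G K v v
  | adj {x y : V} : Reached G K v x → (∀ e ∈ K, x ∉ e) → G.Adj x y → Reached G K v y
  | two {x₁ x₂ y : V} : Reached G K v x₁ → Reached G K v x₂ → x₁ ≠ x₂ → G.Adj x₁ y → G.Adj x₂ y →
      Reached G K v y

theorem Reached.trans_of_disjoint {K K' : Finset (Sym2 V)} {v v' : V}
    (hd : ∀ x, Reached G K v x → ∀ e ∈ K', x ∉ e) {w : V} (hw : Reached G K v w)
    (hw' : Reached G K' v' w) {x : V} (hx : Reached G K v x) : Reached G K' v' x := by
  have key : Reached G K' v' w → Reached G K' v' v := by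
    clear hw'
    induction hw with
    | base => exact id
    | adj hx _ hxy ih => exact fun h => ih (h.adj (hd _ (hx.adj ‹_› hxy)) hxy.symm)
    | two h₁ h₂ hne h₁y h₂y ih _ =>
      exact fun h => ih (h.adj (hd _ (h₁.two h₂ hne h₁y h₂y)) h₁y.symm)
  induction hx with
  | base => exact key hw'
  | adj hx _ hxy ih => exact ih.adj (hd _ hx) hxy
  | two h₁ _ _ h₁y _ ih _ => exact ih.adj (hd _ h₁) h₁y

end

variable {V : Type*} [Fintype V] {G : SimpleGraph V} {w : V} {u : Fin 3 → V} {a : Fin 3 → Bool → V}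
  {v : V} {K P : Finset (Sym2 V)} {c₀ : Sym2 V → Fin 21}

theorem Spider.exists_config (h : Spider G w u a) (hG : NoShortCycle G)
    (hdeg : ∀ x, #(nb G x) ≤ 4) : ∃ K c₀, Config G w K c₀ ∧
      ∀ e ∈ K, ∀ z ∈ e, (∃ i, z = u i) ∨ ∃ i s, z = a i s := by
  have hlegs : ∀ (σ : Fin 3 → Fin 3) (φ : Fin 3 → Bool), ∀ e ∈ legs (u ∘ σ) (fun i s => a (σ i)
      (s ^^ φ i)), ∀ z ∈ e, (∃ i, z = u i) ∨ ∃ i s, z = a i s := by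
    intro σ φ e he z hz
    obtain ⟨⟨i, s⟩, -, rfl⟩ := mem_image.1 he
    exact (Sym2.mem_iff.1 hz).imp (fun h => ⟨_, h⟩) fun h => ⟨_, _, h⟩
  obtain ⟨φ, hφ⟩ := h.exists_flip hG
  by_cases hs : ∀ i j s, i ≠ j → ¬ G.Adj (a i (s ^^ φ i)) (a j (s ^^ φ j))
  · obtain ⟨c₀, hc⟩ := (h.reindex Function.injective_id φ).config_of_not_adj_same hG hdeg hs
    exact ⟨_, c₀, hc, hlegs id φ⟩
  have hd := hφ.resolve_left hs
  push Not at hs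
  obtain ⟨i, j, s, hij, hadj⟩ := hs
  have main : ∀ {i j k : Fin 3}, i ≠ j → i ≠ k → j ≠ k →
      G.Adj (a i (s ^^ φ i)) (a j (s ^^ φ j)) → ¬ G.Adj (a i (s ^^ φ i)) (a k (s ^^ φ k)) →
      ∃ K c₀, Config G w K c₀ ∧ ∀ e ∈ K, ∀ z ∈ e, (∃ i, z = u i) ∨ ∃ i s, z = a i s := by
    intro i j k hij hik hjk h₁ h₂
    have hσ : Function.Injective ![i, j, k] := by
      intro l m hlm
      fin_cases l <;> fin_cases m <;> simp_all
    have e : ∀ l, (true ^^ ((!s) ^^ φ l)) = (s ^^ φ l) := fun l => by simp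
    obtain ⟨c₀, hc⟩ := (h.reindex hσ fun l => (!s) ^^ φ (![i, j, k] l)).config_of_not_adj_diff hG
      hdeg (fun l m t hlm => by
        have := hd _ _ (t ^^ !s) (hσ.ne hlm)
        rwa [Bool.xor_assoc, ← Bool.not_xor, Bool.xor_assoc] at this) (by
        rw [e, e]; exact h₁) (by rw [e, e]; exact h₂)
    refine ⟨_, c₀, hc, fun f hf z hz => ?_⟩
    rcases mem_insert.1 hf with rfl | hf
    · exact Or.inr ((Sym2.mem_iff.1 hz).elim (fun h => ⟨_, _, h⟩) fun h => ⟨_, _, h⟩)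
    · exact hlegs _ _ f hf z hz
  obtain ⟨k, hik, hjk⟩ : ∃ k, i ≠ k ∧ j ≠ k :=
    (by decide : ∀ i j : Fin 3, ∃ k, i ≠ k ∧ j ≠ k) i j
  by_cases h' : G.Adj (a i (s ^^ φ i)) (a k (s ^^ φ k))
  · exact main hij.symm hjk hik hadj.symm (hG.triangle _ _ _ hadj h')
  · exact main hij hik hjk hadj h'

theorem Config.starIn (h : Config G v K c₀) (hdeg : ∀ x, #(nb G x) ≤ 4) (hP : Saturated G K P c₀)
    (hKP : Disjoint K P) {x : V} (hx : Reached G K v x) : StarIn G (P ∪ K) x := by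
  induction hx with
  | base => exact h.star P hP
  | adj _ hxK hxy ih =>
    refine hP.starIn_of_adj hKP hdeg (fun q hq =>
      (mem_union.1 (ih q hq)).resolve_right fun h' => ?_) hxy
    exact hxK _ h' (Sym2.mem_mk_left _ _)
  | two _ _ hne h₁ h₂ ih₁ ih₂ => exact hP.starIn_of_adj_two hKP hdeg ih₁ ih₂ hne h₁ h₂ h.two

theorem Config.exists_proper (h : Config G v K c₀) (hdeg : ∀ x, #(nb G x) ≤ 4)
    (hv : ∀ x, Reached G K v x) : ∃ c, Proper G (edges G) c := by
  obtain ⟨P, -, hKP, hP, hc⟩ := exists_saturated K ∅ c₀ (disjoint_empty_right _) h.proper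
  simpa using hc fun e he => by
    induction e using Sym2.ind with
    | _ p q => exact h.starIn hdeg hP hKP (hv p) q (mk_mem_edges.1 he)

/-- A vertex with three neighbors in `D`, each with at most one neighbor outside `D`. -/
theorem exists_config_of_subset (hG : NoShortCycle G) (hreg : ∀ x, #(nb G x) = 4) {D : Set V}
    {u₄ : V} (hw : G.Adj w u₄) (h₄ : ∀ z, G.Adj w z → z ≠ u₄ → z ∈ D)
    (hD : ∀ x ∈ D, ∀ z z', G.Adj x z → G.Adj x z' → z ∉ D → z' ∉ D → z = z') :
    ∃ K c₀, Config G w K c₀ ∧ ∀ e ∈ K, ∀ z ∈ e, z ∈ D := by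
  obtain ⟨u₁, u₂, u₃, h⟩ := exists_nbs_of_one (hreg w) hw
  have key : ∀ x, x ∈ D → G.Adj w x → ∃ b : Bool → V, Function.Injective b ∧
      ∀ s, G.Adj x (b s) ∧ b s ≠ w ∧ b s ∈ D := by
    intro x hx hwx
    obtain ⟨p, q, r, hn⟩ := exists_nbs_of_one (hreg x) hwx.symm
    have : ∀ {p q : V}, p ≠ q → G.Adj x p → G.Adj x q → p ≠ w → q ≠ w → p ∈ D → q ∈ D →
        ∃ b : Bool → V, Function.Injective b ∧ ∀ s, G.Adj x (b s) ∧ b s ≠ w ∧ b s ∈ D := by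
      intro p q hpq hp hq hpw hqw hpD hqD
      refine ⟨fun s => cond s p q, fun s t hst => ?_, fun s => ?_⟩
      · cases s <;> cases t <;> simp_all
      · cases s
        exacts [⟨hq, hqw, hqD⟩, ⟨hp, hpw, hpD⟩]
    by_cases hp : p ∈ D
    · by_cases hq : q ∈ D
      · exact this hn.ne₂₃ hn.adj₂ hn.adj₃ hn.ne₁₂.symm hn.ne₁₃.symm hp hq
      · refine this hn.ne₂₄ hn.adj₂ hn.adj₄ hn.ne₁₂.symm hn.ne₁₄.symm hp ?_
        by_contra hr
        exact hn.ne₃₄ (hD x hx _ _ hn.adj₃ hn.adj₄ hq hr)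
    · refine this hn.ne₃₄ hn.adj₃ hn.adj₄ hn.ne₁₃.symm hn.ne₁₄.symm ?_ ?_
      · by_contra hq
        exact hn.ne₂₃ (hD x hx _ _ hn.adj₂ hn.adj₃ hp hq)
      · by_contra hr
        exact hn.ne₂₄ (hD x hx _ _ hn.adj₂ hn.adj₄ hp hr)
  have hu : ∀ i, G.Adj w (![u₁, u₂, u₃] i) ∧ ![u₁, u₂, u₃] i ∈ D := by
    intro i
    fin_cases i
    exacts [⟨h.adj₂, h₄ _ h.adj₂ h.ne₁₂.symm⟩, ⟨h.adj₃, h₄ _ h.adj₃ h.ne₁₃.symm⟩,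
      ⟨h.adj₄, h₄ _ h.adj₄ h.ne₁₄.symm⟩]
  choose b hb hb' using fun i => key _ (hu i).2 (hu i).1
  have hS : Spider G w ![u₁, u₂, u₃] b := by
    refine ⟨fun i => (hu i).1, ?_, fun i s => (hb' i s).1, fun i s => (hb' i s).2.1, hb⟩
    intro i j hij
    have := h.ne₂₃
    have := h.ne₂₄
    have := h.ne₃₄
    fin_cases i <;> fin_cases j <;> simp_all
  obtain ⟨K, c₀, hc, hK⟩ := hS.exists_config hG fun x => (hreg x).le
  refine ⟨K, c₀, hc, fun e he z hz => ?_⟩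
  rcases hK e he z hz with ⟨i, rfl⟩ | ⟨i, s, rfl⟩
  exacts [(hu i).2, (hb' i s).2.2]

theorem exists_proper_of_noShortCycle (hconn : G.Connected) (hG : NoShortCycle G)
    (hreg : ∀ x, #(nb G x) = 4) : ∃ c, Proper G (edges G) c := by
  have hdeg : ∀ x, #(nb G x) ≤ 4 := fun x => (hreg x).le
  suffices H : ∀ n v K c₀, Config G v K c₀ → #(univ.filter fun x => ¬ Reached G K v x) = n →
      ∃ c, Proper G (edges G) c by
    obtain ⟨w⟩ := hconn.nonempty
    obtain ⟨z, hz⟩ := card_pos.1 (by rw [hreg w]; omega : 0 < #(nb G w))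
    obtain ⟨K, c₀, hc, -⟩ := exists_config_of_subset hG hreg (D := Set.univ) (mem_nb.1 hz)
      (fun _ _ _ => Set.mem_univ _) fun _ _ _ _ _ _ h' => absurd (Set.mem_univ _) h'
    exact H _ w K c₀ hc rfl
  intro n
  induction n using Nat.strong_induction_on with
  | _ n ih =>
    intro v K c₀ hc hn
    by_cases hall : ∀ x, Reached G K v x
    · exact hc.exists_proper hdeg hall
    push Not at hall
    obtain ⟨x, hx⟩ := hall
    obtain ⟨u₄, hu₄, w, hw, hadj⟩ :
        ∃ u₄, Reached G K v u₄ ∧ ∃ w, ¬ Reached G K v w ∧ G.Adj u₄ w := by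
      by_contra! hno
      obtain ⟨p⟩ := hconn.preconnected v x
      have : ∀ {y z : V}, G.Walk y z → Reached G K v y → Reached G K v z := by
        intro y z p
        induction p with
        | nil => exact id
        | cons hadj _ ih =>
          exact fun hy => ih (by_contra fun h' => hno _ hy _ h' hadj)
      exact hx (this p .base)
    obtain ⟨K', c₁, hc', hK'⟩ := exists_config_of_subset hG hreg (D := {z | ¬ Reached G K v z})
      hadj.symm (fun z hz hne hzr => hw (hzr.two hu₄ hne hz.symm hadj))
      (fun x hx z z' hz hz' hzD hzD' => by
        simp only [Set.mem_ofPred_eq, not_not] at hzD hzD'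
        by_contra hne
        exact hx (hzD.two hzD' hne hz.symm hz'.symm))
    have hd : ∀ x, Reached G K v x → ∀ e ∈ K', x ∉ e := fun x hx e he hxe => hK' e he x hxe hx
    have hsub : ∀ x, Reached G K v x → Reached G K' w x := fun x hx =>
      Reached.trans_of_disjoint hd hu₄ (Reached.base.adj hc'.notMem hadj.symm) hx
    refine ih _ (hn ▸ card_lt_card ?_) w K' c₁ hc' rfl
    refine (ssubset_iff_of_subset fun x hx => ?_).2 ⟨w, by simpa using hw, by simp [Reached.base]⟩
    simp only [mem_filter, mem_univ, true_and] at hx ⊢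
    exact fun h => hx (hsub x h)

end

section

variable {V : Type*} [Fintype V] {G : SimpleGraph V}

theorem exists_proper_of_connected (hG : G.Connected) (hdeg : ∀ x, #(nb G x) ≤ 4) :
    ∃ c, Proper G (edges G) c := by
  by_cases hreg : ∀ x, 4 ≤ #(nb G x)
  · replace hreg : ∀ x, #(nb G x) = 4 := fun x => (hdeg x).antisymm (hreg x)
    by_cases htri : ∀ x y z, G.Adj x y → G.Adj x z → ¬ G.Adj y z
    · by_cases hK : CommonLeTwo G
      · by_cases hsq : ∀ x y p q, G.Adj x p → G.Adj x q → G.Adj y p → G.Adj y q → p ≠ q → x = y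
        · exact exists_proper_of_noShortCycle hG ⟨htri, hsq⟩ hreg
        · push Not at hsq
          obtain ⟨x, y, p, q, hxp, hxq, hyp, hyq, hpq, hxy⟩ := hsq
          exact exists_proper_of_four_cycle hG hreg htri hK hxp hyp.symm hyq hxq.symm hxy hpq
      · exact exists_proper_of_common_three hG hreg htri hK
    · push Not at htri
      obtain ⟨x, y, z, hxy, hxz, hyz⟩ := htri
      exact exists_proper_of_triangle hG hdeg hxy hxz hyz
  · push Not at hreg
    obtain ⟨x, hx⟩ := hreg
    exact exists_proper_of_card_lt hG hdeg (x := x) (by omega)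

theorem exists_proper_component (hdeg : ∀ x, #(nb G x) ≤ 4) (C : G.ConnectedComponent) :
    ∃ c : Sym2 V → Fin 21, ∀ e ∈ edges G, ∀ f ∈ edges G, (∀ z ∈ e, z ∈ C) → (∀ z ∈ f, z ∈ C) →
      e ≠ f → StrongConflict G e f → c e ≠ c f := by
  obtain ⟨c, hc⟩ := exists_proper_of_connected C.connected_toSimpleGraph fun x =>
    (card_le_card_of_injOn Subtype.val (t := nb G x.1) (fun y hy => by
      have hxy : C.toSimpleGraph.Adj x y := mem_nb.1 hy
      exact mem_nb.2 hxy)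
      Subtype.val_injective.injOn).trans (hdeg x.1)
  have hinj : Function.Injective (Sym2.map (Subtype.val : C → V)) :=
    Sym2.map.injective Subtype.val_injective
  have lift : ∀ e ∈ edges G, (∀ z ∈ e, z ∈ C) →
      ∃ e' ∈ edges C.toSimpleGraph, Sym2.map Subtype.val e' = e := by
    intro e he hC
    induction e using Sym2.ind with
    | _ p q =>
      have hpq : G.Adj p q := mk_mem_edges.1 he
      exact ⟨s(⟨p, hC p (Sym2.mem_mk_left _ _)⟩, ⟨q, hC q (Sym2.mem_mk_right _ _)⟩),
        mk_mem_edges.2 hpq, rfl⟩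
  refine ⟨Function.extend (Sym2.map Subtype.val) c 0, fun e he f hf heC hfC hne hcf => ?_⟩
  obtain ⟨e, he', rfl⟩ := lift e he heC
  obtain ⟨f, hf', rfl⟩ := lift f hf hfC
  rw [hinj.extend_apply, hinj.extend_apply]
  refine hc e he' f hf' (fun h => hne (h ▸ rfl)) ?_
  rcases hcf with ⟨z, hz, hz'⟩ | ⟨y, z, hy, hz, hyz⟩
  · obtain ⟨x, hx, rfl⟩ := Sym2.mem_map.1 hz
    obtain ⟨x', hx', h⟩ := Sym2.mem_map.1 hz'
    exact Or.inl ⟨x, hx, Subtype.val_injective h ▸ hx'⟩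
  · obtain ⟨y, hy', rfl⟩ := Sym2.mem_map.1 hy
    obtain ⟨z, hz', rfl⟩ := Sym2.mem_map.1 hz
    exact Or.inr ⟨y, z, hy', hz', hyz⟩

theorem exists_proper (hdeg : ∀ x, #(nb G x) ≤ 4) : ∃ c, Proper G (edges G) c := by
  choose c hc using exists_proper_component hdeg
  have comp : ∀ e ∈ edges G, ∀ z ∈ e, ∀ z' ∈ e,
      G.connectedComponentMk z = G.connectedComponentMk z' := by
    intro e he z hz z' hz'
    by_cases h : z = z'
    · rw [h]
    · rw [(Sym2.mem_and_mem_iff h).1 ⟨hz, hz'⟩] at he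
      exact SimpleGraph.ConnectedComponent.sound (mk_mem_edges.1 he).reachable
  refine ⟨fun e => c (G.connectedComponentMk (Quot.out e).1) e, fun e he f hf hne hcf => ?_⟩
  have hef : G.connectedComponentMk (Quot.out f).1 = G.connectedComponentMk (Quot.out e).1 := by
    rcases hcf with ⟨z, hz, hz'⟩ | ⟨y, z, hy, hz, hyz⟩
    · exact (comp f hf _ (Sym2.out_fst_mem f) z hz').trans
        (comp e he z hz _ (Sym2.out_fst_mem e))
    · exact (comp f hf _ (Sym2.out_fst_mem f) z hz).trans
        ((SimpleGraph.ConnectedComponent.sound hyz.symm.reachable).trans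
          (comp e he y hy _ (Sym2.out_fst_mem e)))
  simp only [hef]
  exact hc _ e he f hf (fun z hz => comp e he z hz _ (Sym2.out_fst_mem e))
    (fun z hz => (comp f hf z hz _ (Sym2.out_fst_mem f)).trans hef) hne hcf

end

end StrongEdge

/-- For a graph with maximum degree at most 4 and a vertex `v`, there is a
partial strong edge-coloring with at most 21 colors whose domain is exactly the
edges not incident to `v`. -/
theorem partial_strong_edge_coloring_avoiding_vertex {V : Type*} [Fintype V]
    (G : SimpleGraph V) [DecidableRel G.Adj]
    (hdeg : ∀ u, G.degree u ≤ 4) (v : V) :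
    ∃ C : G.edgeSet → Option (Fin 21),
      IsPartialStrongEdgeColoring G C ∧
      ∀ e : G.edgeSet, (C e).isSome ↔ v ∉ (e : Sym2 V) := by
  classical
  obtain ⟨c, hc⟩ := StrongEdge.exists_proper (G := G) fun x => by
    rw [show StrongEdge.nb G x = G.neighborFinset x by ext y; simp, G.card_neighborFinset_eq_degree]
    exact hdeg x
  refine ⟨fun e => if v ∈ (e : Sym2 V) then none else some (c e), fun e f hne hcf a he hf => ?_,
    fun e => by by_cases h : v ∈ (e : Sym2 V) <;> simp [h]⟩
  have he' : c e = a := by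
    by_cases h : v ∈ (e : Sym2 V) <;> simp_all
  have hf' : c f = a := by
    by_cases h : v ∈ (f : Sym2 V) <;> simp_all
  exact hc e (by simp) f (by simp) (fun h => hne (Subtype.ext h)) hcf (he'.trans hf'.symm)
end

section
/- Let T be a finite index set and let A assign to each element i of T a finite set A(i) of colors. For a subset S of T define the discrepancy disc(S) = |S| − |⋃_{i∈S} A(i)|. Suppose S ⊆ T attains the maximum of disc over all subsets of T, and suppose f is an injective function on S with f(i) ∈ A(i) for every i ∈ S. Then f extends to an injective function g on all of T with g(i) ∈ A(i) for every i ∈ T. -/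
/-- If `S ⊆ T` maximizes the discrepancy `|S| - |⋃_{i ∈ S} A i|` among all
subsets of `T`, then any system of distinct representatives on `S` extends to a
system of distinct representatives on all of `T`. -/
theorem sdr_extension_of_max_discrepancy {ι α : Type*} [DecidableEq ι] [DecidableEq α]
    (T : Finset ι) (A : ι → Finset α) (S : Finset ι) (hS : S ⊆ T)
    (hmax : ∀ S' ⊆ T,
      (S'.card : ℤ) - ((S'.biUnion A).card : ℤ) ≤ (S.card : ℤ) - ((S.biUnion A).card : ℤ))
    (f : ι → α) (hfinj : Set.InjOn f (S : Set ι)) (hfA : ∀ i ∈ S, f i ∈ A i) :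
    ∃ g : ι → α, Set.InjOn g (T : Set ι) ∧ (∀ i ∈ T, g i ∈ A i) ∧
      ∀ i ∈ S, g i = f i := by
  set B := S.biUnion A with hB
  obtain ⟨h, hinj, hmem⟩ :=
    (Finset.all_card_le_biUnion_card_iff_exists_injective
      (fun i : {i // i ∈ T \ S} => A i \ B)).1 fun U => by
      set V : Finset ι := U.map (Function.Embedding.subtype _) with hV
      have hVTS : ∀ i ∈ V, i ∈ T \ S := by
        intro i hi
        obtain ⟨j, -, rfl⟩ := Finset.mem_map.1 hi
        exact j.2
      have hunion : (S ∪ V).biUnion A = B ∪ U.biUnion fun i => A i \ B := by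
        rw [Finset.union_biUnion, ← hB]
        ext a
        simp only [hV, Finset.mem_union, Finset.mem_biUnion, Finset.mem_sdiff, Finset.mem_map,
          Function.Embedding.subtype_apply]
        grind
      have hdisj : Disjoint S V :=
        Finset.disjoint_right.2 fun i hi => (Finset.mem_sdiff.1 (hVTS i hi)).2
      have hle := hmax (S ∪ V)
        (Finset.union_subset hS fun i hi => (Finset.mem_sdiff.1 (hVTS i hi)).1)
      have hcard := Finset.card_union_le B (U.biUnion fun i => A i \ B)
      rw [hunion, Finset.card_union_of_disjoint hdisj, hV, Finset.card_map] at hle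
      push_cast at hle
      omega
  refine ⟨fun i => if hi : i ∈ T \ S then h ⟨i, hi⟩ else f i, ?_, ?_, ?_⟩
  · have hfB : ∀ i ∈ S, f i ∈ B := fun i hi => Finset.mem_biUnion.2 ⟨i, hi, hfA i hi⟩
    have hhB : ∀ i, h i ∉ B := fun i => (Finset.mem_sdiff.1 (hmem i)).2
    intro i hi j hj hij
    rw [Finset.mem_coe] at hi hj
    by_cases hiS : i ∈ S <;> by_cases hjS : j ∈ S <;> simp [hi, hj, hiS, hjS] at hij
    · exact hfinj hiS hjS hij
    · exact absurd (hij ▸ hfB i hiS) (hhB _)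
    · exact absurd (hij ▸ hfB j hjS) (hhB _)
    · exact congrArg Subtype.val (hinj hij)
  · intro i hi
    by_cases hiS : i ∈ S
    · simpa [hiS] using hfA i hiS
    · simpa [hi, hiS] using (Finset.mem_sdiff.1 (hmem ⟨i, Finset.mem_sdiff.2 ⟨hi, hiS⟩⟩)).1
  · intro i hi
    simp [hi]
end

section
/- Let Δ be a positive integer and let G be a Δ-regular simple graph containing no cycle of length less than 6. Then G admits a strong edge-coloring using at most 2Δ² − 3Δ + 2 colors. -/
/-- A strong edge-coloring of `G` with `k` colors: conflicting distinct edges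
receive different colors. -/
def IsStrongEdgeColoring {V : Type*} (G : SimpleGraph V) {k : ℕ}
    (C : G.edgeSet → Fin k) : Prop :=
  ∀ e f : G.edgeSet, e ≠ f → StrongConflict G (e : Sym2 V) (f : Sym2 V) → C e ≠ C f

lemma Finset.exists_coloring_of_degenerate {α : Type*} [DecidableEq α] (R : α → α → Prop)
    [DecidableRel R] (hsymm : ∀ a b, R a b → R b a) (hirr : ∀ a, ¬ R a a) (m : ℕ) (S : Finset α)
    (hS : ∀ T ⊆ S, T.Nonempty → ∃ a ∈ T, (T.filter (R a)).card ≤ m) :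
    ∃ C : α → Fin (m + 1), ∀ a ∈ S, ∀ b ∈ S, R a b → C a ≠ C b := by
  induction S using Finset.strongInduction with
  | H S ih =>
    rcases S.eq_empty_or_nonempty with rfl | hne
    · exact ⟨fun _ => 0, by simp⟩
    obtain ⟨a, ha, hcard⟩ := hS S subset_rfl hne
    obtain ⟨C, hC⟩ := ih (S.erase a) (Finset.erase_ssubset ha)
      (fun T hT => hS T (hT.trans (Finset.erase_subset _ _)))
    have hlt : ((S.filter (R a)).image C).card < (Finset.univ : Finset (Fin (m + 1))).card := by
      rw [Finset.card_fin]
      exact Nat.lt_succ_of_le (Finset.card_image_le.trans hcard)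
    obtain ⟨c, -, hc⟩ := Finset.exists_mem_notMem_of_card_lt_card hlt
    have hfree : ∀ b ∈ S, R a b → C b ≠ c := fun b hb hab h =>
      hc (Finset.mem_image.2 ⟨b, Finset.mem_filter.2 ⟨hb, hab⟩, h⟩)
    refine ⟨Function.update C a c, fun x hx y hy hxy => ?_⟩
    by_cases hxa : x = a
    · subst hxa
      have hyx : y ≠ x := fun h => hirr x (h ▸ hxy)
      simpa [Function.update_of_ne hyx] using (hfree y hy hxy).symm
    · by_cases hya : y = a
      · subst hya
        simpa [Function.update_of_ne hxa] using hfree x hx (hsymm _ _ hxy)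
      · simpa [Function.update_of_ne hxa, Function.update_of_ne hya] using
          hC x (Finset.mem_erase.2 ⟨hxa, hx⟩) y (Finset.mem_erase.2 ⟨hya, hy⟩) hxy

namespace SimpleGraph

variable {V : Type*} {G : SimpleGraph V}

lemma not_adj_of_girth_three
    (hgirth : ∀ (v : V) (c : G.Walk v v), c.IsCycle → 6 ≤ c.length) {a b c : V}
    (hab : G.Adj a b) (hbc : G.Adj b c) : ¬ G.Adj c a := fun hca => by
  have := hgirth a (.cons hab (.cons hbc (.cons hca .nil))) (by
    have := hab.ne; have := hbc.ne; have := hca.ne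
    rw [Walk.cons_isCycle_iff]
    simp [Walk.isPath_def]
    grind)
  simp at this

lemma not_adj_of_girth_four
    (hgirth : ∀ (v : V) (c : G.Walk v v), c.IsCycle → 6 ≤ c.length) {a b c d : V}
    (hab : G.Adj a b) (hbc : G.Adj b c) (hcd : G.Adj c d) (hac : a ≠ c) (hbd : b ≠ d) :
    ¬ G.Adj d a := fun hda => by
  have := hgirth a (.cons hab (.cons hbc (.cons hcd (.cons hda .nil)))) (by
    have := hab.ne; have := hbc.ne; have := hcd.ne; have := hda.ne
    rw [Walk.cons_isCycle_iff]
    simp [Walk.isPath_def]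
    grind)
  simp at this

lemma not_adj_of_girth_five
    (hgirth : ∀ (v : V) (c : G.Walk v v), c.IsCycle → 6 ≤ c.length) {a b c d e : V}
    (hab : G.Adj a b) (hbc : G.Adj b c) (hcd : G.Adj c d) (hde : G.Adj d e)
    (hac : a ≠ c) (had : a ≠ d) (hbd : b ≠ d) (hbe : b ≠ e) (hce : c ≠ e) :
    ¬ G.Adj e a := fun hea => by
  have := hgirth a (.cons hab (.cons hbc (.cons hcd (.cons hde (.cons hea .nil))))) (by
    have := hab.ne; have := hbc.ne; have := hcd.ne; have := hde.ne; have := hea.ne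
    rw [Walk.cons_isCycle_iff]
    simp [Walk.isPath_def]
    grind)
  simp at this

end SimpleGraph

lemma StrongConflict.symm {V : Type*} {G : SimpleGraph V} {e f : Sym2 V}
    (h : StrongConflict G e f) : StrongConflict G f e := by
  rcases h with ⟨v, h1, h2⟩ | ⟨u, v, h1, h2, h3⟩
  · exact .inl ⟨v, h2, h1⟩
  · exact .inr ⟨v, u, h2, h1, h3.symm⟩

/-- Edges hanging from distinct neighbours of a common vertex do not conflict when the girth is
at least six. -/
lemma not_strongConflict_of_common_neighbor {V : Type*} {G : SimpleGraph V}
    (hgirth : ∀ (v : V) (c : G.Walk v v), c.IsCycle → 6 ≤ c.length) {v w w' x x' : V}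
    (hw : G.Adj v w) (hw' : G.Adj v w') (hne : w ≠ w') (hx : G.Adj w x) (hx' : G.Adj w' x')
    (hxv : x ≠ v) (hxv' : x' ≠ v) : ¬ StrongConflict G s(w, x) s(w', x') := by
  have h3 : ¬ G.Adj w w' := fun h => G.not_adj_of_girth_three hgirth hw h hw'.symm
  have h1 : w ≠ x' := by rintro rfl; exact h3 hx'.symm
  have h2 : x ≠ w' := by rintro rfl; exact h3 hx
  have h4 : ¬ G.Adj x w' := fun h =>
    G.not_adj_of_girth_four hgirth hw hx h hxv.symm hne hw'.symm
  have h5 : ¬ G.Adj w x' := fun h =>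
    G.not_adj_of_girth_four hgirth hw' hx' h.symm hxv'.symm hne.symm hw.symm
  have h6 : x ≠ x' := by rintro rfl; exact h4 hx'.symm
  have h7 : ¬ G.Adj x x' := fun h =>
    G.not_adj_of_girth_five hgirth hw hx h hx'.symm hxv.symm hxv'.symm h1 hne h2 hw'.symm
  rintro (⟨z, hz, hz'⟩ | ⟨a, b, ha, hb, hab⟩)
  all_goals grind

/-- In a graph of maximum degree at most `Δ`, every edge conflicts with at most `2Δ(Δ - 1)`
others. -/
lemma card_filter_strongConflict_le {V : Type*} [Fintype V] [DecidableEq V] (Δ : ℕ)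
    (G : SimpleGraph V) [DecidableRel G.Adj] (hdeg : ∀ v, G.degree v ≤ Δ)
    [∀ e, DecidablePred (fun f => e ≠ f ∧ StrongConflict G e f)]
    {e : Sym2 V} (he : e ∈ G.edgeFinset) :
    (G.edgeFinset.filter (fun f => e ≠ f ∧ StrongConflict G e f)).card ≤
      2 * ((Δ - 1) * Δ) := by
  induction e using Sym2.ind with
  | _ u v =>
  have huv : G.Adj u v := by simpa using he
  have hsub : G.edgeFinset.filter (fun f => s(u, v) ≠ f ∧ StrongConflict G s(u, v) f) ⊆
      ((G.neighborFinset u).erase v).biUnion (fun x => G.incidenceFinset x) ∪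
      ((G.neighborFinset v).erase u).biUnion (fun x => G.incidenceFinset x) := by
    intro f hf
    induction f using Sym2.ind with
    | _ a b =>
    simp only [Finset.mem_filter, SimpleGraph.mem_edgeFinset, SimpleGraph.mem_edgeSet] at hf
    obtain ⟨hab, hne, h⟩ := hf
    simp only [Finset.mem_union, Finset.mem_biUnion, Finset.mem_erase,
      SimpleGraph.mem_neighborFinset, SimpleGraph.mem_incidenceFinset,
      SimpleGraph.incidenceSet, Set.mem_sep_iff,
      SimpleGraph.mem_edgeSet, Sym2.mem_iff]
    simp only [StrongConflict, Sym2.mem_iff] at h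
    have hba := hab.symm
    have hvu := huv.symm
    rw [Ne, Sym2.eq_iff] at hne
    grind
  have hbound : ∀ x y, G.Adj x y →
      (((G.neighborFinset x).erase y).biUnion (fun z => G.incidenceFinset z)).card ≤
        (Δ - 1) * Δ := by
    intro x y hxy
    refine (Finset.card_biUnion_le_card_mul _ _ Δ fun z _ => ?_).trans ?_
    · rw [G.card_incidenceFinset_eq_degree]; exact hdeg z
    · refine Nat.mul_le_mul_right _ ?_
      rw [Finset.card_erase_of_mem (by simpa using hxy), G.card_neighborFinset_eq_degree]
      exact Nat.sub_le_sub_right (hdeg x) 1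
  have := (Finset.card_le_card hsub).trans (Finset.card_union_le _ _)
  have := hbound u v huv
  have := hbound v u huv.symm
  omega

/-- In a `Δ`-regular graph of girth at least six there are pairwise non-conflicting edges `P` and
a rank `ρ` such that each edge outside `P` conflicts with `Δ` edges in `P` or of smaller rank. -/
lemma exists_independent_and_rank {V : Type*} [Fintype V] [DecidableEq V]
    (Δ : ℕ) (hΔ : 1 < Δ) (G : SimpleGraph V) [DecidableRel G.Adj]
    (hreg : ∀ v, G.degree v = Δ)
    (hgirth : ∀ (v : V) (c : G.Walk v v), c.IsCycle → 6 ≤ c.length) :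
    ∃ P : Finset (Sym2 V),
      (∀ e ∈ P, ∀ f ∈ P, e ≠ f → ¬ StrongConflict G e f) ∧
      ∃ ρ : Sym2 V → ℕ, ∀ e ∈ G.edgeFinset, e ∉ P →
        ∃ D : Finset (Sym2 V), D.card = Δ ∧ ∀ f ∈ D,
          f ∈ G.edgeFinset ∧ e ≠ f ∧ StrongConflict G e f ∧ (f ∈ P ∨ ρ f < ρ e) := by
  obtain ⟨root, hroot, hrootadj⟩ : ∃ root : V → V, (∀ v, G.Reachable (root v) v) ∧
      ∀ v w, G.Adj v w → root v = root w := by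
    refine ⟨fun v => (G.connectedComponentMk v).out, fun v => ?_, fun v w h => ?_⟩
    · exact SimpleGraph.ConnectedComponent.exact (Quot.out_eq _)
    · have : G.connectedComponentMk v = G.connectedComponentMk w :=
        SimpleGraph.ConnectedComponent.sound h.reachable
      simp only [this]
  have hchild : ∀ w, ∃ x, G.Adj w x ∧ x ≠ root w := by
    intro w
    obtain ⟨x, hx, hne⟩ := Finset.exists_mem_ne
      (by rw [G.card_neighborFinset_eq_degree, hreg]; exact hΔ) (s := G.neighborFinset w) (root w)
    exact ⟨x, by simpa using hx, hne⟩
  choose child hchild hchildne using hchild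
  have hP : ∀ e, e ∈ (Finset.univ.filter (fun w => G.Adj (root w) w)).image
      (fun w => s(w, child w)) ↔ ∃ w, G.Adj (root w) w ∧ s(w, child w) = e := by simp
  refine ⟨(Finset.univ.filter (fun w => G.Adj (root w) w)).image (fun w => s(w, child w)),
    ?_, ?_⟩
  · intro e he f hf hne h
    rw [hP] at he hf
    obtain ⟨w, hw, rfl⟩ := he
    obtain ⟨w', hw', rfl⟩ := hf
    have hww : w ≠ w' := by rintro rfl; exact hne rfl
    have hr : root w = root w' := by
      have := hrootadj _ _ (hchild w)
      have := hrootadj _ _ (hchild w')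
      rcases h with ⟨z, hz, hz'⟩ | ⟨a, b, ha, hb, hab⟩
      · grind
      · have := hrootadj _ _ hab
        grind
    exact not_strongConflict_of_common_neighbor hgirth hw (hr ▸ hw') hww (hchild w) (hchild w')
      (hchildne w) (hr ▸ hchildne w') h
  · let d : V → ℕ := fun v => G.dist (root v) v
    refine ⟨Sym2.lift ⟨fun a b => min (d a) (d b), fun a b => min_comm _ _⟩, fun e he _ => ?_⟩
    obtain ⟨x, y, hxy, hle, rfl⟩ : ∃ x y, G.Adj x y ∧ d x ≤ d y ∧ s(x, y) = e := by
      induction e using Sym2.ind with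
      | _ a b =>
      have hab : G.Adj a b := by simpa using he
      rcases le_total (d a) (d b) with h | h
      · exact ⟨a, b, hab, h, rfl⟩
      · exact ⟨b, a, hab.symm, h, Sym2.eq_swap⟩
    rcases Nat.eq_zero_or_pos (d x) with h0 | hpos
    · have hx : root x = x := (hroot x).dist_eq_zero_iff.1 h0
      have hrx : ∀ w, G.Adj x w → root w = x := fun w hw => (hrootadj _ _ hw).symm.trans hx
      refine ⟨(G.neighborFinset x).image (fun w => s(w, child w)), ?_, ?_⟩
      · rw [Finset.card_image_of_injOn, G.card_neighborFinset_eq_degree, hreg]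
        intro w hw w' hw' heq
        have hw : G.Adj x w := by simpa using hw
        have hw' : G.Adj x w' := by simpa using hw'
        rcases Sym2.eq_iff.1 heq with ⟨h, -⟩ | ⟨-, h⟩
        · exact h
        · exact absurd hw'.symm (G.not_adj_of_girth_three hgirth hw (h ▸ hchild w))
      · intro f hf
        obtain ⟨w, hw, rfl⟩ := Finset.mem_image.1 hf
        have hw : G.Adj x w := by simpa using hw
        refine ⟨by simpa using hchild w, fun h => ?_, .inr ⟨x, w, by simp, by simp, hw⟩,
          .inl ((hP _).2 ⟨w, by rwa [hrx w hw], rfl⟩)⟩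
        have := hchildne w
        rw [hrx w hw] at this
        have := hw.ne
        rw [Sym2.eq_iff] at h
        grind
    · obtain ⟨p, hpx, hp⟩ : ∃ p, G.Adj p x ∧ d p < d x := by
        obtain ⟨q, hq⟩ := (hroot x).symm.exists_walk_length_eq_dist
        simp only [d] at hpos ⊢
        have hrx : ∀ p, G.Adj x p → root p = root x := fun p h => (hrootadj _ _ h).symm
        generalize root x = r at q hq hpos hrx
        cases q with
        | nil => simp at hpos
        | @cons _ p _ h q =>
          refine ⟨p, h.symm, ?_⟩
          have h1 := SimpleGraph.dist_le q
          simp only [SimpleGraph.Walk.length_cons] at hq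
          rw [hrx p h, G.dist_comm, G.dist_comm (u := r)]
          omega
      refine ⟨G.incidenceFinset p, by rw [G.card_incidenceFinset_eq_degree, hreg], ?_⟩
      intro f hf
      rw [SimpleGraph.mem_incidenceFinset] at hf
      obtain ⟨hfe, hpf⟩ := hf
      refine ⟨by simpa using hfe, ?_, .inr ⟨x, p, by simp, hpf, hpx.symm⟩, .inr ?_⟩
      · rintro rfl
        rcases Sym2.mem_iff.1 hpf with rfl | rfl <;> omega
      · obtain ⟨q, rfl⟩ := Sym2.mem_iff_exists.1 hpf
        simp only [Sym2.lift_mk]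
        omega

/-- For `Δ ≥ 1`, a `Δ`-regular graph with no cycle of length less than 6 has a
strong edge-coloring with at most `2Δ² - 3Δ + 2` colors. -/
theorem strong_edge_coloring_regular_girth_ge_6 {V : Type*} [Fintype V]
    (Δ : ℕ) (hΔ : 1 ≤ Δ) (G : SimpleGraph V) [DecidableRel G.Adj]
    (hreg : ∀ v, G.degree v = Δ)
    (hgirth : ∀ (v : V) (c : G.Walk v v), c.IsCycle → 6 ≤ c.length) :
    ∃ C : G.edgeSet → Fin (2 * Δ ^ 2 + 2 - 3 * Δ), IsStrongEdgeColoring G C := by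
  classical
  have hdeg := fun e he => card_filter_strongConflict_le (e := e) Δ G (fun v => (hreg v).le) he
  rcases hΔ.eq_or_lt with rfl | hΔ2
  · refine ⟨fun _ => ⟨0, by norm_num⟩, fun e f hne h => ?_⟩
    have h0 := hdeg e (by simp)
    simp only [Nat.sub_self, zero_mul, mul_zero, Nat.le_zero, Finset.card_eq_zero] at h0
    have hf : (f : Sym2 V) ∈
        G.edgeFinset.filter (fun f => (e : Sym2 V) ≠ f ∧ StrongConflict G e f) :=
      Finset.mem_filter.2 ⟨by simp, fun h => hne (Subtype.ext h), h⟩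
    simp [h0] at hf
  obtain ⟨P, hPind, ρ, hlater⟩ := exists_independent_and_rank Δ hΔ2 G hreg hgirth
  set m := 2 * ((Δ - 1) * Δ) - Δ with hm
  have hk : 2 * Δ ^ 2 + 2 - 3 * Δ = m + 1 + 1 := by
    obtain ⟨n, rfl⟩ : ∃ n, Δ = n + 2 := ⟨Δ - 2, by omega⟩
    simp only [show n + 2 - 1 = n + 1 by omega] at hm
    have h1 : 2 * (n + 2) ^ 2 = 2 * n ^ 2 + 8 * n + 8 := by ring
    have h2 : 2 * ((n + 1) * (n + 2)) = 2 * n ^ 2 + 6 * n + 4 := by ring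
    omega
  rw [hk]
  obtain ⟨C, hC⟩ := Finset.exists_coloring_of_degenerate
    (fun e f => e ≠ f ∧ StrongConflict G e f)
    (fun _ _ h => ⟨h.1.symm, h.2.symm⟩) (fun _ h => h.1 rfl) m (G.edgeFinset \ P) (by
      intro T hT hne
      obtain ⟨e, heT, hmin⟩ := T.exists_min_image ρ hne
      have he := Finset.mem_sdiff.1 (hT heT)
      refine ⟨e, heT, ?_⟩
      obtain ⟨D, hDcard, hD⟩ := hlater e he.1 he.2
      have hDsub : D ⊆ G.edgeFinset.filter (fun f => e ≠ f ∧ StrongConflict G e f) :=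
        fun f hf => Finset.mem_filter.2 ⟨(hD f hf).1, (hD f hf).2.1, (hD f hf).2.2.1⟩
      have hsub : T.filter (fun f => e ≠ f ∧ StrongConflict G e f) ⊆
          G.edgeFinset.filter (fun f => e ≠ f ∧ StrongConflict G e f) \ D := by
        intro f hf
        obtain ⟨hfT, hef⟩ := Finset.mem_filter.1 hf
        have hf' := Finset.mem_sdiff.1 (hT hfT)
        refine Finset.mem_sdiff.2 ⟨Finset.mem_filter.2 ⟨hf'.1, hef⟩, fun hfD => ?_⟩
        rcases (hD f hfD).2.2.2 with h | h
        · exact hf'.2 h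
        · exact (hmin f hfT).not_gt h
      have h1 := Finset.card_le_card hsub
      rw [Finset.card_sdiff_of_subset hDsub] at h1
      have h2 := hdeg e he.1
      omega)
  refine ⟨fun e => if (e : Sym2 V) ∈ P then 0 else (C e).succ, fun e f hne h => ?_⟩
  have hne' : (e : Sym2 V) ≠ f := fun h => hne (Subtype.ext h)
  by_cases heP : (e : Sym2 V) ∈ P <;> by_cases hfP : (f : Sym2 V) ∈ P
  · exact absurd h (hPind _ heP _ hfP hne')
  · simp [heP, hfP, (Fin.succ_ne_zero _).symm]
  · simp [heP, hfP]
  · simpa [heP, hfP] using hC e (by simp [heP]) f (by simp [hfP]) ⟨hne', h⟩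
end

section
/- Let G be the simple graph on vertex set {0,1,...,9} obtained from a 5-cycle on vertices p₀,…,p₄ by replacing each vertex pᵢ with two nonadjacent vertices, where the two copies of pᵢ are each adjacent to both copies of p_{i−1} and both copies of p_{i+1} (indices mod 5). Then G is 4-regular, has exactly 20 edges, and every strong edge-coloring of G assigns pairwise distinct colors to all 20 edges; in particular, every strong edge-coloring of G uses at least 20 colors. -/
/-- Any two edges of a 5-cycle are joined by an edge of the cycle. -/
theorem exists_adj_between_edges_of_five_cycle : ∀ a b c d : Fin 5,
    (a = b + 1 ∨ b = a + 1) → (c = d + 1 ∨ d = c + 1) →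
      (a = c + 1 ∨ c = a + 1) ∨ (a = d + 1 ∨ d = a + 1) ∨
        (b = c + 1 ∨ c = b + 1) ∨ (b = d + 1 ∨ d = b + 1) := by
  decide

/-- Any two edges of a blow-up of the 5-cycle conflict. -/
theorem strongConflict_of_adj_iff {α : Type*} {G : SimpleGraph (Fin 5 × α)}
    (hG : ∀ x y : Fin 5 × α, G.Adj x y ↔ (x.1 = y.1 + 1 ∨ y.1 = x.1 + 1))
    {e f : Sym2 (Fin 5 × α)} (he : e ∈ G.edgeSet) (hf : f ∈ G.edgeSet) :
    StrongConflict G e f := by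
  induction e with | _ a b
  induction f with | _ c d
  rw [SimpleGraph.mem_edgeSet, hG] at he hf
  right
  rcases exists_adj_between_edges_of_five_cycle _ _ _ _ he hf with h | h | h | h
  · exact ⟨a, c, by simp, by simp, (hG _ _).2 h⟩
  · exact ⟨a, d, by simp, by simp, (hG _ _).2 h⟩
  · exact ⟨b, c, by simp, by simp, (hG _ _).2 h⟩
  · exact ⟨b, d, by simp, by simp, (hG _ _).2 h⟩

/-- The Erdős–Nešetřil construction for `Δ = 4`: the graph on `Fin 5 × Fin 2`
(two nonadjacent copies of each vertex of a 5-cycle, each copy adjacent to both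
copies of the neighbors on the cycle) is 4-regular, has exactly 20 edges, every
strong edge-coloring of it is injective on edges, and hence every strong
edge-coloring of it uses at least 20 colors. -/
theorem erdos_nesetril_graph_needs_20_colors (G : SimpleGraph (Fin 5 × Fin 2))
    [DecidableRel G.Adj]
    (hG : ∀ x y : Fin 5 × Fin 2, G.Adj x y ↔ (x.1 = y.1 + 1 ∨ y.1 = x.1 + 1)) :
    (∀ v, G.degree v = 4) ∧
    G.edgeFinset.card = 20 ∧
    (∀ (k : ℕ) (C : G.edgeSet → Fin k),
      IsStrongEdgeColoring G C → Function.Injective C) ∧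
    (∀ (k : ℕ) (C : G.edgeSet → Fin k), IsStrongEdgeColoring G C → 20 ≤ k) := by
  have hdeg : ∀ v, G.degree v = 4 := by
    intro v
    have hN : G.neighborFinset v =
        Finset.univ.filter fun w : Fin 5 × Fin 2 => v.1 = w.1 + 1 ∨ w.1 = v.1 + 1 := by
      ext w
      simp [hG]
    rw [← G.card_neighborFinset_eq_degree, hN]
    clear hN
    revert v
    decide
  have hcard : G.edgeFinset.card = 20 := by
    have h := G.sum_degrees_eq_twice_card_edges
    simp only [hdeg, Finset.sum_const, Finset.card_univ, Fintype.card_prod, Fintype.card_fin,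
      smul_eq_mul] at h
    omega
  have hinj : ∀ (k : ℕ) (C : G.edgeSet → Fin k),
      IsStrongEdgeColoring G C → Function.Injective C := by
    intro k C hC e f hef
    by_contra hne
    exact hC e f hne (strongConflict_of_adj_iff hG e.2 f.2) hef
  refine ⟨hdeg, hcard, hinj, fun k C hC => ?_⟩
  have h := Fintype.card_le_of_injective C (hinj k C hC)
  rwa [Fintype.card_fin, ← G.edgeFinset_card, hcard] at h
end
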